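/- arXiv:1906.08153 — 8 statements merged into one kernel-verified Lean document; each statement's English description precedes it below -/
import Mathlib

section
/- The operator U satisfies U^m = Id_{V⊗V}, and on V⊗V⊗V the operators U₁ = U ⊗ Id_V and U₂ = Id_V ⊗ U satisfy U₁ U₂ = q² U₂ U₁. Hence u_i ↦ Id^{⊗(i−1)} ⊗ U ⊗ Id^{⊗(n−i−1)} defines a local representation of the defining relations u_i^m = 1, u_i u_{i+1} = q² u_{i+1} u_i, u_i u_j = u_j u_i (|i−j| ≥ 2) on V^{⊗n}. -/
/-!
STATEMENT 3: With V = ℂ^{ℤ/mℤ} and U(e_i ⊗ e_j) = q^{j−i} e_{i+1} ⊗ e_{j+1},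
the operator U satisfies U^m = Id, the operators U₁ = U ⊗ Id, U₂ = Id ⊗ U on
V⊗V⊗V satisfy U₁U₂ = q² U₂U₁, and more generally
u_i ↦ Id^{⊗(i−1)} ⊗ U ⊗ Id^{⊗(n−i−1)} defines a local representation of the
defining relations u_i^m = 1, u_i u_{i+1} = q² u_{i+1} u_i,
u_i u_j = u_j u_i (|i−j| ≥ 2) on V^{⊗n}.

We model V^{⊗n} as the function space (Fin n → ℤ/mℤ) → ℂ (with basis the delta
functions e_{x₁} ⊗ ⋯ ⊗ e_{xₙ}), and `Op m q n i` (1 ≤ i ≤ n−1) is the operator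
Id^{⊗(i−1)} ⊗ U ⊗ Id^{⊗(n−i−1)}, acting on the tensor slots i−1, i
(zero-indexed).
-/

namespace Stmt3

/-- Entry of `x : Fin n → ZMod m` at a natural-number position (0 outside range). -/
def get {m n : ℕ} (x : Fin n → ZMod m) (j : ℕ) : ZMod m :=
  if h : j < n then x ⟨j, h⟩ else 0

/-- The operator `Id^{⊗(i−1)} ⊗ U ⊗ Id^{⊗(n−i−1)}` on V^{⊗n} (for 1 ≤ i ≤ n−1),
where `U(e_a ⊗ e_b) = q^{b−a} e_{a+1} ⊗ e_{b+1}`: in the dual (function) picture,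
`(Op f)(x) = q^{x_i − x_{i−1}} f(x with slots i−1, i decremented)`. -/
noncomputable def Op (m : ℕ) (q : ℂ) (n : ℕ) (i : ℕ) :
    Module.End ℂ ((Fin n → ZMod m) → ℂ) where
  toFun f := fun x =>
    q ^ ((get x i - get x (i - 1)).val) *
      f (fun j => if (j : ℕ) = i - 1 ∨ (j : ℕ) = i then x j - 1 else x j)
  map_add' f g := by
    funext x
    simp [mul_add]
  map_smul' c f := by
    funext x
    simp only [Pi.smul_apply, smul_eq_mul, RingHom.id_apply]
    ring

theorem pw_add {m : ℕ} [NeZero m] {q : ℂ} (hq : q ^ m = 1) (a b : ZMod m) :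
    q ^ (a + b).val = q ^ a.val * q ^ b.val := by
  rw [ZMod.val_add, ← pow_add, ← pow_eq_pow_mod _ hq]

theorem pw_one {m : ℕ} (hm : 3 ≤ m) (q : ℂ) : q ^ (1 : ZMod m).val = q := by
  have : Fact (1 < m) := ⟨by omega⟩
  rw [ZMod.val_one, pow_one]

theorem Op_apply (m : ℕ) (q : ℂ) (n i : ℕ) (f : (Fin n → ZMod m) → ℂ) (x : Fin n → ZMod m) :
    Op m q n i f x = q ^ ((get x i - get x (i - 1)).val) *
      f (fun j => if (j : ℕ) = i - 1 ∨ (j : ℕ) = i then x j - 1 else x j) := rfl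

theorem Op_pow_apply (m : ℕ) (q : ℂ) (n i : ℕ) (hi : 1 ≤ i) (hn : i ≤ n - 1) (k : ℕ)
    (f : (Fin n → ZMod m) → ℂ) (x : Fin n → ZMod m) :
    (Op m q n i ^ k) f x = (q ^ ((get x i - get x (i - 1)).val)) ^ k *
      f (fun j => if (j : ℕ) = i - 1 ∨ (j : ℕ) = i then x j - k else x j) := by
  induction k generalizing x with
  | zero => simp
  | succ k ih =>
    rw [pow_succ', Module.End.mul_apply, Op_apply, ih, pow_succ', ← mul_assoc]
    have h1 : i < n := by omega
    have h2 : i - 1 < n := by omega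
    congr 1
    · simp [get, h1, h2]
    · congr 1
      funext j
      by_cases h : (j : ℕ) = i - 1 ∨ (j : ℕ) = i
      · simp only [h, if_true]
        push_cast
        ring
      · simp only [h, if_false]

theorem Op_pow (m : ℕ) (q : ℂ) (hq : q ^ m = 1) (n i : ℕ) (hi : 1 ≤ i) (hn : i ≤ n - 1) :
    Op m q n i ^ m = 1 := by
  ext1 f
  funext x
  rw [Op_pow_apply m q n i hi hn, ← pow_mul, mul_comm _ m, pow_mul, hq]
  simp

theorem Op_adj (m : ℕ) (hm : 3 ≤ m) (q : ℂ) (hq : q ^ m = 1) (n i : ℕ) (hi : 1 ≤ i)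
    (hn : i + 1 ≤ n - 1) :
    Op m q n i * Op m q n (i + 1) = q ^ 2 • (Op m q n (i + 1) * Op m q n i) := by
  have : NeZero m := ⟨by omega⟩
  refine LinearMap.ext fun f => funext fun x => ?_
  rw [LinearMap.smul_apply, Pi.smul_apply, smul_eq_mul, Module.End.mul_apply,
    Module.End.mul_apply, Op_apply, Op_apply, Op_apply, Op_apply, ← mul_assoc, ← mul_assoc,
    ← mul_assoc]
  have h0 : i + 1 < n := by omega
  have h1 : i < n := by omega
  have h2 : i - 1 < n := by omega
  have e1 : ¬ (i + 1 = i - 1) := by omega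
  have e2 : ¬ (i - 1 = i) := by omega
  have e3 : ¬ (i - 1 = i + 1) := by omega
  congr 1
  · simp only [get, h0, h1, h2, dif_pos, Nat.add_sub_cancel, e1, e2, e3, or_true, true_or,
      or_false, if_true, if_false, Nat.succ_ne_self]
    generalize x ⟨i - 1, h2⟩ = a
    generalize x ⟨i, h1⟩ = b
    generalize x ⟨i + 1, h0⟩ = c
    have E1 : b - a = (b - 1 - a) + 1 := by ring
    have E2 : c - (b - 1) = (c - b) + 1 := by ring
    rw [E1, E2, pw_add hq, pw_add hq, pw_one hm]
    ring
  · congr 1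
    funext j
    split_ifs <;> first | rfl | ring

theorem Op_far (m : ℕ) (q : ℂ) (n i j : ℕ) (hi : 1 ≤ i) (hj : 1 ≤ j) (hin : i ≤ n - 1)
    (hjn : j ≤ n - 1) (hij : 2 ≤ |(i : ℤ) - (j : ℤ)|) :
    Op m q n i * Op m q n j = Op m q n j * Op m q n i := by
  refine LinearMap.ext fun f => funext fun x => ?_
  rw [Module.End.mul_apply,
    Module.End.mul_apply, Op_apply, Op_apply, Op_apply, Op_apply, ← mul_assoc, ← mul_assoc]
  have hij' : i + 2 ≤ j ∨ j + 2 ≤ i := by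
    rcases le_abs.mp hij with h | h <;> omega
  have a1 : i < n := by omega
  have a2 : i - 1 < n := by omega
  have a3 : j < n := by omega
  have a4 : j - 1 < n := by omega
  have b1 : ¬ (i = j - 1 ∨ i = j) := by omega
  have b2 : ¬ (i - 1 = j - 1 ∨ i - 1 = j) := by omega
  have b3 : ¬ (j = i - 1 ∨ j = i) := by omega
  have b4 : ¬ (j - 1 = i - 1 ∨ j - 1 = i) := by omega
  congr 1
  · simp only [get, a1, a2, a3, a4, dif_pos, b1, b2, b3, b4, if_false]
    ring
  · congr 1
    funext k
    split_ifs <;> first | rfl | ring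

theorem statement3 (m : ℕ) (hm : 3 ≤ m) (hodd : Odd m) (q : ℂ)
    (hq : IsPrimitiveRoot q m) (n : ℕ) :
    (Op m q 2 1 ^ m = 1) ∧
    (Op m q 3 1 * Op m q 3 2 = q ^ 2 • (Op m q 3 2 * Op m q 3 1)) ∧
    (∀ i : ℕ, 1 ≤ i → i ≤ n - 1 → Op m q n i ^ m = 1) ∧
    (∀ i : ℕ, 1 ≤ i → i + 1 ≤ n - 1 →
      Op m q n i * Op m q n (i + 1) = q ^ 2 • (Op m q n (i + 1) * Op m q n i)) ∧
    (∀ i j : ℕ, 1 ≤ i → 1 ≤ j → i ≤ n - 1 → j ≤ n - 1 →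
      2 ≤ |(i : ℤ) - (j : ℤ)| → Op m q n i * Op m q n j = Op m q n j * Op m q n i) := by
  have h1 := hq.pow_eq_one
  exact ⟨Op_pow m q h1 2 1 le_rfl le_rfl, Op_adj m hm q h1 3 1 le_rfl le_rfl,
    fun i => Op_pow m q h1 n i, fun i => Op_adj m hm q h1 n i, fun i j => Op_far m q n i j⟩

end Stmt3
end

section
/- The algebra 𝒜ₙ(G,τ) is a semisimple ring (a finite-dimensional semisimple ℂ-algebra). -/
/-!
STATEMENT 6: The algebra 𝒜ₙ(G,τ) is a semisimple ring (a finite-dimensional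
semisimple ℂ-algebra).

𝒜ₙ(G,τ) is presented by generators g_i (g ∈ G, 1 ≤ i ≤ n−1, here indexed by
`Fin (n−1) × G`) subject to e_i = 1, g_i h_i = (gh)_i, g_i h_j = h_j g_i for
|i−j| ≥ 2, and g_i h_{i+1} = q^{α(g,h)} h_{i+1} g_i.
-/

namespace Stmt6

/-- The defining relations of 𝒜ₙ(G,τ) (with `N = n − 1` tensor factors). -/
inductive Rel (m : ℕ) (q : ℂ) (G : Type) [Group G] (α : G → G → ZMod m) (N : ℕ) :
    FreeAlgebra ℂ (Fin N × G) → FreeAlgebra ℂ (Fin N × G) → Prop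
  | unit (i : Fin N) :
      Rel m q G α N (FreeAlgebra.ι ℂ (i, (1 : G))) 1
  | mul (i : Fin N) (g h : G) :
      Rel m q G α N (FreeAlgebra.ι ℂ (i, g) * FreeAlgebra.ι ℂ (i, h))
        (FreeAlgebra.ι ℂ (i, g * h))
  | far (i j : Fin N) (g h : G) (hij : 2 ≤ |((i : ℕ) : ℤ) - ((j : ℕ) : ℤ)|) :
      Rel m q G α N (FreeAlgebra.ι ℂ (i, g) * FreeAlgebra.ι ℂ (j, h))
        (FreeAlgebra.ι ℂ (j, h) * FreeAlgebra.ι ℂ (i, g))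
  | adj (i j : Fin N) (g h : G) (hij : (j : ℕ) = (i : ℕ) + 1) :
      Rel m q G α N (FreeAlgebra.ι ℂ (i, g) * FreeAlgebra.ι ℂ (j, h))
        (q ^ (α g h).val • (FreeAlgebra.ι ℂ (j, h) * FreeAlgebra.ι ℂ (i, g)))

/-- The algebra 𝒜ₙ(G,τ), as the quotient of the free algebra on the generators
g_i by the two-sided ideal generated by the defining relations; here `N = n−1`. -/
abbrev Alg (m : ℕ) (q : ℂ) (G : Type) [Group G] (α : G → G → ZMod m) (N : ℕ) : Type :=
  RingQuot (Rel m q G α N)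

/-- The generator `g_i` of 𝒜ₙ(G,τ). -/
noncomputable def gen (m : ℕ) (q : ℂ) (G : Type) [Group G] (α : G → G → ZMod m)
    (N : ℕ) (i : Fin N) (g : G) : Alg m q G α N :=
  RingQuot.mkAlgHom ℂ (Rel m q G α N) (FreeAlgebra.ι ℂ (i, g))

open Subgroup in
theorem finite_aux {U G ι : Type*} [Group U] [Group G] [Finite G] [DecidableEq ι] (ζ : U)
    (hfin : IsOfFinOrder ζ) (hc : ∀ x, ζ * x = x * ζ) (u : ι → G →* U)
    (hu : ∀ i j, i ≠ j → ∀ g h, ∃ k : ℤ, u i g * u j h = ζ ^ k * (u j h * u i g))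
    (s : Finset ι) :
    ∃ K : Subgroup U, Finite K ∧ zpowers ζ ≤ K ∧ (∀ i ∈ s, (u i).range ≤ K) ∧
      ∀ j ∉ s, (u j).range ≤ normalizer (K : Set U) := by
  induction s using Finset.induction_on with
  | empty =>
    refine ⟨zpowers ζ, ?_, le_rfl, by simp, ?_⟩
    · exact finite_zpowers.2 hfin
    · intro j _
      rw [le_normalizer_iff]
      rintro _ - _ ⟨k, rfl⟩
      rename_i x
      have : Commute ζ x := hc x
      have h2 : ζ ^ k * x = x * ζ ^ k := this.zpow_left k
      exact ⟨k, by simp [← h2]⟩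
  | insert j s hj ih =>
    obtain ⟨K, hK, hZ, hs, hn⟩ := ih
    have hmul := coe_mul_of_right_le_normalizer_left K (u j).range (hn j hj)
    refine ⟨K ⊔ (u j).range, ?_, hZ.trans le_sup_left, ?_, ?_⟩
    · have h1 : ((K : Set U)).Finite := Set.toFinite _
      have h2 : (((u j).range : Subgroup U) : Set U).Finite := by
        rw [MonoidHom.coe_range]; exact Set.finite_range _
      have h3 := h1.mul h2
      rw [← hmul] at h3
      exact h3
    · intro i hi
      rcases Finset.mem_insert.1 hi with rfl | hi
      · exact le_sup_right
      · exact (hs i hi).trans le_sup_left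
    · intro l hl
      have hls : l ∉ s := fun h => hl (Finset.mem_insert_of_mem h)
      have hlj : l ≠ j := fun h => hl (h ▸ Finset.mem_insert_self _ _)
      have hn' := le_normalizer_iff.1 (hn l hls)
      rw [le_normalizer_iff]
      rintro _ ⟨g, rfl⟩ x hx
      rw [← SetLike.mem_coe, hmul] at hx
      obtain ⟨k, hk, _, ⟨h, rfl⟩, rfl⟩ := hx
      obtain ⟨t, ht⟩ := hu l j hlj g h
      have e : u l g * (k * u j h) * (u l g)⁻¹ =
          (u l g * k * (u l g)⁻¹) * (ζ ^ t * u j h) := by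
        have : u l g * u j h * (u l g)⁻¹ = ζ ^ t * u j h := by
          rw [ht]; group
        rw [← this]; group
      show u l g * (k * u j h) * (u l g)⁻¹ ∈ _
      rw [e]
      refine mul_mem (mem_sup_left (hn' _ ⟨g, rfl⟩ k hk)) (mul_mem ?_ ?_)
      · exact mem_sup_left (hZ ⟨t, rfl⟩)
      · exact mem_sup_right ⟨h, rfl⟩

theorem statement6 (m : ℕ) (hm : 1 ≤ m) (q : ℂ) (hq : IsPrimitiveRoot q m)
    (G : Type) [Group G] [Fintype G] (α : G → G → ZMod m)
    (hα₁ : ∀ g h h' : G, α g (h * h') = α g h + α g h')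
    (hα₂ : ∀ g g' h : G, α (g * g') h = α g h + α g' h)
    (n : ℕ) (hn : 2 ≤ n) :
    IsSemisimpleRing (Alg m q G α (n - 1)) := by
  classical
  generalize n - 1 = N
  have hrel : ∀ {x y}, Rel m q G α N x y →
      RingQuot.mkAlgHom ℂ (Rel m q G α N) x = RingQuot.mkAlgHom ℂ (Rel m q G α N) y :=
    fun h => RingQuot.mkAlgHom_rel ℂ h
  let v : Fin N → G →* Alg m q G α N := fun i =>
    { toFun := gen m q G α N i
      map_one' := by simpa [gen] using hrel (Rel.unit i)
      map_mul' := fun g h => by simpa [gen] using (hrel (Rel.mul i g h)).symm }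
  let u : Fin N → G →* (Alg m q G α N)ˣ := fun i => (v i).toHomUnits
  have huv : ∀ i g, (u i g : Alg m q G α N) = gen m q G α N i g := fun i g => rfl
  have hm0 : m ≠ 0 := by omega
  let q' : ℂˣ := Units.mk0 q (hq.ne_zero hm0)
  let ζ : (Alg m q G α N)ˣ := Units.map (algebraMap ℂ (Alg m q G α N) : ℂ →* _) q'
  have hζ : ∀ k : ℕ, ((ζ ^ k : (Alg m q G α N)ˣ) : Alg m q G α N) =
      algebraMap ℂ (Alg m q G α N) (q ^ k) := fun k => by simp [ζ, q']
  have hfin : IsOfFinOrder ζ := by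
    refine isOfFinOrder_iff_pow_eq_one.2 ⟨m, by omega, ?_⟩
    ext
    rw [hζ, hq.pow_eq_one]; simp
  have hc : ∀ x, ζ * x = x * ζ := fun x => by
    ext
    exact Algebra.commutes _ _
  have hadj : ∀ i j : Fin N, (j : ℕ) = (i : ℕ) + 1 → ∀ g h,
      u i g * u j h = ζ ^ (α g h).val * (u j h * u i g) := fun i j hij g h => by
    ext
    have := hrel (Rel.adj (m := m) (q := q) (α := α) i j g h hij)
    rw [map_smul, map_mul, map_mul, Algebra.smul_def] at this
    rw [Units.val_mul, Units.val_mul, Units.val_mul, hζ]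
    exact this
  have hu : ∀ i j, i ≠ j → ∀ g h, ∃ k : ℤ, u i g * u j h = ζ ^ k * (u j h * u i g) := by
    intro i j hij g h
    have hij' : (i : ℕ) ≠ j := fun h => hij (Fin.ext h)
    by_cases h1 : (j : ℕ) = i + 1
    · exact ⟨_, by rw [zpow_natCast]; exact hadj i j h1 g h⟩
    by_cases h2 : (i : ℕ) = j + 1
    · refine ⟨-((α h g).val : ℤ), ?_⟩
      rw [hadj j i h2 h g, zpow_neg, zpow_natCast, inv_mul_cancel_left]
    · refine ⟨0, ?_⟩
      have hfar : 2 ≤ |((i : ℕ) : ℤ) - ((j : ℕ) : ℤ)| := by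
        rw [le_abs]; omega
      have := hrel (Rel.far (m := m) (q := q) (α := α) i j g h hfar)
      rw [map_mul, map_mul] at this
      rw [zpow_zero, one_mul]
      ext
      exact this
  obtain ⟨K, hK, -, hr, -⟩ := finite_aux ζ hfin hc u hu Finset.univ
  let F : MonoidAlgebra ℂ K →ₐ[ℂ] Alg m q G α N :=
    MonoidAlgebra.lift ℂ _ K ((Units.coeHom _).comp K.subtype)
  have hF : Function.Surjective F := by
    intro x
    obtain ⟨y, rfl⟩ := RingQuot.mkAlgHom_surjective ℂ (Rel m q G α N) x
    change RingQuot.mkAlgHom ℂ (Rel m q G α N) y ∈ F.range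
    induction y with
    | grade0 r => rw [AlgHom.commutes]; exact algebraMap_mem _ _
    | grade1 x =>
      refine ⟨MonoidAlgebra.single ⟨u x.1 x.2, hr x.1 (Finset.mem_univ _) ⟨x.2, rfl⟩⟩ 1, ?_⟩
      exact (MonoidAlgebra.lift_single _ _ _).trans (one_smul _ _)
    | mul a b ha hb => rw [map_mul]; exact mul_mem ha hb
    | add a b ha hb => rw [map_add]; exact add_mem ha hb
  haveI : NeZero (Nat.card K : ℂ) := ⟨Nat.cast_ne_zero.2 Nat.card_pos.ne'⟩
  haveI : IsSemisimpleRing (MonoidAlgebra ℂ K) := inferInstance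
  exact RingHom.isSemisimpleRing_of_surjective F.toRingHom hF

end Stmt6
end

section
/- The operation (x, g)·(y, h) = (x + y + c(g,h), gh) on the set ℤ/mℤ × Gⁿ, where c(g,h) = −Σ_{i=1}^{n−1} α(h_i, g_{i+1}), defines a group G^{×_α n} (a central extension of Gⁿ by ℤ/mℤ with identity (0,(e,…,e))). Moreover, the quotient of the complex group algebra ℂ[G^{×_α n}] by the two-sided ideal generated by [(1,(e,…,e))] − q·1 is isomorphic as a ℂ-algebra to 𝒜_{n+1}(G,τ), via the map sending the class of (x,(g^{(1)},…,g^{(n)})) to q^x · g^{(1)}₁ g^{(2)}₂ ⋯ g^{(n)}_n. -/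
/-!
STATEMENT 7: The operation (x,g)·(y,h) = (x + y + c(g,h), gh) on ℤ/mℤ × Gⁿ,
where c(g,h) = −Σ_{i=1}^{n−1} α(h_i, g_{i+1}), defines a group G^{×_α n}
(a central extension of Gⁿ by ℤ/mℤ, with identity (0,(e,…,e))).  Moreover the
quotient of ℂ[G^{×_α n}] by the two-sided ideal generated by
[(1,(e,…,e))] − q·1 is isomorphic as a ℂ-algebra to 𝒜_{n+1}(G,τ), via
(x,(g^{(1)},…,g^{(n)})) ↦ q^x · g^{(1)}₁ ⋯ g^{(n)}_n.
-/

namespace Stmt7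

/-- The defining relations of 𝒜_{N+1}(G,τ) (with `N` tensor factors). -/
inductive Rel (m : ℕ) (q : ℂ) (G : Type) [Group G] (α : G → G → ZMod m) (N : ℕ) :
    FreeAlgebra ℂ (Fin N × G) → FreeAlgebra ℂ (Fin N × G) → Prop
  | unit (i : Fin N) :
      Rel m q G α N (FreeAlgebra.ι ℂ (i, (1 : G))) 1
  | mul (i : Fin N) (g h : G) :
      Rel m q G α N (FreeAlgebra.ι ℂ (i, g) * FreeAlgebra.ι ℂ (i, h))
        (FreeAlgebra.ι ℂ (i, g * h))
  | far (i j : Fin N) (g h : G) (hij : 2 ≤ |((i : ℕ) : ℤ) - ((j : ℕ) : ℤ)|) :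
      Rel m q G α N (FreeAlgebra.ι ℂ (i, g) * FreeAlgebra.ι ℂ (j, h))
        (FreeAlgebra.ι ℂ (j, h) * FreeAlgebra.ι ℂ (i, g))
  | adj (i j : Fin N) (g h : G) (hij : (j : ℕ) = (i : ℕ) + 1) :
      Rel m q G α N (FreeAlgebra.ι ℂ (i, g) * FreeAlgebra.ι ℂ (j, h))
        (q ^ (α g h).val • (FreeAlgebra.ι ℂ (j, h) * FreeAlgebra.ι ℂ (i, g)))

/-- The algebra 𝒜_{n+1}(G,τ) (with `n` tensor factors). -/
abbrev Alg (m : ℕ) (q : ℂ) (G : Type) [Group G] (α : G → G → ZMod m) (N : ℕ) : Type :=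
  RingQuot (Rel m q G α N)

/-- The generator `g_i` of 𝒜_{n+1}(G,τ). -/
noncomputable def gen (m : ℕ) (q : ℂ) (G : Type) [Group G] (α : G → G → ZMod m)
    (N : ℕ) (i : Fin N) (g : G) : Alg m q G α N :=
  RingQuot.mkAlgHom ℂ (Rel m q G α N) (FreeAlgebra.ι ℂ (i, g))

/-- The underlying set ℤ/mℤ × Gⁿ of the central extension G^{×_α n}. -/
structure Ext (m n : ℕ) (G : Type) : Type where
  fst : ZMod m
  snd : Fin n → G

/-- The 2-cocycle c(g,h) = −Σ_{i=1}^{n−1} α(h_i, g_{i+1}) on Gⁿ. -/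
def c (m n : ℕ) (G : Type) (α : G → G → ZMod m) (g h : Fin n → G) : ZMod m :=
  -∑ i : Fin n, if h' : (i : ℕ) + 1 < n then α (h i) (g ⟨(i : ℕ) + 1, h'⟩) else 0

/-- The relation generating the two-sided ideal ⟨[(1,(e,…,e))] − q·1⟩ in the
complex group algebra ℂ[G^{×_α n}]. -/
inductive CRel (m n : ℕ) (G : Type) [Group G] (q : ℂ) [Monoid (Ext m n G)] :
    MonoidAlgebra ℂ (Ext m n G) → MonoidAlgebra ℂ (Ext m n G) → Prop
  | base : CRel m n G q
      (MonoidAlgebra.single (⟨(1 : ZMod m), (1 : Fin n → G)⟩ : Ext m n G) (1 : ℂ))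
      (q • (1 : MonoidAlgebra ℂ (Ext m n G)))

section Helpers

variable {m : ℕ} {q : ℂ} {G : Type} [Group G] {α : G → G → ZMod m} {n : ℕ}

/-- the term of the cocycle at a pair of positions -/
def kap (α : G → G → ZMod m) (g h : Fin n → G) (i j : Fin n) : ZMod m :=
  if (j : ℕ) = (i : ℕ) + 1 then -α (h i) (g j) else 0

lemma c_eq (g h : Fin n → G) : c m n G α g h = ∑ i, ∑ j, kap α g h i j := by
  unfold c
  rw [← Finset.sum_neg_distrib]
  refine Finset.sum_congr rfl fun i _ => ?_
  split_ifs with h'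
  · rw [Finset.sum_eq_single (⟨(i : ℕ) + 1, h'⟩ : Fin n)]
    · simp [kap]
    · intro b _ hb
      rw [kap, if_neg]
      intro hh
      exact hb (Fin.ext hh)
    · simp
  · rw [Finset.sum_eq_zero, neg_zero]
    intro j _
    rw [kap, if_neg]
    have := j.2
    omega

lemma al_one_right (hα₁ : ∀ g h h' : G, α g (h * h') = α g h + α g h') (g : G) :
    α g 1 = 0 := by
  have := hα₁ g 1 1
  simpa using this

lemma al_one_left (hα₂ : ∀ g g' h : G, α (g * g') h = α g h + α g' h) (g : G) :
    α 1 g = 0 := by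
  have := hα₂ 1 1 g
  simpa using this

lemma c_mul_left (hα₁ : ∀ g h h' : G, α g (h * h') = α g h + α g h') (g g' h : Fin n → G) :
    c m n G α (g * g') h = c m n G α g h + c m n G α g' h := by
  simp only [c_eq, ← Finset.sum_add_distrib]
  refine Finset.sum_congr rfl fun i _ => Finset.sum_congr rfl fun j _ => ?_
  unfold kap
  split_ifs
  · rw [Pi.mul_apply, hα₁]; ring
  · simp

lemma c_mul_right (hα₂ : ∀ g g' h : G, α (g * g') h = α g h + α g' h) (g h h' : Fin n → G) :
    c m n G α g (h * h') = c m n G α g h + c m n G α g h' := by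
  simp only [c_eq, ← Finset.sum_add_distrib]
  refine Finset.sum_congr rfl fun i _ => Finset.sum_congr rfl fun j _ => ?_
  unfold kap
  split_ifs
  · rw [Pi.mul_apply, hα₂]; ring
  · simp

lemma c_one_left (hα₁ : ∀ g h h' : G, α g (h * h') = α g h + α g h') (h : Fin n → G) :
    c m n G α 1 h = 0 := by
  have := c_mul_left hα₁ 1 1 h
  simpa using this

lemma c_one_right (hα₂ : ∀ g g' h : G, α (g * g') h = α g h + α g' h) (g : Fin n → G) :
    c m n G α g 1 = 0 := by
  have := c_mul_right hα₂ g 1 1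
  simpa using this

lemma c_single (hα₁ : ∀ g h h' : G, α g (h * h') = α g h + α g h')
    (hα₂ : ∀ g g' h : G, α (g * g') h = α g h + α g' h) (i j : Fin n) (g h : G) :
    c m n G α (Pi.mulSingle i g) (Pi.mulSingle j h) =
      if (i : ℕ) = (j : ℕ) + 1 then -α h g else 0 := by
  rw [c_eq, Finset.sum_eq_single j, Finset.sum_eq_single i]
  · simp [kap]
  · intro b _ hb
    simp [kap, Pi.mulSingle_eq_of_ne hb, al_one_right hα₁]
  · simp
  · intro b _ hb
    simp [kap, Pi.mulSingle_eq_of_ne hb, al_one_left hα₂]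
  · simp

/-- the group structure -/
abbrev extGroup (hα₁ : ∀ g h h' : G, α g (h * h') = α g h + α g h')
    (hα₂ : ∀ g g' h : G, α (g * g') h = α g h + α g' h) (n : ℕ) : Group (Ext m n G) :=
  letI : Mul (Ext m n G) := ⟨fun a b => ⟨a.fst + b.fst + c m n G α a.snd b.snd, a.snd * b.snd⟩⟩
  letI : One (Ext m n G) := ⟨⟨0, 1⟩⟩
  letI : Inv (Ext m n G) := ⟨fun a => ⟨-a.fst - c m n G α a.snd⁻¹ a.snd, a.snd⁻¹⟩⟩
  Group.ofLeftAxioms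
    (by
      intro a b d
      change Ext.mk _ _ = Ext.mk _ _
      rw [Ext.mk.injEq]
      refine ⟨?_, mul_assoc _ _ _⟩
      change a.fst + b.fst + c m n G α a.snd b.snd + d.fst + c m n G α (a.snd * b.snd) d.snd
        = a.fst + (b.fst + d.fst + c m n G α b.snd d.snd) + c m n G α a.snd (b.snd * d.snd)
      rw [c_mul_left hα₁, c_mul_right hα₂]
      ring)
    (by
      intro a
      change Ext.mk (0 + a.fst + c m n G α 1 a.snd) (1 * a.snd) = a
      rw [c_one_left hα₁]
      simp)
    (by
      intro a
      change Ext.mk (-a.fst - c m n G α a.snd⁻¹ a.snd + a.fst + c m n G α a.snd⁻¹ a.snd)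
        (a.snd⁻¹ * a.snd) = Ext.mk 0 1
      rw [Ext.mk.injEq]
      refine ⟨by ring, inv_mul_cancel _⟩)

/-- the character -/
noncomputable def qq (q : ℂ) (x : ZMod m) : ℂ := q ^ x.val

lemma qq_add [NeZero m] (hq : q ^ m = 1) (x y : ZMod m) : qq q (x + y) = qq q x * qq q y := by
  unfold qq
  rw [ZMod.val_add, ← pow_add, ← pow_eq_pow_mod _ hq]

lemma qq_zero : qq q (0 : ZMod m) = 1 := by simp [qq]

lemma qq_neg_mul [NeZero m] (hq : q ^ m = 1) (x : ZMod m) : qq q (-x) * qq q x = 1 := by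
  rw [← qq_add hq, neg_add_cancel, qq_zero]

lemma qq_one [NeZero m] (hq : q ^ m = 1) : qq q (1 : ZMod m) = q := by
  unfold qq
  rw [ZMod.val_one_eq_one_mod, ← pow_eq_pow_mod _ hq, pow_one]

lemma gen_one (i : Fin n) : gen m q G α n i 1 = 1 := by
  unfold gen
  rw [RingQuot.mkAlgHom_rel ℂ (Rel.unit i), map_one]

lemma gen_mul (i : Fin n) (g h : G) :
    gen m q G α n i g * gen m q G α n i h = gen m q G α n i (g * h) := by
  unfold gen
  rw [← map_mul, RingQuot.mkAlgHom_rel ℂ (Rel.mul i g h)]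

lemma gen_swap [NeZero m] (hq : q ^ m = 1) (g h : Fin n → G) (i j : Fin n) (hij : i < j) :
    gen m q G α n j (g j) * gen m q G α n i (h i) =
      qq q (kap α g h i j) • (gen m q G α n i (h i) * gen m q G α n j (g j)) := by
  unfold kap
  split_ifs with hh
  · have : gen m q G α n i (h i) * gen m q G α n j (g j) =
        qq q (α (h i) (g j)) • (gen m q G α n j (g j) * gen m q G α n i (h i)) := by
      unfold gen qq
      rw [← map_mul, RingQuot.mkAlgHom_rel ℂ (Rel.adj i j (h i) (g j) hh), map_smul, map_mul]
    rw [this, smul_smul, qq_neg_mul hq, one_smul]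
  · rw [qq_zero, one_smul]
    unfold gen
    rw [← map_mul, RingQuot.mkAlgHom_rel ℂ (Rel.far j i (g j) (h i) _), map_mul]
    have h1 : (i : ℕ) < (j : ℕ) := hij
    refine le_trans ?_ (le_abs_self _)
    omega

/-- partial product -/
noncomputable def PP (m : ℕ) (q : ℂ) (α : G → G → ZMod m) (l : List (Fin n)) (g : Fin n → G) :
    Alg m q G α n := (l.map (fun i => gen m q G α n i (g i))).prod

lemma PP_cons (a : Fin n) (l : List (Fin n)) (g : Fin n → G) :
    PP m q α (a :: l) g = gen m q G α n a (g a) * PP m q α l g := by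
  simp [PP]

lemma PP_swap [NeZero m] (hq : q ^ m = 1) (g h : Fin n → G) (a : Fin n) (l : List (Fin n))
    (hl : ∀ b ∈ l, a < b) :
    PP m q α l g * gen m q G α n a (h a) =
      qq q ((l.map (fun j => kap α g h a j)).sum) • (gen m q G α n a (h a) * PP m q α l g) := by
  induction l with
  | nil => simp [PP, qq_zero]
  | cons b l ih =>
    rw [PP_cons, mul_assoc, ih (fun x hx => hl x (by simp [hx])), mul_smul_comm, ← mul_assoc,
      gen_swap hq g h a b (hl b (by simp)), smul_mul_assoc, smul_smul, ← qq_add hq, mul_assoc,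
      List.map_cons, List.sum_cons, add_comm]

lemma PP_mul [NeZero m] (hq : q ^ m = 1) (g h : Fin n → G) (l : List (Fin n))
    (hl : l.Pairwise (· < ·)) :
    PP m q α l g * PP m q α l h =
      qq q ((l.map (fun i => (l.map (fun j => kap α g h i j)).sum)).sum) • PP m q α l (g * h) := by
  induction l with
  | nil => simp [PP, qq_zero]
  | cons a l ih =>
    rw [List.pairwise_cons] at hl
    have key : ((a :: l).map (fun i => ((a :: l).map (fun j => kap α g h i j)).sum)).sum
        = (l.map (fun j => kap α g h a j)).sum +
          (l.map (fun i => (l.map (fun j => kap α g h i j)).sum)).sum := by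
      have h0 : kap α g h a a = 0 := by simp [kap]
      rw [List.map_cons, List.sum_cons, List.map_cons, List.sum_cons, h0, zero_add]
      congr 2
      apply List.map_congr_left
      intro i hi
      have h1 : (a : ℕ) < (i : ℕ) := hl.1 i hi
      have h2 : kap α g h i a = 0 := by
        rw [kap, if_neg]
        omega
      rw [List.map_cons, List.sum_cons, h2, zero_add]
    rw [key, PP_cons, PP_cons, PP_cons]
    calc gen m q G α n a (g a) * PP m q α l g * (gen m q G α n a (h a) * PP m q α l h)
        = gen m q G α n a (g a) * (PP m q α l g * gen m q G α n a (h a)) * PP m q α l h := by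
          simp only [mul_assoc]
      _ = qq q ((l.map (fun j => kap α g h a j)).sum) •
            ((gen m q G α n a (g a) * gen m q G α n a (h a)) * (PP m q α l g * PP m q α l h)) := by
          rw [PP_swap hq g h a l hl.1]
          simp only [mul_smul_comm, smul_mul_assoc, mul_assoc]
      _ = _ := by
          rw [ih hl.2, gen_mul, mul_smul_comm, smul_smul, ← qq_add hq, Pi.mul_apply]

lemma PP_full [NeZero m] (hq : q ^ m = 1) (g h : Fin n → G) :
    PP m q α (List.finRange n) g * PP m q α (List.finRange n) h =
      qq q (c m n G α g h) • PP m q α (List.finRange n) (g * h) := by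
  rw [PP_mul hq g h _ (List.pairwise_lt_finRange n), c_eq]
  simp only [Fin.sum_univ_def]

lemma PP_one (l : List (Fin n)) : PP m q α l 1 = 1 := by
  induction l with
  | nil => simp [PP]
  | cons a l ih => rw [PP_cons, ih, Pi.one_apply, gen_one, mul_one]

lemma PP_single_not_mem (i : Fin n) (g : G) (l : List (Fin n)) (hi : i ∉ l) :
    PP m q α l (Pi.mulSingle i g) = 1 := by
  induction l with
  | nil => simp [PP]
  | cons a l ih =>
    simp only [List.mem_cons, not_or] at hi
    rw [PP_cons, ih hi.2, Pi.mulSingle_eq_of_ne (Ne.symm hi.1), gen_one, mul_one]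

lemma PP_single (i : Fin n) (g : G) (l : List (Fin n)) (hl : l.Nodup) (hi : i ∈ l) :
    PP m q α l (Pi.mulSingle i g) = gen m q G α n i g := by
  induction l with
  | nil => simp at hi
  | cons a l ih =>
    rw [List.nodup_cons] at hl
    rw [PP_cons]
    by_cases h : i = a
    · subst h
      rw [PP_single_not_mem i g l hl.1, Pi.mulSingle_eq_same, mul_one]
    · rw [Pi.mulSingle_eq_of_ne (Ne.symm h), gen_one, one_mul]
      exact ih hl.2 (by simpa [h] using hi)

end Helpers

theorem statement7 (m : ℕ) (hm : 1 ≤ m) (q : ℂ) (hq : IsPrimitiveRoot q m)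
    (G : Type) [Group G] [Fintype G] (α : G → G → ZMod m)
    (hα₁ : ∀ g h h' : G, α g (h * h') = α g h + α g h')
    (hα₂ : ∀ g g' h : G, α (g * g') h = α g h + α g' h)
    (n : ℕ) (hn : 1 ≤ n) :
    ∃ grp : Group (Ext m n G),
      (∀ a b : Ext m n G,
        (letI := grp; a * b) =
          ⟨a.fst + b.fst + c m n G α a.snd b.snd, a.snd * b.snd⟩) ∧
      ((letI := grp; (1 : Ext m n G)) = ⟨0, 1⟩) ∧
      (letI := grp;
        ∃ φ : RingQuot (CRel m n G q) ≃ₐ[ℂ] Alg m q G α n,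
          ∀ (x : ZMod m) (g : Fin n → G),
            φ (RingQuot.mkAlgHom ℂ (CRel m n G q)
                (MonoidAlgebra.single (⟨x, g⟩ : Ext m n G) (1 : ℂ))) =
              q ^ x.val •
                ((List.finRange n).map (fun i => gen m q G α n i (g i))).prod) := by
  haveI : NeZero m := ⟨by omega⟩
  have hq1 : q ^ m = 1 := hq.pow_eq_one
  letI grp : Group (Ext m n G) := extGroup hα₁ hα₂ n
  have hmul : ∀ a b : Ext m n G,
      a * b = ⟨a.fst + b.fst + c m n G α a.snd b.snd, a.snd * b.snd⟩ := fun _ _ => rfl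
  have hone : (1 : Ext m n G) = ⟨0, 1⟩ := rfl
  clear_value grp
  refine ⟨grp, hmul, hone, ?_⟩
  change ∃ φ : RingQuot (CRel m n G q) ≃ₐ[ℂ] Alg m q G α n,
          ∀ (x : ZMod m) (g : Fin n → G),
            φ (RingQuot.mkAlgHom ℂ (CRel m n G q)
                (MonoidAlgebra.single (⟨x, g⟩ : Ext m n G) (1 : ℂ))) =
              qq q x • PP m q α (List.finRange n) g
  let F₀ : Ext m n G →* Alg m q G α n :=
    { toFun := fun a => qq q a.fst • PP m q α (List.finRange n) a.snd
      map_one' := by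
        rw [hone]
        change qq q 0 • PP m q α (List.finRange n) 1 = 1
        rw [qq_zero, PP_one, one_smul]
      map_mul' := by
        intro a b
        rw [hmul]
        change qq q (a.fst + b.fst + c m n G α a.snd b.snd) •
          PP m q α (List.finRange n) (a.snd * b.snd) = _
        rw [smul_mul_smul_comm, PP_full hq1, smul_smul, qq_add hq1, qq_add hq1] }
  let F₁ : MonoidAlgebra ℂ (Ext m n G) →ₐ[ℂ] Alg m q G α n :=
    MonoidAlgebra.lift ℂ _ _ F₀
  have hF₁ : ∀ a, F₁ (MonoidAlgebra.single a (1 : ℂ)) = F₀ a := by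
    intro a
    simp [F₁]
  have hF₁rel : ∀ ⦃x y⦄, CRel m n G q x y → F₁ x = F₁ y := by
    rintro _ _ ⟨⟩
    rw [hF₁, map_smul, map_one]
    change qq q 1 • PP m q α (List.finRange n) 1 = _
    rw [qq_one hq1, PP_one]
  let F : RingQuot (CRel m n G q) →ₐ[ℂ] Alg m q G α n :=
    RingQuot.liftAlgHom ℂ ⟨F₁, hF₁rel⟩
  let E : Ext m n G → RingQuot (CRel m n G q) := fun a =>
    RingQuot.mkAlgHom ℂ (CRel m n G q) (MonoidAlgebra.single a (1 : ℂ))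
  have hFE : ∀ a, F (E a) = qq q a.fst • PP m q α (List.finRange n) a.snd := by
    intro a
    change RingQuot.liftAlgHom ℂ ⟨F₁, hF₁rel⟩ (RingQuot.mkAlgHom ℂ _ _) = _
    rw [RingQuot.liftAlgHom_mkAlgHom_apply, hF₁]
    rfl
  have hEmul : ∀ a b, E a * E b = E (a * b) := by
    intro a b
    simp only [E]
    rw [← map_mul, MonoidAlgebra.single_mul_single, one_mul]
  have hEone : E 1 = 1 := by
    simp only [E]
    rw [← MonoidAlgebra.one_def, map_one]
  have hEnat : ∀ k : ℕ, E ⟨(k : ZMod m), 1⟩ = (q ^ k) • (1 : RingQuot (CRel m n G q)) := by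
    intro k
    induction k with
    | zero => rw [Nat.cast_zero, ← hone, hEone, pow_zero, one_smul]
    | succ k ih =>
      have h1 : E ⟨1, 1⟩ = q • (1 : RingQuot (CRel m n G q)) := by
        simp only [E]
        rw [RingQuot.mkAlgHom_rel ℂ CRel.base, map_smul, map_one]
      have h2 : (⟨((k + 1 : ℕ) : ZMod m), 1⟩ : Ext m n G) = ⟨(k : ZMod m), 1⟩ * ⟨1, 1⟩ := by
        rw [hmul]
        simp [c_one_left hα₁]
      rw [h2, ← hEmul, ih, h1, smul_mul_smul_comm, mul_one, pow_succ]
  have hE : ∀ (x : ZMod m) (g : Fin n → G), E ⟨x, g⟩ = qq q x • E ⟨0, g⟩ := by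
    intro x g
    have h2 : (⟨x, g⟩ : Ext m n G) = ⟨((x.val : ℕ) : ZMod m), 1⟩ * ⟨0, g⟩ := by
      rw [hmul]
      simp [c_one_left hα₁]
    rw [h2, ← hEmul, hEnat, smul_mul_assoc, one_mul]
    rfl
  have hE0 : ∀ (g h : Fin n → G),
      E ⟨0, g⟩ * E ⟨0, h⟩ = qq q (c m n G α g h) • E ⟨0, g * h⟩ := by
    intro g h
    rw [hEmul, hmul, ← hE]
    simp
  let B₀ : FreeAlgebra ℂ (Fin n × G) →ₐ[ℂ] RingQuot (CRel m n G q) :=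
    FreeAlgebra.lift ℂ (fun p => E ⟨0, Pi.mulSingle p.1 p.2⟩)
  have hB₀ : ∀ i g, B₀ (FreeAlgebra.ι ℂ (i, g)) = E ⟨0, Pi.mulSingle i g⟩ := by
    intro i g
    simp [B₀]
  have hcomm : ∀ (i j : Fin n) (g h : G), i ≠ j →
      (Pi.mulSingle i g * Pi.mulSingle j h : Fin n → G) = Pi.mulSingle j h * Pi.mulSingle i g :=
    fun i j g h hij => (Pi.mulSingle_commute (f := fun _ : Fin n => G) hij g h).eq
  have hB₀rel : ∀ ⦃x y⦄, Rel m q G α n x y → B₀ x = B₀ y := by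
    intro x y hxy
    cases hxy with
    | unit i =>
      rw [hB₀, Pi.mulSingle_one, ← hone, hEone, map_one]
    | mul i g h =>
      rw [map_mul, hB₀, hB₀, hB₀, hE0, c_single hα₁ hα₂, if_neg (by omega), qq_zero, one_smul,
        Pi.mulSingle_mul]
    | far i j g h hij =>
      have h1 : ¬ ((i : ℕ) = (j : ℕ) + 1) := by
        intro hh
        rw [hh] at hij
        simp at hij
      have h2 : ¬ ((j : ℕ) = (i : ℕ) + 1) := by
        intro hh
        rw [hh] at hij
        simp at hij
      have h3 : i ≠ j := by
        rintro rfl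
        simp at hij
      rw [map_mul, map_mul, hB₀, hB₀, hE0, hE0, c_single hα₁ hα₂, c_single hα₁ hα₂,
        if_neg h1, if_neg h2, hcomm i j g h h3]
    | adj i j g h hij =>
      have h3 : i ≠ j := by
        rintro rfl
        omega
      rw [map_smul, map_mul, map_mul, hB₀, hB₀, hE0, hE0, c_single hα₁ hα₂, c_single hα₁ hα₂,
        if_neg (by omega), if_pos hij, hcomm i j g h h3, smul_smul]
      congr 1
      change _ = qq q (α g h) * _
      rw [mul_comm, qq_neg_mul hq1, qq_zero]
  let B : Alg m q G α n →ₐ[ℂ] RingQuot (CRel m n G q) :=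
    RingQuot.liftAlgHom ℂ ⟨B₀, hB₀rel⟩
  have hB : ∀ i g, B (gen m q G α n i g) = E ⟨0, Pi.mulSingle i g⟩ := by
    intro i g
    change RingQuot.liftAlgHom ℂ ⟨B₀, hB₀rel⟩ (RingQuot.mkAlgHom ℂ _ _) = _
    rw [RingQuot.liftAlgHom_mkAlgHom_apply, hB₀]
  have hFB : F.comp B = AlgHom.id ℂ _ := by
    apply RingQuot.ringQuot_ext'
    apply FreeAlgebra.hom_ext
    funext p
    obtain ⟨i, g⟩ := p
    change F (B (gen m q G α n i g)) = gen m q G α n i g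
    rw [hB, hFE]
    change qq q 0 • _ = _
    rw [qq_zero, one_smul]
    exact PP_single i g _ (List.nodup_finRange n) (List.mem_finRange i)
  let S : Submonoid (Fin n → G) :=
    { carrier := {g | E ⟨0, g⟩ ∈ B.range}
      one_mem' := by
        change E ⟨0, 1⟩ ∈ B.range
        rw [← hone, hEone]
        exact one_mem _
      mul_mem' := by
        intro a b ha hb
        change E ⟨0, a * b⟩ ∈ B.range
        have h1 : E ⟨0, a * b⟩ = qq q (-c m n G α a b) • (E ⟨0, a⟩ * E ⟨0, b⟩) := by
          rw [hE0, smul_smul, qq_neg_mul hq1, one_smul]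
        rw [h1]
        exact Subalgebra.smul_mem _ (mul_mem ha hb) _ }
  have hS : ∀ g : Fin n → G, E ⟨0, g⟩ ∈ B.range := by
    intro g
    change g ∈ S
    exact Submonoid.pi_mem_of_mulSingle_mem g (fun i => ⟨_, hB i (g i)⟩)
  have hBs : Function.Surjective B := by
    intro y
    obtain ⟨z, rfl⟩ := RingQuot.mkAlgHom_surjective ℂ (CRel m n G q) y
    change _ ∈ B.range
    induction z using MonoidAlgebra.induction_on with
    | of a =>
      change E a ∈ B.range
      obtain ⟨x, g⟩ := a
      rw [hE]
      exact Subalgebra.smul_mem _ (hS g) _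
    | add a b ha hb => rw [map_add]; exact add_mem ha hb
    | smul r a ha => rw [map_smul]; exact Subalgebra.smul_mem _ ha _
  have hBF : B.comp F = AlgHom.id ℂ _ := by
    apply AlgHom.ext
    intro y
    obtain ⟨z, rfl⟩ := hBs y
    have := DFunLike.congr_fun hFB z
    exact congrArg B this
  exact ⟨AlgEquiv.ofAlgHom F B hFB hBF, fun x g => hFE ⟨x, g⟩⟩

end Stmt7
end

section
/- Let G = (ℤ/mℤ)^k with m ≥ 3 odd, and let S ∈ M_k(ℤ/mℤ) be an invertible matrix that is either symmetric (Sᵀ = S) or skew-symmetric (Sᵀ = −S). Set α(x,y) = xᵀ S y and χ(x,y) = xᵀ y. Then for every n ≥ 2 there is an isomorphism of ℂ-algebras 𝒜ₙ(G, q^α) ≅ 𝒜ₙ(G, q^χ). -/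
/-!
STATEMENT 8: Let G = (ℤ/mℤ)^k with m ≥ 3 odd, and S ∈ M_k(ℤ/mℤ) invertible
with Sᵀ = S or Sᵀ = −S.  Set α(x,y) = xᵀSy and χ(x,y) = xᵀy.  Then for every
n ≥ 2 there is a ℂ-algebra isomorphism 𝒜ₙ(G, q^α) ≅ 𝒜ₙ(G, q^χ).

For a bihomomorphism β : G × G → ℤ/mℤ on the additive group G = (ℤ/mℤ)^k,
𝒜ₙ(G, q^β) is presented by generators g_i (g ∈ G, 1 ≤ i ≤ n−1) subject to
0_i = 1, g_i h_i = (g+h)_i, g_i h_j = h_j g_i for |i−j| ≥ 2, and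
g_i h_{i+1} = q^{β(g,h)} h_{i+1} g_i.
-/

namespace Stmt8

/-- The defining relations of 𝒜ₙ(G, q^β) for the additive group G = (ℤ/mℤ)^k,
with `N = n − 1` tensor factors. -/
inductive Rel (m k : ℕ) (q : ℂ)
    (β : (Fin k → ZMod m) → (Fin k → ZMod m) → ZMod m) (N : ℕ) :
    FreeAlgebra ℂ (Fin N × (Fin k → ZMod m)) →
      FreeAlgebra ℂ (Fin N × (Fin k → ZMod m)) → Prop
  | unit (i : Fin N) :
      Rel m k q β N (FreeAlgebra.ι ℂ (i, (0 : Fin k → ZMod m))) 1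
  | add (i : Fin N) (g h : Fin k → ZMod m) :
      Rel m k q β N (FreeAlgebra.ι ℂ (i, g) * FreeAlgebra.ι ℂ (i, h))
        (FreeAlgebra.ι ℂ (i, g + h))
  | far (i j : Fin N) (g h : Fin k → ZMod m)
      (hij : 2 ≤ |((i : ℕ) : ℤ) - ((j : ℕ) : ℤ)|) :
      Rel m k q β N (FreeAlgebra.ι ℂ (i, g) * FreeAlgebra.ι ℂ (j, h))
        (FreeAlgebra.ι ℂ (j, h) * FreeAlgebra.ι ℂ (i, g))
  | adj (i j : Fin N) (g h : Fin k → ZMod m) (hij : (j : ℕ) = (i : ℕ) + 1) :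
      Rel m k q β N (FreeAlgebra.ι ℂ (i, g) * FreeAlgebra.ι ℂ (j, h))
        (q ^ (β g h).val • (FreeAlgebra.ι ℂ (j, h) * FreeAlgebra.ι ℂ (i, g)))

/-- The algebra 𝒜ₙ(G, q^β) with `N = n − 1`. -/
abbrev Alg (m k : ℕ) (q : ℂ)
    (β : (Fin k → ZMod m) → (Fin k → ZMod m) → ZMod m) (N : ℕ) : Type :=
  RingQuot (Rel m k q β N)

/-- Morphism of presented algebras induced by additive maps. -/
noncomputable def mapHom (m k : ℕ) (q : ℂ)
    (β γ : (Fin k → ZMod m) → (Fin k → ZMod m) → ZMod m) (N : ℕ)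
    (f : ℕ → (Fin k → ZMod m) →+ (Fin k → ZMod m))
    (hf : ∀ i x y, γ (f i x) (f (i + 1) y) = β x y) :
    Alg m k q β N →ₐ[ℂ] Alg m k q γ N :=
  RingQuot.liftAlgHom ℂ ⟨FreeAlgebra.lift ℂ (fun p : Fin N × (Fin k → ZMod m) =>
      RingQuot.mkAlgHom ℂ (Rel m k q γ N) (FreeAlgebra.ι ℂ (p.1, f p.1 p.2))), by
    intro a b hab
    cases hab with
    | unit i =>
      simp only [FreeAlgebra.lift_ι_apply, map_zero, map_one]
      rw [RingQuot.mkAlgHom_rel ℂ (Rel.unit i), map_one]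
    | add i g h =>
      simp only [FreeAlgebra.lift_ι_apply, map_add, map_mul]
      rw [← map_mul, RingQuot.mkAlgHom_rel ℂ (Rel.add i _ _)]
    | far i j g h hij =>
      simp only [FreeAlgebra.lift_ι_apply, map_mul]
      rw [← map_mul, RingQuot.mkAlgHom_rel ℂ (Rel.far i j _ _ hij), map_mul]
    | adj i j g h hij =>
      simp only [FreeAlgebra.lift_ι_apply, map_mul, map_smul]
      rw [← map_mul, RingQuot.mkAlgHom_rel ℂ (Rel.adj i j _ _ hij), map_smul, map_mul, hij, hf]⟩

theorem mapHom_ι (m k : ℕ) (q : ℂ)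
    (β γ : (Fin k → ZMod m) → (Fin k → ZMod m) → ZMod m) (N : ℕ)
    (f : ℕ → (Fin k → ZMod m) →+ (Fin k → ZMod m))
    (hf : ∀ i x y, γ (f i x) (f (i + 1) y) = β x y) (i : Fin N) (g : Fin k → ZMod m) :
    mapHom m k q β γ N f hf (RingQuot.mkAlgHom ℂ (Rel m k q β N) (FreeAlgebra.ι ℂ (i, g))) =
      RingQuot.mkAlgHom ℂ (Rel m k q γ N) (FreeAlgebra.ι ℂ (i, f i g)) := by
  simp [mapHom]

theorem mapHom_comp (m k : ℕ) (q : ℂ)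
    (β γ : (Fin k → ZMod m) → (Fin k → ZMod m) → ZMod m) (N : ℕ)
    (f : ℕ → (Fin k → ZMod m) →+ (Fin k → ZMod m))
    (hf : ∀ i x y, γ (f i x) (f (i + 1) y) = β x y)
    (f' : ℕ → (Fin k → ZMod m) →+ (Fin k → ZMod m))
    (hf' : ∀ i x y, β (f' i x) (f' (i + 1) y) = γ x y)
    (h : ∀ i x, f' i (f i x) = x) :
    (mapHom m k q γ β N f' hf').comp (mapHom m k q β γ N f hf) = AlgHom.id ℂ _ := by
  apply RingQuot.ringQuot_ext'
  apply FreeAlgebra.hom_ext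
  funext p
  obtain ⟨i, g⟩ := p
  simp only [Function.comp_apply, AlgHom.comp_apply, AlgHom.id_apply]
  rw [mapHom_ι, mapHom_ι, h]

open Matrix in
theorem exists_T (m k : ℕ) (S : Matrix (Fin k) (Fin k) (ZMod m)) (hS : IsUnit S) :
    ∃ T : ℕ → Matrix (Fin k) (Fin k) (ZMod m),
      (∀ i, IsUnit (T i).det) ∧ ∀ i, (T i)ᵀ * T (i + 1) = S := by
  have hS' := (Matrix.isUnit_iff_isUnit_det S).1 hS
  let T : ℕ → Matrix (Fin k) (Fin k) (ZMod m) :=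
    fun i => Nat.rec 1 (fun _ M => (Mᵀ)⁻¹ * S) i
  have hT : ∀ i, T (i + 1) = ((T i)ᵀ)⁻¹ * S := fun i => rfl
  have hu : ∀ i, IsUnit (T i).det := by
    intro i
    induction i with
    | zero => simp [T]
    | succ i ih =>
      rw [hT, Matrix.det_mul]
      refine IsUnit.mul ?_ hS'
      apply Matrix.isUnit_nonsing_inv_det
      rwa [Matrix.det_transpose]
  refine ⟨T, hu, fun i => ?_⟩
  rw [hT, ← Matrix.mul_assoc, Matrix.mul_nonsing_inv, Matrix.one_mul]
  rw [Matrix.det_transpose]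
  exact hu i

open Matrix in
theorem statement8 (m : ℕ) (hm : 3 ≤ m) (hodd : Odd m) (q : ℂ)
    (hq : IsPrimitiveRoot q m) (k : ℕ) (S : Matrix (Fin k) (Fin k) (ZMod m))
    (hS : IsUnit S) (hsym : S.transpose = S ∨ S.transpose = -S)
    (n : ℕ) (hn : 2 ≤ n) :
    Nonempty
      (Alg m k q (fun x y => x ⬝ᵥ S.mulVec y) (n - 1) ≃ₐ[ℂ]
        Alg m k q (fun x y => x ⬝ᵥ y) (n - 1)) := by
  obtain ⟨T, hu, hT⟩ := exists_T m k S hS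
  have h1 : ∀ i x y, ((T i).mulVecLin.toAddMonoidHom x) ⬝ᵥ ((T (i + 1)).mulVecLin.toAddMonoidHom y)
      = x ⬝ᵥ S.mulVec y := by
    intro i x y
    change (T i *ᵥ x) ⬝ᵥ (T (i + 1) *ᵥ y) = _
    rw [← hT i, ← Matrix.mulVec_mulVec, Matrix.dotProduct_mulVec x, Matrix.vecMul_transpose]
  have l : ∀ i x, (T i)⁻¹.mulVecLin.toAddMonoidHom ((T i).mulVecLin.toAddMonoidHom x) = x := by
    intro i x
    change (T i)⁻¹ *ᵥ (T i *ᵥ x) = x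
    rw [Matrix.mulVec_mulVec, Matrix.nonsing_inv_mul _ (hu i), Matrix.one_mulVec]
  have r : ∀ i x, (T i).mulVecLin.toAddMonoidHom ((T i)⁻¹.mulVecLin.toAddMonoidHom x) = x := by
    intro i x
    change (T i) *ᵥ ((T i)⁻¹ *ᵥ x) = x
    rw [Matrix.mulVec_mulVec, Matrix.mul_nonsing_inv _ (hu i), Matrix.one_mulVec]
  have h2 : ∀ i x y, ((T i)⁻¹.mulVecLin.toAddMonoidHom x) ⬝ᵥ
      S.mulVec ((T (i + 1))⁻¹.mulVecLin.toAddMonoidHom y) = x ⬝ᵥ y := by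
    intro i x y
    rw [← h1 i, r, r]
  exact ⟨AlgEquiv.ofAlgHom
    (mapHom m k q (fun x y => x ⬝ᵥ S.mulVec y) (fun x y => x ⬝ᵥ y) (n - 1)
      (fun i => (T i).mulVecLin.toAddMonoidHom) h1)
    (mapHom m k q (fun x y => x ⬝ᵥ y) (fun x y => x ⬝ᵥ S.mulVec y) (n - 1)
      (fun i => (T i)⁻¹.mulVecLin.toAddMonoidHom) h2)
    (mapHom_comp _ _ _ _ _ _ _ _ _ _ r) (mapHom_comp _ _ _ _ _ _ _ _ _ _ l)⟩

end Stmt8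
end

section
/- For n odd, the center of 𝒜ₙ(ℤ_m × ℤ_m, χ) is one-dimensional (equal to ℂ·1), and 𝒜ₙ(ℤ_m × ℤ_m, χ) is simple, isomorphic as a ℂ-algebra to the full matrix algebra M_{m^{n−1}}(ℂ). -/
/-!
STATEMENT 11: For n odd, the center of 𝒜ₙ(ℤ_m × ℤ_m, χ) is one-dimensional
(ℂ·1), and 𝒜ₙ(ℤ_m × ℤ_m, χ) is simple, isomorphic to M_{m^{n−1}}(ℂ).
-/

namespace Stmt11

/-- Generators u_i, v_i (i = 1,…,n−1, indexed by `Fin N` with `N = n−1`)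
of 𝒜ₙ(ℤ_m × ℤ_m, χ). -/
inductive GenA (N : ℕ) : Type
  | u (i : Fin N) : GenA N
  | v (i : Fin N) : GenA N

/-- The underlying index of a generator. -/
def idx {N : ℕ} : GenA N → ℕ
  | GenA.u i => (i : ℕ)
  | GenA.v i => (i : ℕ)

open GenA in
/-- The defining relations of 𝒜ₙ(ℤ_m × ℤ_m, χ): u_i^m = v_i^m = 1,
u_iv_i = v_iu_i, u_iu_{i+1} = q u_{i+1}u_i, v_iv_{i+1} = q v_{i+1}v_i, and all
other pairs of generators commute. -/
inductive RelA (m N : ℕ) (q : ℂ) :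
    FreeAlgebra ℂ (GenA N) → FreeAlgebra ℂ (GenA N) → Prop
  | upow (i : Fin N) : RelA m N q (FreeAlgebra.ι ℂ (u i) ^ m) 1
  | vpow (i : Fin N) : RelA m N q (FreeAlgebra.ι ℂ (v i) ^ m) 1
  | uvsame (i : Fin N) :
      RelA m N q (FreeAlgebra.ι ℂ (u i) * FreeAlgebra.ι ℂ (v i))
        (FreeAlgebra.ι ℂ (v i) * FreeAlgebra.ι ℂ (u i))
  | uuadj (i j : Fin N) (hij : (j : ℕ) = (i : ℕ) + 1) :
      RelA m N q (FreeAlgebra.ι ℂ (u i) * FreeAlgebra.ι ℂ (u j))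
        (q • (FreeAlgebra.ι ℂ (u j) * FreeAlgebra.ι ℂ (u i)))
  | vvadj (i j : Fin N) (hij : (j : ℕ) = (i : ℕ) + 1) :
      RelA m N q (FreeAlgebra.ι ℂ (v i) * FreeAlgebra.ι ℂ (v j))
        (q • (FreeAlgebra.ι ℂ (v j) * FreeAlgebra.ι ℂ (v i)))
  | uvadj (i j : Fin N) (hij : (j : ℕ) = (i : ℕ) + 1) :
      RelA m N q (FreeAlgebra.ι ℂ (u i) * FreeAlgebra.ι ℂ (v j))
        (FreeAlgebra.ι ℂ (v j) * FreeAlgebra.ι ℂ (u i))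
  | vuadj (i j : Fin N) (hij : (j : ℕ) = (i : ℕ) + 1) :
      RelA m N q (FreeAlgebra.ι ℂ (v i) * FreeAlgebra.ι ℂ (u j))
        (FreeAlgebra.ι ℂ (u j) * FreeAlgebra.ι ℂ (v i))
  | far (a b : GenA N) (hab : 2 ≤ |(idx a : ℤ) - (idx b : ℤ)|) :
      RelA m N q (FreeAlgebra.ι ℂ a * FreeAlgebra.ι ℂ b)
        (FreeAlgebra.ι ℂ b * FreeAlgebra.ι ℂ a)

/-- The algebra 𝒜ₙ(ℤ_m × ℤ_m, χ) (with `N = n − 1`). -/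
abbrev AlgA (m N : ℕ) (q : ℂ) : Type := RingQuot (RelA m N q)

/-- The generator u_i of 𝒜ₙ(ℤ_m × ℤ_m, χ). -/
noncomputable def U (m N : ℕ) (q : ℂ) (i : Fin N) : AlgA m N q :=
  RingQuot.mkAlgHom ℂ (RelA m N q) (FreeAlgebra.ι ℂ (GenA.u i))

/-- The generator v_i of 𝒜ₙ(ℤ_m × ℤ_m, χ). -/
noncomputable def V (m N : ℕ) (q : ℂ) (i : Fin N) : AlgA m N q :=
  RingQuot.mkAlgHom ℂ (RelA m N q) (FreeAlgebra.ι ℂ (GenA.v i))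


/-! ### Helper material -/

noncomputable instance (N : ℕ) : DecidableEq (GenA N) := Classical.decEq _

/-- Generators as a sum type. -/
def genEquiv (N : ℕ) : GenA N ≃ Fin N ⊕ Fin N where
  toFun
    | GenA.u i => Sum.inl i
    | GenA.v i => Sum.inr i
  invFun
    | Sum.inl i => GenA.u i
    | Sum.inr i => GenA.v i
  left_inv := by rintro (i | i) <;> rfl
  right_inv := by rintro (i | i) <;> rfl

noncomputable instance (N : ℕ) : Fintype (GenA N) := Fintype.ofEquiv _ (genEquiv N).symm

lemma card_gen (N : ℕ) : Fintype.card (GenA N) = N + N := by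
  rw [Fintype.card_congr (genEquiv N)]; simp

lemma sum_gen {N : ℕ} {M : Type*} [AddCommMonoid M] (f : GenA N → M) :
    ∑ g, f g = ∑ i, f (GenA.u i) + ∑ i, f (GenA.v i) := by
  rw [← (genEquiv N).symm.sum_comp, Fintype.sum_sum_type]; rfl

/-- indicator of `j = i+1` -/
def nx (m : ℕ) {N : ℕ} (i j : Fin N) : ZMod m := if (j : ℕ) = i + 1 then 1 else 0

/-- commutation exponents -/
def om (m : ℕ) {N : ℕ} : GenA N → GenA N → ZMod m
  | GenA.u i, GenA.u j => nx m i j - nx m j i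
  | GenA.v i, GenA.v j => nx m i j - nx m j i
  | GenA.u _, GenA.v _ => 0
  | GenA.v _, GenA.u _ => 0

/-- ordered monomials -/
def mon {R : Type*} [Monoid R] {G : Type*} {m : ℕ} (g : G → R) (l : List G) (α : G → ZMod m) : R :=
  (l.map fun x => g x ^ (α x).val).prod

lemma pow_comm' {R : Type*} [Ring R] [Algebra ℂ R] {m : ℕ} [NeZero m]
    (e : AddChar (ZMod m) ℂ) (x y : R) (w : ZMod m) (h : x * y = e w • (y * x)) (k : ℕ) :
    x * y ^ k = e (w * k) • (y ^ k * x) := by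
  induction k with
  | zero => simp
  | succ k ih =>
    rw [pow_succ, ← mul_assoc, ih, smul_mul_assoc, mul_assoc, h, mul_smul_comm, smul_smul,
      ← AddChar.map_add_eq_mul, mul_assoc]
    congr 2; push_cast; ring

lemma mul_mon {R : Type*} [Ring R] [Algebra ℂ R] {m : ℕ} [NeZero m] {G : Type*} [DecidableEq G]
    (e : AddChar (ZMod m) ℂ) (g : G → R) (w : G → G → ZMod m)
    (hg : ∀ a b, g a * g b = e (w a b) • (g b * g a)) (a : G) (l : List G) (α : G → ZMod m) :
    g a * mon g l α = e ((l.map fun x => w a x * α x).sum) • (mon g l α * g a) := by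
  induction l with
  | nil => simp [mon]
  | cons b t ih =>
    have h1 := pow_comm' e (g a) (g b) _ (hg a b) (α b).val
    simp only [mon, List.map_cons, List.prod_cons, List.sum_cons] at *
    rw [← mul_assoc, h1, smul_mul_assoc, mul_assoc, ih, mul_smul_comm, smul_smul,
      ← AddChar.map_add_eq_mul, mul_assoc]
    simp

lemma mon_congr {R : Type*} [Monoid R] {G : Type*} {m : ℕ} (g : G → R) (l : List G)
    (α β : G → ZMod m) (h : ∀ x ∈ l, α x = β x) : mon g l α = mon g l β := by
  unfold mon
  congr 1
  apply List.map_congr_left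
  intro x hx; rw [h x hx]

lemma mul_pow_val {R : Type*} [Monoid R] {m : ℕ} [NeZero m] (x : R) (hx : x ^ m = 1)
    (c : ZMod m) : x * x ^ c.val = x ^ (c + 1).val := by
  have h : ∀ k, x ^ (k % m) = x ^ k := fun k => by
    conv_rhs => rw [← Nat.mod_add_div k m, pow_add, pow_mul, hx, one_pow, mul_one]
  rw [← pow_succ', ZMod.val_add, h, pow_add, pow_add, ZMod.val_one_eq_one_mod, h]

lemma absorb {R : Type*} [Ring R] [Algebra ℂ R] {m : ℕ} [NeZero m] {G : Type*} [DecidableEq G]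
    (e : AddChar (ZMod m) ℂ) (g : G → R) (w : G → G → ZMod m)
    (hg : ∀ a b, g a * g b = e (w a b) • (g b * g a)) (hp : ∀ a, g a ^ m = 1)
    (a : G) (l : List G) (hl : l.Nodup) (ha : a ∈ l) (α : G → ZMod m) :
    ∃ c : ℂ, g a * mon g l α = c • mon g l (α + Pi.single a 1) := by
  induction l with
  | nil => simp at ha
  | cons b t ih =>
    rw [List.nodup_cons] at hl
    have hmon : ∀ γ : G → ZMod m, mon g (b :: t) γ = g b ^ (γ b).val * mon g t γ := by
      intro γ; simp [mon]
    rw [hmon, hmon]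
    by_cases hab : a = b
    · subst hab
      refine ⟨1, ?_⟩
      rw [← mul_assoc, mul_pow_val _ (hp a), one_smul]
      congr 1
      · simp
      · apply mon_congr
        intro x hx
        have : x ≠ a := by rintro rfl; exact hl.1 hx
        simp [this]
    · have hat : a ∈ t := by simpa [hab] using ha
      obtain ⟨c, hc⟩ := ih hl.2 hat
      refine ⟨e (w a b * ((α b).val : ℕ)) * c, ?_⟩
      rw [← mul_assoc, pow_comm' e (g a) (g b) _ (hg a b), smul_mul_assoc, mul_assoc, hc,
        mul_smul_comm, smul_smul]
      have : b ≠ a := fun h => hab h.symm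
      simp [this]

/-- Weyl operators. -/
def W {m N : ℕ} (e : AddChar (ZMod m) ℂ) (a b : Fin N → ZMod m) :
    Matrix (Fin N → ZMod m) (Fin N → ZMod m) ℂ :=
  fun y x => if y = x + a then e (b ⬝ᵥ x) else 0

lemma W_mul {m N : ℕ} [NeZero m] (e : AddChar (ZMod m) ℂ) (a b c d : Fin N → ZMod m) :
    W e a b * W e c d = e (b ⬝ᵥ c) • W e (a + c) (b + d) := by
  ext y x
  rw [Matrix.mul_apply, Finset.sum_eq_single (x + c)]
  · simp only [W, Matrix.smul_apply, smul_eq_mul, if_true]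
    have : x + c + a = x + (a + c) := by abel
    rw [this]
    split_ifs
    · rw [← AddChar.map_add_eq_mul, ← AddChar.map_add_eq_mul]
      congr 1
      rw [dotProduct_add, add_dotProduct]; ring
    · simp
  · intro z _ hz
    simp [W, hz]
  · simp

lemma W_zero {m N : ℕ} [NeZero m] (e : AddChar (ZMod m) ℂ) :
    W e (0 : Fin N → ZMod m) 0 = 1 := by
  ext y x
  simp [W, Matrix.one_apply]

lemma W_pow {m N : ℕ} [NeZero m] (e : AddChar (ZMod m) ℂ) (a b : Fin N → ZMod m)
    (h : b ⬝ᵥ a = 0) (k : ℕ) : W e a b ^ k = W e (k • a) (k • b) := by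
  induction k with
  | zero => simp [W_zero]
  | succ k ih =>
    rw [pow_succ, ih, W_mul, smul_dotProduct, h]
    rw [smul_zero, AddChar.map_zero_eq_one, one_smul, succ_nsmul, succ_nsmul]

/-- position part -/
def ga (m : ℕ) {N : ℕ} : GenA N → Fin N → ZMod m
  | GenA.u i => Pi.single i 1
  | GenA.v i => Pi.single i ((-1) ^ (i : ℕ))

/-- momentum part -/
def gb (m : ℕ) {N : ℕ} : GenA N → Fin N → ZMod m
  | GenA.u i => fun j => nx m i j
  | GenA.v i => fun j => (-1) ^ (i : ℕ) * nx m j i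

lemma gb_ga (m : ℕ) {N : ℕ} (x y : GenA N) : gb m x ⬝ᵥ ga m y = om m x y + gb m y ⬝ᵥ ga m x := by
  rcases x with i | i <;> rcases y with j | j <;> simp only [ga, gb, om, dotProduct_single]
  · ring
  · ring
  · ring
  · unfold nx
    split_ifs with h1 h2 h2
    · omega
    · rw [h1, pow_succ]; ring_nf; simp
    · rw [h2, pow_succ]; ring_nf; simp
    · ring

lemma gb_self (m : ℕ) {N : ℕ} (x : GenA N) : gb m x ⬝ᵥ ga m x = 0 := by
  rcases x with i | i <;> simp [ga, gb, nx]

/-- representing matrices of the generators -/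
def GM {m N : ℕ} (e : AddChar (ZMod m) ℂ) (x : GenA N) :
    Matrix (Fin N → ZMod m) (Fin N → ZMod m) ℂ := W e (ga m x) (gb m x)

lemma GM_comm {m N : ℕ} [NeZero m] (e : AddChar (ZMod m) ℂ) (x y : GenA N) :
    GM e x * GM e y = e (om m x y) • (GM e y * GM e x) := by
  rw [GM, GM, W_mul, W_mul, smul_smul, ← AddChar.map_add_eq_mul, gb_ga, add_comm (ga m x),
    add_comm (gb m x)]

lemma GM_pow {m N : ℕ} [NeZero m] (e : AddChar (ZMod m) ℂ) (x : GenA N) :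
    GM e x ^ m = 1 := by
  rw [GM, W_pow _ _ _ (gb_self m x)]
  have h : ∀ f : Fin N → ZMod m, m • f = 0 := fun f => by
    funext i; simp
  rw [h, h, W_zero]

lemma om_far (m : ℕ) {N : ℕ} (a b : GenA N) (hab : 2 ≤ |(idx a : ℤ) - (idx b : ℤ)|) :
    om m a b = 0 := by
  rw [le_abs] at hab
  rcases a with i | i <;> rcases b with j | j <;> simp only [idx, om, nx] at * <;>
  · try rw [if_neg (by omega), if_neg (by omega), sub_zero]

lemma nx_one (m : ℕ) {N : ℕ} (i j : Fin N) (h : (j : ℕ) = i + 1) : nx m i j - nx m j i = 1 := by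
  unfold nx
  rw [if_pos h, if_neg (by omega), sub_zero]

/-- generator in A -/
noncomputable def gA (m N : ℕ) (q : ℂ) (x : GenA N) : AlgA m N q :=
  RingQuot.mkAlgHom ℂ (RelA m N q) (FreeAlgebra.ι ℂ x)

lemma gA_pow (m N : ℕ) (q : ℂ) (x : GenA N) : gA m N q x ^ m = 1 := by
  unfold gA
  rw [← map_pow, ← map_one (RingQuot.mkAlgHom ℂ (RelA m N q))]
  apply RingQuot.mkAlgHom_rel
  rcases x with i | i
  · exact RelA.upow i
  · exact RelA.vpow i

lemma gA_rel (m N : ℕ) (q : ℂ) (x y : GenA N) (c : ℂ)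
    (h : RelA m N q (FreeAlgebra.ι ℂ x * FreeAlgebra.ι ℂ y)
      (c • (FreeAlgebra.ι ℂ y * FreeAlgebra.ι ℂ x))) :
    gA m N q x * gA m N q y = c • (gA m N q y * gA m N q x) := by
  have := RingQuot.mkAlgHom_rel ℂ h
  simpa [gA] using this

lemma gA_rel1 (m N : ℕ) (q : ℂ) (x y : GenA N)
    (h : RelA m N q (FreeAlgebra.ι ℂ x * FreeAlgebra.ι ℂ y)
      (FreeAlgebra.ι ℂ y * FreeAlgebra.ι ℂ x)) :
    gA m N q x * gA m N q y = gA m N q y * gA m N q x := by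
  have := RingQuot.mkAlgHom_rel ℂ h
  simpa [gA] using this

lemma om_anti (m : ℕ) {N : ℕ} (a b : GenA N) : om m b a = - om m a b := by
  rcases a with i | i <;> rcases b with j | j <;> simp [om]

lemma gA_comm_le (m N : ℕ) [NeZero m] (q : ℂ) (e : AddChar (ZMod m) ℂ) (he : e 1 = q)
    (x y : GenA N) (hxy : idx x ≤ idx y) :
    gA m N q x * gA m N q y = e (om m x y) • (gA m N q y * gA m N q x) := by
  by_cases hfar : 2 ≤ |(idx x : ℤ) - (idx y : ℤ)|
  · rw [om_far m _ _ hfar, AddChar.map_zero_eq_one, one_smul]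
    exact gA_rel1 _ _ _ _ _ (RelA.far x y hfar)
  · have h : idx y = idx x ∨ idx y = idx x + 1 := by
      rw [le_abs] at hfar; omega
    rcases x with i | i <;> rcases y with j | j <;> simp only [idx] at h <;>
      rcases h with h | h
    · obtain rfl := Fin.ext h
      simp [om]
    · simp only [om]
      rw [nx_one m i j h, he]
      exact gA_rel _ _ _ _ _ _ (RelA.uuadj i j h)
    · obtain rfl := Fin.ext h
      simp only [om, AddChar.map_zero_eq_one, one_smul]
      exact gA_rel1 _ _ _ _ _ (RelA.uvsame _)
    · simp only [om, AddChar.map_zero_eq_one, one_smul]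
      exact gA_rel1 _ _ _ _ _ (RelA.uvadj i j h)
    · obtain rfl := Fin.ext h
      simp only [om, AddChar.map_zero_eq_one, one_smul]
      exact (gA_rel1 _ _ _ _ _ (RelA.uvsame _)).symm
    · simp only [om, AddChar.map_zero_eq_one, one_smul]
      exact gA_rel1 _ _ _ _ _ (RelA.vuadj i j h)
    · obtain rfl := Fin.ext h
      simp [om]
    · simp only [om]
      rw [nx_one m i j h, he]
      exact gA_rel _ _ _ _ _ _ (RelA.vvadj i j h)

lemma gA_comm (m N : ℕ) [NeZero m] (q : ℂ) (e : AddChar (ZMod m) ℂ) (he : e 1 = q)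
    (x y : GenA N) :
    gA m N q x * gA m N q y = e (om m x y) • (gA m N q y * gA m N q x) := by
  rcases le_total (idx x) (idx y) with h | h
  · exact gA_comm_le m N q e he x y h
  · rw [gA_comm_le m N q e he y x h, smul_smul, ← AddChar.map_add_eq_mul, om_anti m x y,
      add_neg_cancel, AddChar.map_zero_eq_one, one_smul]

lemma GM_rel {m N : ℕ} [NeZero m] (q : ℂ) (e : AddChar (ZMod m) ℂ) (he : e 1 = q)
    ⦃x y : FreeAlgebra ℂ (GenA N)⦄ (h : RelA m N q x y) :
    FreeAlgebra.lift ℂ (GM (N := N) e) x = FreeAlgebra.lift ℂ (GM e) y := by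
  cases h with
  | upow i => simp [GM_pow]
  | vpow i => simp [GM_pow]
  | uvsame i =>
    simp only [map_mul, FreeAlgebra.lift_ι_apply]; rw [GM_comm]; simp [om]
  | uuadj i j h =>
    simp only [map_mul, map_smul, FreeAlgebra.lift_ι_apply]
    rw [GM_comm, om, nx_one m i j h, he]
  | vvadj i j h =>
    simp only [map_mul, map_smul, FreeAlgebra.lift_ι_apply]
    rw [GM_comm, om, nx_one m i j h, he]
  | uvadj i j h =>
    simp only [map_mul, FreeAlgebra.lift_ι_apply]; rw [GM_comm]; simp [om]
  | vuadj i j h =>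
    simp only [map_mul, FreeAlgebra.lift_ι_apply]; rw [GM_comm]; simp [om]
  | far a b hab =>
    simp only [map_mul, FreeAlgebra.lift_ι_apply]; rw [GM_comm, om_far m _ _ hab]; simp

/-- the representation -/
noncomputable def phi {m N : ℕ} [NeZero m] (q : ℂ) (e : AddChar (ZMod m) ℂ) (he : e 1 = q) :
    AlgA m N q →ₐ[ℂ] Matrix (Fin N → ZMod m) (Fin N → ZMod m) ℂ :=
  RingQuot.liftAlgHom ℂ ⟨FreeAlgebra.lift ℂ (GM e), GM_rel q e he⟩

lemma phi_gA {m N : ℕ} [NeZero m] (q : ℂ) (e : AddChar (ZMod m) ℂ) (he : e 1 = q) (x : GenA N) :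
    phi q e he (gA m N q x) = GM e x := by
  simp [phi, gA]

lemma mon_map {R S : Type*} [Monoid R] [Monoid S] {G : Type*} {m : ℕ} (f : R →* S) (g : G → R)
    (l : List G) (α : G → ZMod m) : f (mon g l α) = mon (fun x => f (g x)) l α := by
  simp [mon, map_list_prod, Function.comp_def]

lemma span_mon (m N : ℕ) [NeZero m] (q : ℂ) (e : AddChar (ZMod m) ℂ) (he : e 1 = q) :
    Submodule.span ℂ (Set.range fun α : GenA N → ZMod m =>
      mon (gA m N q) Finset.univ.toList α) = ⊤ := by
  set S := Submodule.span ℂ (Set.range fun α : GenA N → ZMod m =>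
      mon (gA m N q) Finset.univ.toList α) with hS
  have h1 : (1 : AlgA m N q) ∈ S := by
    apply Submodule.subset_span
    exact ⟨0, by simp [mon]⟩
  have hmul : ∀ a, ∀ x ∈ S, gA m N q a * x ∈ S := by
    intro a x hx
    induction hx using Submodule.span_induction with
    | mem x hx =>
      obtain ⟨α, rfl⟩ := hx
      obtain ⟨c, hc⟩ := absorb e (gA m N q) (om m) (gA_comm m N q e he) (gA_pow m N q) a
        Finset.univ.toList (Finset.nodup_toList _) (by simp) α
      simp only [hc]
      exact S.smul_mem _ (Submodule.subset_span ⟨_, rfl⟩)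
    | zero => simp
    | add x y _ _ hx hy => rw [mul_add]; exact S.add_mem hx hy
    | smul c x _ hx => rw [mul_smul_comm]; exact S.smul_mem _ hx
  have key : ∀ z : FreeAlgebra ℂ (GenA N), ∀ x ∈ S,
      RingQuot.mkAlgHom ℂ (RelA m N q) z * x ∈ S := by
    intro z
    induction z using FreeAlgebra.induction with
    | grade0 r =>
      intro x hx
      rw [AlgHom.commutes, ← Algebra.smul_def]
      exact S.smul_mem _ hx
    | grade1 a => exact hmul a
    | mul a b ha hb => 
      intro x hx
      rw [map_mul, mul_assoc]
      exact ha _ (hb _ hx)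
    | add a b ha hb =>
      intro x hx
      rw [map_add, add_mul]
      exact S.add_mem (ha _ hx) (hb _ hx)
  rw [eq_top_iff]
  intro z _
  obtain ⟨z, rfl⟩ := RingQuot.mkAlgHom_surjective ℂ (RelA m N q) z
  simpa using key z 1 h1

lemma nx_sum (m N : ℕ) (i : Fin N) (γ : Fin N → ZMod m) (f : ℕ → ZMod m)
    (hf : ∀ j : Fin N, f (j + 1) = γ j) (h0 : f 0 = 0) (hN : ∀ k, N < k → f k = 0) :
    ∑ j, (nx m i j - nx m j i) * γ j = f (i + 2) - f i := by
  simp only [sub_mul, Finset.sum_sub_distrib]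
  congr 1
  · by_cases h : (i : ℕ) + 1 < N
    · rw [Finset.sum_eq_single ⟨i + 1, h⟩]
      · rw [← hf]; simp [nx]
      · intro j _ hj
        have : ¬ (j : ℕ) = i + 1 := fun h => hj (Fin.ext h)
        simp [nx, this]
      · simp
    · rw [hN _ (by omega)]
      apply Finset.sum_eq_zero
      intro j _
      have : ¬ (j : ℕ) = i + 1 := by omega
      simp [nx, this]
  · by_cases h : (i : ℕ) = 0
    · rw [h, h0]
      apply Finset.sum_eq_zero
      intro j _
      simp [nx, h]
    · rw [Finset.sum_eq_single ⟨i - 1, by omega⟩]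
      · rw [← hf]
        have : (i : ℕ) - 1 + 1 = i := by omega
        simp [nx, this]
      · intro j _ hj
        have : ¬ (i : ℕ) = j + 1 := fun h => hj (Fin.ext (by simp; omega))
        simp [nx, this]
      · simp

lemma nondeg1 (m N : ℕ) (hN : Even N) (γ : Fin N → ZMod m)
    (h : ∀ i, ∑ j, (nx m i j - nx m j i) * γ j = 0) : γ = 0 := by
  let f : ℕ → ZMod m := fun k => if hk : 0 < k ∧ k ≤ N then γ ⟨k - 1, by omega⟩ else 0
  have hf : ∀ j : Fin N, f (j + 1) = γ j := by
    intro j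
    have : 0 < (j : ℕ) + 1 ∧ (j : ℕ) + 1 ≤ N := by omega
    simp only [f, dif_pos this]
    congr 1
  have h0 : f 0 = 0 := by simp [f]
  have hNf : ∀ k, N < k → f k = 0 := by
    intro k hk
    have : ¬ (0 < k ∧ k ≤ N) := by omega
    simp only [f, dif_neg this]
  have step : ∀ i, i < N → f (i + 2) = f i := by
    intro i hi
    have := h ⟨i, hi⟩
    rw [nx_sum m N _ γ f hf h0 hNf] at this
    exact sub_eq_zero.mp this
  obtain ⟨r, hr⟩ := hN
  have hev : ∀ t, t ≤ r → f (2 * t) = 0 := by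
    intro t
    induction t with
    | zero => intro _; exact h0
    | succ t ih =>
      intro ht
      rw [show 2 * (t + 1) = 2 * t + 2 by ring, step _ (by omega), ih (by omega)]
  have hod : ∀ t, t ≤ r → f (N + 1 - 2 * t) = 0 := by
    intro t
    induction t with
    | zero => intro _; exact hNf _ (by omega)
    | succ t ih =>
      intro ht
      rw [← step _ (by omega), show N + 1 - 2 * (t + 1) + 2 = N + 1 - 2 * t by omega,
        ih (by omega)]
  funext j
  rw [← hf, Pi.zero_apply]
  rcases Nat.even_or_odd' ((j : ℕ) + 1) with ⟨c, hc | hc⟩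
  · rw [hc]; exact hev _ (by omega)
  · have := hod (r - c) (by omega)
    rwa [show N + 1 - 2 * (r - c) = (j : ℕ) + 1 by omega] at this

lemma nondeg (m N : ℕ) (hN : Even N) (γ : GenA N → ZMod m)
    (h : ∀ a, ∑ x, om m a x * γ x = 0) : γ = 0 := by
  have hu := nondeg1 m N hN (fun i => γ (GenA.u i)) (fun i => by
    simpa [sum_gen, om] using h (GenA.u i))
  have hv := nondeg1 m N hN (fun i => γ (GenA.v i)) (fun i => by
    simpa [sum_gen, om] using h (GenA.v i))
  funext x
  rcases x with i | i
  · exact congrFun hu i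
  · exact congrFun hv i

lemma isUnit_of_pow {R : Type*} [Monoid R] {m : ℕ} [NeZero m] (x : R) (h : x ^ m = 1) :
    IsUnit x := IsUnit.of_pow_eq_one h (NeZero.ne m)

lemma inv_comm' {R : Type*} [Ring R] [Algebra ℂ R] (g B : Rˣ) (c : ℂ)
    (h : (g : R) * B = c • ((B : R) * g)) :
    ((B⁻¹ : Rˣ) : R) * g = c • ((g : R) * ((B⁻¹ : Rˣ) : R)) := by
  have h9 : ((B⁻¹ : Rˣ) : R) * ((g : R) * B) * ((B⁻¹ : Rˣ) : R) = ((B⁻¹ : Rˣ) : R) * g := by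
    simp [mul_assoc]
  rw [← h9, h]
  simp [mul_assoc]

lemma indep (m N : ℕ) [NeZero m] (hN : Even N) (e : AddChar (ZMod m) ℂ)
    (hinj : ∀ w, e w = 1 → w = 0) :
    LinearIndependent ℂ (fun α : GenA N → ZMod m => mon (GM e) Finset.univ.toList α) := by
  set M := fun α : GenA N → ZMod m => mon (GM e) Finset.univ.toList α with hM
  have hMu : ∀ α, IsUnit (M α) := by
    intro α
    simp only [hM, mon]
    apply List.prod_isUnit
    intro x hx
    obtain ⟨y, _, rfl⟩ := List.mem_map.mp hx
    exact (isUnit_of_pow _ (GM_pow e y)).pow _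
  have hcomm : ∀ a α, GM e a * M α = e (∑ x, om m a x * α x) • (M α * GM e a) := by
    intro a α
    have := mul_mon e (GM e) (om m) (GM_comm e) a Finset.univ.toList α
    rwa [Finset.sum_map_toList] at this
  rw [Fintype.linearIndependent_iff]
  intro c hc β
  obtain ⟨B, hB⟩ := hMu β
  have htr : ∀ α, α ≠ β → Matrix.trace (M α * (↑B⁻¹ : Matrix (Fin N → ZMod m) (Fin N → ZMod m) ℂ)) = 0 := by
    intro α hαβ
    have hex : ∃ a, ∑ x, om m a x * (α - β) x ≠ 0 := by
      by_contra! hcon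
      exact hαβ (sub_eq_zero.mp (nondeg m N hN _ hcon))
    obtain ⟨a, ha⟩ := hex
    obtain ⟨g, hg⟩ := isUnit_of_pow _ (GM_pow e a)
    have h1 := hcomm a α
    have h2 := hcomm a β
    rw [← hg] at h1 h2
    rw [← hB] at h2
    have h3 : (↑B⁻¹ : Matrix (Fin N → ZMod m) (Fin N → ZMod m) ℂ) * g = e (∑ x, om m a x * β x) • (g * (↑B⁻¹ : Matrix (Fin N → ZMod m) (Fin N → ZMod m) ℂ)) := by
      exact inv_comm' g B _ h2
    have h4 : Matrix.trace (M α * (↑B⁻¹ : Matrix (Fin N → ZMod m) (Fin N → ZMod m) ℂ)) * e (∑ x, om m a x * β x) =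
        e (∑ x, om m a x * α x) * Matrix.trace (M α * (↑B⁻¹ : Matrix (Fin N → ZMod m) (Fin N → ZMod m) ℂ)) := by
      have h6 : e (∑ x, om m a x * β x) • ((g : Matrix (Fin N → ZMod m) (Fin N → ZMod m) ℂ) *
          (M α * (↑B⁻¹ : Matrix (Fin N → ZMod m) (Fin N → ZMod m) ℂ))) =
          e (∑ x, om m a x * α x) • (M α * (↑B⁻¹ : Matrix (Fin N → ZMod m) (Fin N → ZMod m) ℂ) * g) := by
        rw [mul_assoc (M α), h3, ← mul_assoc, h1, smul_mul_assoc, mul_smul_comm, smul_comm,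
          mul_assoc]
      have h7 := congrArg (fun Y => Matrix.trace (Y * 
        (↑g⁻¹ : Matrix (Fin N → ZMod m) (Fin N → ZMod m) ℂ))) h6
      simp only [smul_mul_assoc, Matrix.trace_smul, smul_eq_mul] at h7
      rw [Matrix.trace_mul_comm, ← mul_assoc, Units.inv_mul, one_mul, mul_assoc _ (g : Matrix (Fin N → ZMod m) (Fin N → ZMod m) ℂ),
        Units.mul_inv, mul_one] at h7
      rw [mul_comm, h7]
    by_contra h0
    rw [mul_comm] at h4
    have h8 := mul_right_cancel₀ h0 h4
    apply ha
    apply hinj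
    simp only [Pi.sub_apply, mul_sub, Finset.sum_sub_distrib]
    rw [AddChar.map_sub_eq_div, ← h8, div_self]
    exact (AddChar.val_isUnit e _).ne_zero
  have h5 : Matrix.trace ((∑ α, c α • M α) * (↑B⁻¹ : Matrix (Fin N → ZMod m) (Fin N → ZMod m) ℂ)) = 0 := by rw [hc]; simp
  rw [Finset.sum_mul, Matrix.trace_sum, Finset.sum_eq_single β] at h5
  · rw [← hB] at h5
    simpa [Matrix.trace_one, NeZero.ne m] using h5
  · intro α _ h
    rw [smul_mul_assoc, Matrix.trace_smul, htr α h, smul_zero]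
  · simp

lemma main_equiv (m N : ℕ) [NeZero m] (hN : Even N) (q : ℂ) (hq : IsPrimitiveRoot q m) :
    Nonempty (AlgA m N q ≃ₐ[ℂ] Matrix (Fin (m ^ N)) (Fin (m ^ N)) ℂ) := by
  let e : AddChar (ZMod m) ℂ := AddChar.zmodChar m hq.pow_eq_one
  have he : e 1 = q := by
    have := AddChar.zmodChar_apply' hq.pow_eq_one 1
    simpa [e] using this
  have hinj : ∀ w, e w = 1 → w = 0 := by
    intro w hw
    rw [AddChar.zmodChar_apply] at hw
    have h := hq.dvd_of_pow_eq_one _ hw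
    exact (ZMod.val_eq_zero w).mp (Nat.eq_zero_of_dvd_of_lt h (ZMod.val_lt w))
  have hind := indep m N hN e hinj
  have hspan := span_mon m N q e he
  have hcard : Fintype.card (GenA N → ZMod m) = m ^ N * m ^ N := by
    rw [Fintype.card_fun, ZMod.card, card_gen, pow_add]
  have hfM : Module.finrank ℂ (Matrix (Fin N → ZMod m) (Fin N → ZMod m) ℂ) = m ^ N * m ^ N := by
    rw [Module.finrank_matrix]; simp
  have hspM := hind.span_eq_top_of_card_eq_finrank' (by rw [hcard, hfM])
  have himg : ∀ α : GenA N → ZMod m, phi q e he (mon (gA m N q) Finset.univ.toList α) =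
      mon (GM e) Finset.univ.toList α := by
    intro α
    have := mon_map (phi (N := N) q e he).toRingHom.toMonoidHom (gA m N q) Finset.univ.toList α
    simpa [phi_gA] using this
  have hsurj : Function.Surjective (phi (N := N) q e he).toLinearMap := by
    rw [← LinearMap.range_eq_top, eq_top_iff, ← hspM, Submodule.span_le]
    rintro _ ⟨α, rfl⟩
    exact ⟨_, himg α⟩
  have hfin : Module.Finite ℂ (AlgA m N q) := by
    refine ⟨⟨(Set.finite_range fun α : GenA N → ZMod m =>
      mon (gA m N q) Finset.univ.toList α).toFinset, ?_⟩⟩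
    rw [Set.Finite.coe_toFinset, hspan]
  have hle : Module.finrank ℂ (AlgA m N q) ≤ m ^ N * m ^ N := by
    have := finrank_range_le_card (R := ℂ) (fun α : GenA N → ZMod m =>
      mon (gA m N q) Finset.univ.toList α)
    rw [Set.finrank, hspan, finrank_top, hcard] at this
    exact this
  have hge := LinearMap.finrank_le_finrank_of_surjective hsurj
  have hinj : Function.Injective (phi (N := N) q e he).toLinearMap :=
    (LinearMap.injective_iff_surjective_of_finrank_eq_finrank (by omega)).mpr hsurj
  have e1 := AlgEquiv.ofBijective (phi (N := N) q e he) ⟨hinj, hsurj⟩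
  have e2 : (Fin N → ZMod m) ≃ Fin (m ^ N) := Fintype.equivFinOfCardEq (by simp)
  exact ⟨e1.trans (Matrix.reindexAlgEquiv ℂ ℂ e2)⟩

theorem statement11 (m : ℕ) (hm : 3 ≤ m) (hodd : Odd m) (q : ℂ)
    (hq : IsPrimitiveRoot q m) (n : ℕ) (hn : Odd n) :
    Module.finrank ℂ (Subalgebra.center ℂ (AlgA m (n - 1) q)) = 1 ∧
    IsSimpleRing (AlgA m (n - 1) q) ∧
    Nonempty (AlgA m (n - 1) q ≃ₐ[ℂ]
      Matrix (Fin (m ^ (n - 1))) (Fin (m ^ (n - 1))) ℂ) := by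
  have : NeZero m := ⟨by omega⟩
  have hN : Even (n - 1) := hn.tsub_odd odd_one
  have hne : Nonempty (Fin (m ^ (n - 1))) := Fin.pos_iff_nonempty.mp (by positivity)
  obtain ⟨E⟩ := main_equiv m (n - 1) hN q hq
  refine ⟨?_, ?_, ⟨E⟩⟩
  · have hc : Algebra.IsCentral ℂ (AlgA m (n - 1) q) := Algebra.IsCentral.of_algEquiv _ _ _ E.symm
    have : Nontrivial (AlgA m (n - 1) q) := E.toRingEquiv.toEquiv.nontrivial
    rw [Algebra.IsCentral.center_eq_bot]
    exact Subalgebra.finrank_bot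
  · exact IsSimpleRing.of_ringEquiv E.symm.toRingEquiv inferInstance

end Stmt11
end

section
/- For n even, the center of 𝒜ₙ(ℤ_m × ℤ_m, χ) has ℂ-dimension m², and 𝒜ₙ(ℤ_m × ℤ_m, χ) is isomorphic as a ℂ-algebra to a direct product of m² copies of the matrix algebra M_{m^{n−2}}(ℂ) (i.e., it decomposes as a direct sum of m² simple algebras, each of dimension m^{2n−4}). -/
/-!
STATEMENT 12: For n even, the center of 𝒜ₙ(ℤ_m × ℤ_m, χ) has ℂ-dimension m²,
and 𝒜ₙ(ℤ_m × ℤ_m, χ) is isomorphic to a direct product of m² copies of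
M_{m^{n−2}}(ℂ).
-/

namespace Stmt12

/-- Generators u_i, v_i (i = 1,…,n−1, indexed by `Fin N` with `N = n−1`)
of 𝒜ₙ(ℤ_m × ℤ_m, χ). -/
inductive GenA (N : ℕ) : Type
  | u (i : Fin N) : GenA N
  | v (i : Fin N) : GenA N

/-- The underlying index of a generator. -/
def idx {N : ℕ} : GenA N → ℕ
  | GenA.u i => (i : ℕ)
  | GenA.v i => (i : ℕ)

open GenA in
/-- The defining relations of 𝒜ₙ(ℤ_m × ℤ_m, χ): u_i^m = v_i^m = 1,
u_iv_i = v_iu_i, u_iu_{i+1} = q u_{i+1}u_i, v_iv_{i+1} = q v_{i+1}v_i, and all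
other pairs of generators commute. -/
inductive RelA (m N : ℕ) (q : ℂ) :
    FreeAlgebra ℂ (GenA N) → FreeAlgebra ℂ (GenA N) → Prop
  | upow (i : Fin N) : RelA m N q (FreeAlgebra.ι ℂ (u i) ^ m) 1
  | vpow (i : Fin N) : RelA m N q (FreeAlgebra.ι ℂ (v i) ^ m) 1
  | uvsame (i : Fin N) :
      RelA m N q (FreeAlgebra.ι ℂ (u i) * FreeAlgebra.ι ℂ (v i))
        (FreeAlgebra.ι ℂ (v i) * FreeAlgebra.ι ℂ (u i))
  | uuadj (i j : Fin N) (hij : (j : ℕ) = (i : ℕ) + 1) :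
      RelA m N q (FreeAlgebra.ι ℂ (u i) * FreeAlgebra.ι ℂ (u j))
        (q • (FreeAlgebra.ι ℂ (u j) * FreeAlgebra.ι ℂ (u i)))
  | vvadj (i j : Fin N) (hij : (j : ℕ) = (i : ℕ) + 1) :
      RelA m N q (FreeAlgebra.ι ℂ (v i) * FreeAlgebra.ι ℂ (v j))
        (q • (FreeAlgebra.ι ℂ (v j) * FreeAlgebra.ι ℂ (v i)))
  | uvadj (i j : Fin N) (hij : (j : ℕ) = (i : ℕ) + 1) :
      RelA m N q (FreeAlgebra.ι ℂ (u i) * FreeAlgebra.ι ℂ (v j))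
        (FreeAlgebra.ι ℂ (v j) * FreeAlgebra.ι ℂ (u i))
  | vuadj (i j : Fin N) (hij : (j : ℕ) = (i : ℕ) + 1) :
      RelA m N q (FreeAlgebra.ι ℂ (v i) * FreeAlgebra.ι ℂ (u j))
        (FreeAlgebra.ι ℂ (u j) * FreeAlgebra.ι ℂ (v i))
  | far (a b : GenA N) (hab : 2 ≤ |(idx a : ℤ) - (idx b : ℤ)|) :
      RelA m N q (FreeAlgebra.ι ℂ a * FreeAlgebra.ι ℂ b)
        (FreeAlgebra.ι ℂ b * FreeAlgebra.ι ℂ a)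

/-- The algebra 𝒜ₙ(ℤ_m × ℤ_m, χ) (with `N = n − 1`). -/
abbrev AlgA (m N : ℕ) (q : ℂ) : Type := RingQuot (RelA m N q)

/-- The generator u_i of 𝒜ₙ(ℤ_m × ℤ_m, χ). -/
noncomputable def U (m N : ℕ) (q : ℂ) (i : Fin N) : AlgA m N q :=
  RingQuot.mkAlgHom ℂ (RelA m N q) (FreeAlgebra.ι ℂ (GenA.u i))

/-- The generator v_i of 𝒜ₙ(ℤ_m × ℤ_m, χ). -/
noncomputable def V (m N : ℕ) (q : ℂ) (i : Fin N) : AlgA m N q :=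
  RingQuot.mkAlgHom ℂ (RelA m N q) (FreeAlgebra.ι ℂ (GenA.v i))

theorem span_lemma {A G : Type*} [Ring A] [Algebra ℂ A] (g : G → A) (m : ℕ) (hm : 0 < m)
    (hp : ∀ a, g a ^ m = 1) (hc : ∀ a b, ∃ c : ℂ, g b * g a = c • (g a * g b)) (l : List G) :
    ∃ S : Finset A, S.card ≤ m ^ l.length ∧ 1 ∈ Submodule.span ℂ (S : Set A) ∧
      ∀ b ∈ l, ∀ x ∈ Submodule.span ℂ (S : Set A), g b * x ∈ Submodule.span ℂ (S : Set A) := by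
  classical
  induction l with
  | nil => exact ⟨{1}, by simp, Submodule.subset_span (by simp), by simp⟩
  | cons a l ih =>
    obtain ⟨S, hS, h1, hcl⟩ := ih
    let P := (Finset.range m).image (fun i => g a ^ i)
    have hpow : ∀ i, g a ^ i ∈ P := fun i => by
      refine Finset.mem_image.2 ⟨i % m, Finset.mem_range.2 (Nat.mod_lt _ hm), ?_⟩
      conv_rhs => rw [← Nat.div_add_mod i m, pow_add, pow_mul, hp, one_pow, one_mul]
    let Q := Finset.image₂ (fun x y => x * y) P S
    have hQ : ∀ i, ∀ x ∈ Submodule.span ℂ (S : Set A),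
        g a ^ i * x ∈ Submodule.span ℂ (Q : Set A) := by
      intro i x hx
      induction hx using Submodule.span_induction with
      | mem x hx => exact Submodule.subset_span (Finset.mem_image₂.2 ⟨_, hpow i, _, hx, rfl⟩)
      | zero => simp
      | add x y _ _ hx hy => rw [mul_add]; exact add_mem hx hy
      | smul c x _ hx => rw [mul_smul_comm]; exact Submodule.smul_mem _ _ hx
    refine ⟨Q, ?_, ?_, ?_⟩
    · refine (Finset.card_image₂_le _ _ _).trans ?_
      rw [List.length_cons, pow_succ']
      exact Nat.mul_le_mul (Finset.card_image_le.trans (by simp)) hS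
    · simpa using hQ 0 1 h1
    · intro b hb x hx
      induction hx using Submodule.span_induction with
      | zero => simp
      | add x y _ _ hx hy => rw [mul_add]; exact add_mem hx hy
      | smul c x _ hx => rw [mul_smul_comm]; exact Submodule.smul_mem _ _ hx
      | mem x hx =>
        obtain ⟨p, hp', s, hs, rfl⟩ := Finset.mem_image₂.1 hx
        obtain ⟨i, -, rfl⟩ := Finset.mem_image.1 hp'
        rcases List.mem_cons.1 hb with rfl | hb
        · have := hQ (i+1) s (Submodule.subset_span hs)
          rwa [pow_succ', mul_assoc] at this
        · obtain ⟨c, hc⟩ := hc a b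
          have key : ∀ i, g b * g a ^ i = c ^ i • (g a ^ i * g b) := by
            intro i
            induction i with
            | zero => simp
            | succ i ih =>
              rw [pow_succ, ← mul_assoc, ih, smul_mul_assoc, mul_assoc, hc, mul_smul_comm,
                smul_smul, pow_succ, ← mul_assoc]
          show g b * (g a ^ i * s) ∈ _
          rw [← mul_assoc, key, smul_mul_assoc, mul_assoc]
          exact Submodule.smul_mem _ _ (hQ i _ (hcl b hb s (Submodule.subset_span hs)))

theorem finrank_le_lemma {A G : Type*} [Ring A] [Algebra ℂ A] (g : G → A) (m : ℕ) (hm : 0 < m)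
    (hp : ∀ a, g a ^ m = 1) (hc : ∀ a b, ∃ c : ℂ, g b * g a = c • (g a * g b)) (l : List G)
    (hl : ∀ a, a ∈ l) (hg : Algebra.adjoin ℂ (Set.range g) = ⊤) :
    Module.Finite ℂ A ∧ Module.finrank ℂ A ≤ m ^ l.length := by
  obtain ⟨S, hS, h1, hcl⟩ := span_lemma g m hm hp hc l
  have htop : Submodule.span ℂ (S : Set A) = ⊤ := by
    rw [eq_top_iff]
    rintro y -
    have : ∀ y : A, ∀ x ∈ Submodule.span ℂ (S : Set A), y * x ∈ Submodule.span ℂ (S : Set A) := by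
      intro y
      have hy : y ∈ Algebra.adjoin ℂ (Set.range g) := by rw [hg]; trivial
      induction hy using Algebra.adjoin_induction with
      | mem x hx => obtain ⟨b, rfl⟩ := hx; exact hcl b (hl b)
      | algebraMap r =>
        intro x hx; rw [← Algebra.smul_def]; exact Submodule.smul_mem _ _ hx
      | add x y _ _ hx hy => intro z hz; rw [add_mul]; exact add_mem (hx z hz) (hy z hz)
      | mul x y _ _ hx hy => intro z hz; rw [mul_assoc]; exact hx _ (hy z hz)
    simpa using this y 1 h1
  refine ⟨⟨⟨S, htop⟩⟩, ?_⟩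
  have := finrank_span_finset_le_card (R := ℂ) S
  rw [Set.finrank, htop, finrank_top] at this
  exact this.trans hS

theorem sep_lemma {P : Type*} [Fintype P] (D : Subalgebra ℂ (P → ℂ))
    (hsep : ∀ p p' : P, p ≠ p' → ∃ f ∈ D, f p ≠ f p') : D = ⊤ := by
  classical
  have h1 : ∀ p p' : P, p ≠ p' → ∃ f ∈ D, f p = 1 ∧ f p' = 0 := by
    intro p p' h
    obtain ⟨f, hf, hne⟩ := hsep p p' h
    refine ⟨(f p - f p')⁻¹ • (f - algebraMap ℂ _ (f p')),
      D.smul_mem (D.sub_mem hf (D.algebraMap_mem _)) _, ?_, ?_⟩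
    · simp [inv_mul_cancel₀ (sub_ne_zero.2 hne)]
    · simp
  have h2 : ∀ p : P, Pi.single p (1 : ℂ) ∈ D := by
    intro p
    choose! f hf using fun p' (h : p ≠ p') => h1 p p' h
    have : Pi.single p (1 : ℂ) = ∏ p' ∈ Finset.univ.erase p, f p' := by
      ext x
      rw [Finset.prod_apply]
      by_cases hx : x = p
      · subst hx
        rw [Pi.single_eq_same, Finset.prod_eq_one]
        intro y hy; exact (hf y (Finset.ne_of_mem_erase hy).symm).2.1
      · rw [Pi.single_eq_of_ne hx, Finset.prod_eq_zero (i := x) (by simp [hx])]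
        exact (hf x (Ne.symm hx)).2.2
    rw [this]
    exact D.prod_mem fun y hy => (hf y (Finset.ne_of_mem_erase hy).symm).1
  rw [eq_top_iff]
  rintro f -
  have : f = ∑ p, f p • Pi.single p (1 : ℂ) := by
    ext x
    simp [Finset.sum_apply, Pi.single_apply]
  rw [this]
  exact D.sum_mem fun p _ => D.smul_mem (h2 p) _

theorem center_lemma {A T I : Type*} [Fintype T] [Fintype I] [DecidableEq I] [Nonempty I]
    [Ring A] [Algebra ℂ A] (e : A ≃ₐ[ℂ] (T → Matrix I I ℂ)) :
    Module.finrank ℂ (Subalgebra.center ℂ A) = Fintype.card T := by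
  let F : (T → ℂ) →ₗ[ℂ] A :=
    e.symm.toLinearMap ∘ₗ
      { toFun := fun f t => algebraMap ℂ (Matrix I I ℂ) (f t)
        map_add' := by intro f g; ext t : 1; simp
        map_smul' := by intro c f; ext t : 1; simp [Algebra.algebraMap_eq_smul_one, smul_smul] }
  have hF : ∀ f, F f = e.symm (fun t => algebraMap ℂ (Matrix I I ℂ) (f t)) := fun f => rfl
  have hinj : Function.Injective F := by
    intro f g h
    rw [hF, hF] at h
    have := e.symm.injective h
    ext t
    exact (algebraMap ℂ (Matrix I I ℂ)).injective (congrFun this t)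
  have hr : LinearMap.range F = (Subalgebra.center ℂ A).toSubmodule := by
    ext a
    rw [Subalgebra.mem_toSubmodule, Subalgebra.mem_center_iff, LinearMap.mem_range]
    constructor
    · rintro ⟨f, rfl⟩ b
      apply e.injective
      rw [map_mul, map_mul, hF, e.apply_symm_apply]
      ext t : 1
      exact (Algebra.commutes (f t) (e b t)).symm
    · intro h
      have : ∀ t, e a t ∈ Subalgebra.center ℂ (Matrix I I ℂ) := by
        intro t
        rw [Subalgebra.mem_center_iff]
        intro b
        have := congrArg e (h (e.symm (fun _ => b)))
        rw [map_mul, map_mul, e.apply_symm_apply] at this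
        exact congrFun this t
      simp only [Algebra.IsCentral.center_eq_bot, Algebra.mem_bot, Set.mem_range] at this
      choose f hf using this
      exact ⟨f, by rw [hF, AlgEquiv.symm_apply_eq]; ext t : 1; exact hf t⟩
  have := LinearMap.finrank_range_of_inj hinj
  rw [hr] at this
  simpa using this

section W
variable {T I : Type*} [Fintype I] [AddCommGroup I] [DecidableEq I]

/-- weighted shift -/
def W (d : T × I → ℂ) (a : I) : T → Matrix I I ℂ :=
  fun t => Matrix.of fun x y => if x = y + a then d (t, x) else 0

theorem W_mul (d d' : T × I → ℂ) (a a' : I) :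
    W d a * W d' a' = W (fun p => d p * d' (p.1, p.2 - a)) (a + a') := by
  ext t x y
  simp only [W, Pi.mul_apply, Matrix.mul_apply, Matrix.of_apply]
  rw [Finset.sum_eq_single (x - a)]
  · have : x - a = y + a' ↔ x = y + (a + a') := by
      rw [sub_eq_iff_eq_add, add_assoc, add_comm a a']
    simp [this]
  · intro z _ hz
    rw [if_neg, zero_mul]
    rintro rfl; simp at hz
  · simp

theorem W_one : W (1 : T × I → ℂ) 0 = 1 := by
  ext t x y
  simp [W, Matrix.one_apply]

theorem W_smul (c : ℂ) (d : T × I → ℂ) (a : I) : c • W d a = W (c • d) a := by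
  ext t x y
  simp [W]

/-- diagonal hom -/
def Wdiag : (T × I → ℂ) →ₐ[ℂ] (T → Matrix I I ℂ) :=
  AlgHom.ofLinearMap
    { toFun := fun d => W d 0
      map_add' := by
        intro f g; ext t x y; simp only [W, Matrix.of_apply, Pi.add_apply, Matrix.add_apply]
        split_ifs <;> simp
      map_smul' := by intro c f; exact (W_smul c f 0).symm }
    W_one (by intro f g; simp [W_mul]; rfl)

theorem Wdiag_apply (d : T × I → ℂ) : Wdiag d = W d 0 := rfl

theorem W_surj [Fintype T] (R : Subalgebra ℂ (T → Matrix I I ℂ))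
    (hsep : ∀ p p' : T × I, p ≠ p' → ∃ d, W d 0 ∈ R ∧ d p ≠ d p')
    (hshift : AddSubmonoid.closure {a : I | W (1 : T × I → ℂ) a ∈ R} = ⊤) : R = ⊤ := by
  have hd : ∀ d, W d 0 ∈ R := by
    have := sep_lemma (R.comap Wdiag) (by simpa [Wdiag_apply] using hsep)
    intro d
    have h : d ∈ R.comap Wdiag := by rw [this]; trivial
    exact h
  have ha : ∀ a, W (1 : T × I → ℂ) a ∈ R := by
    intro a
    have h : a ∈ AddSubmonoid.closure {a : I | W (1 : T × I → ℂ) a ∈ R} := by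
      rw [hshift]; trivial
    induction h using AddSubmonoid.closure_induction with
    | mem x hx => exact hx
    | zero => exact hd 1
    | add x y _ _ hx hy =>
      have := R.mul_mem hx hy
      rw [W_mul] at this
      convert this using 2
      ext p; simp
  have hW : ∀ d a, W d a ∈ R := by
    intro d a
    have := R.mul_mem (hd d) (ha a)
    rw [W_mul] at this
    convert this using 2
    · ext p; simp
    · simp
  rw [eq_top_iff]
  rintro b -
  have : b = ∑ a : I, W (fun p : T × I => b p.1 p.2 (p.2 - a)) a := by
    ext t x y
    rw [Finset.sum_apply, Matrix.sum_apply, Finset.sum_eq_single (x - y)]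
    · simp [W]
    · intro a _ ha
      simp only [W, Matrix.of_apply]
      rw [if_neg]
      rintro rfl; simp at ha
    · simp
  rw [this]
  exact R.sum_mem fun a _ => hW _ a

end W

section rep
variable {m : ℕ} [NeZero m] {k : ℕ}

abbrev TT (m : ℕ) := Bool → ZMod m
abbrev II (m k : ℕ) := Bool × Fin k → ZMod m

/-- coordinates -/
def co (p : TT m × II m k) (s : Bool) (j : ℕ) : ZMod m :=
  if h : j < k then p.2 (s, ⟨j, h⟩) else p.1 s

/-- exponents of the diagonal part -/
def LL (s : Bool) (i : ℕ) (p : TT m × II m k) : ZMod m :=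
  if i % 2 = 0 then co p s (i / 2) - (if i = 0 then 0 else co p s (i / 2 - 1)) else 0

/-- shift part -/
def aa (m k : ℕ) (s : Bool) (i : ℕ) : II m k :=
  fun r => if i % 2 = 1 ∧ r.1 = s ∧ (r.2 : ℕ) = i / 2 then 1 else 0

/-- commutation exponent -/
def BB (m : ℕ) (s : Bool) (i : ℕ) (s' : Bool) (i' : ℕ) : ZMod m :=
  if s = s' ∧ i % 2 = 0 then (if i' = i + 1 then 1 else if i' + 1 = i then -1 else 0) else 0

theorem co_shift (p : TT m × II m k) (s s' : Bool) (j i' : ℕ) (hi' : i' < 2 * k + 1) :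
    co (p.1, p.2 - aa m k s' i') s j
      = co p s j - if s = s' ∧ i' = 2 * j + 1 then 1 else 0 := by
  unfold co aa
  by_cases h : j < k
  · simp only [h, dif_pos, Pi.sub_apply]
    congr 1
    refine if_congr ?_ rfl rfl
    constructor
    · rintro ⟨h1, h2, h3⟩; exact ⟨h2, by omega⟩
    · rintro ⟨h1, h2⟩; exact ⟨by omega, h1, by omega⟩
  · simp only [h, dif_neg, not_false_iff]
    rw [if_neg (by omega), sub_zero]

theorem LL_shift (p : TT m × II m k) (s s' : Bool) (i i' : ℕ) (hi' : i' < 2 * k + 1) :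
    LL s i (p.1, p.2 - aa m k s' i') = LL s i p - BB m s i s' i' := by
  unfold LL BB
  by_cases h : i % 2 = 0
  · simp only [h, if_true, co_shift _ _ _ _ _ hi']
    by_cases hs : s = s'
    · simp only [hs, true_and]
      rcases Nat.eq_zero_or_pos i with h0 | h0
      · subst h0; simp
      · have e1 : (i' = 2 * (i / 2) + 1) ↔ i' = i + 1 := by omega
        have e2 : (i' = 2 * (i / 2 - 1) + 1) ↔ i' + 1 = i := by omega
        simp only [e1, e2, h0.ne', if_false]
        by_cases h1 : i' = i + 1
        · have : ¬ (i' + 1 = i) := by omega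
          simp only [if_neg this, if_pos h1, if_true]; ring
        · by_cases h2 : i' + 1 = i
          · simp [h1, h2]; ring
          · simp [h1, h2]
    · simp [hs]
  · simp [h]

variable (χ : AddChar (ZMod m) ℂ)

/-- generator images -/
noncomputable def gg (k : ℕ) (s : Bool) (i : ℕ) : TT m → Matrix (II m k) (II m k) ℂ :=
  W (fun p => χ (LL s i p)) (aa m k s i)

theorem gg_comm (s s' : Bool) (i i' : ℕ) (hi : i < 2 * k + 1) (hi' : i' < 2 * k + 1) :
    gg χ k s i * gg χ k s' i'
      = χ (BB m s i s' i' - BB m s' i' s i) • (gg χ k s' i' * gg χ k s i) := by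
  unfold gg
  rw [W_mul, W_mul, W_smul, add_comm (aa m k s i)]
  congr 1
  ext p
  simp only [LL_shift _ _ _ _ _ hi, LL_shift _ _ _ _ _ hi', Pi.smul_apply, smul_eq_mul,
    ← AddChar.map_add_eq_mul]
  congr 1
  ring

theorem BB_self (s : Bool) (i : ℕ) : BB m s i s i = 0 := by
  unfold BB; split_ifs <;> first | rfl | omega

theorem gg_pow (s : Bool) (i : ℕ) (hi : i < 2 * k + 1) : gg χ k s i ^ m = 1 := by
  have : ∀ r : ℕ, gg χ k s i ^ r = W (fun p => χ (r • LL s i p)) (r • aa m k s i) := by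
    intro r
    induction r with
    | zero =>
      rw [pow_zero, ← W_one]
      congr 1
      · ext p; simp
      · simp
    | succ r ih =>
      rw [pow_succ', ih]
      conv_lhs => unfold gg
      rw [W_mul, succ_nsmul']
      congr 1
      ext p
      rw [LL_shift _ _ _ _ _ hi, BB_self, sub_zero, ← AddChar.map_add_eq_mul, succ_nsmul']
  rw [this, ← W_one]
  congr 1
  · ext p; simp
  · ext p; simp

theorem gg_surj (hχ : ∀ z, χ z = 1 → z = 0)
    (R : Subalgebra ℂ (TT m → Matrix (II m k) (II m k) ℂ))
    (hR : ∀ s i, i < 2 * k + 1 → gg χ k s i ∈ R) : R = ⊤ := by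
  apply W_surj
  · intro p p' hpp
    by_contra! hcon
    apply hpp
    have key : ∀ s j, j ≤ k → LL s (2 * j) p = LL s (2 * j) p' := by
      intro s j hj
      have ha : aa m k s (2 * j) = 0 := by
        ext r; unfold aa; rw [if_neg (by omega)]; rfl
      have := hcon (fun p => χ (LL s (2 * j) p)) (by
        have := hR s (2 * j) (by omega)
        unfold gg at this
        rwa [ha] at this)
      have h2 : χ (LL s (2 * j) p - LL s (2 * j) p') = 1 := by
        rw [sub_eq_add_neg, AddChar.map_add_eq_mul, this, ← AddChar.map_add_eq_mul]
        simp
      exact sub_eq_zero.1 (hχ _ h2)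
    have key2 : ∀ s j, j ≤ k → co p s j = co p' s j := by
      intro s j
      induction j with
      | zero => intro hj; simpa [LL] using key s 0 hj
      | succ j ih =>
        intro hj
        have h := key s (j + 1) hj
        have e : 2 * (j + 1) / 2 = j + 1 := by omega
        simp only [LL, Nat.mul_mod_right, if_true, e, Nat.add_sub_cancel] at h
        rw [if_neg (by omega), if_neg (by omega), ih (by omega)] at h
        exact sub_left_injective h
    refine Prod.ext ?_ ?_
    · ext s; simpa [co] using key2 s k le_rfl
    · ext ⟨s, j⟩
      have := key2 s j j.2.le
      simpa [co] using this
  · rw [eq_top_iff]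
    rintro a -
    rw [← Finset.univ_sum_single a]
    refine AddSubmonoid.sum_mem _ fun r _ => ?_
    have : Pi.single r (a r) = (a r).val • (Pi.single r (1 : ZMod m) : II m k) := by
      rw [← Pi.single_smul]; simp
    rw [this]
    refine AddSubmonoid.nsmul_mem _ (AddSubmonoid.subset_closure ?_) _
    have h := hR r.1 (2 * r.2 + 1) (by omega)
    show W _ _ ∈ R
    unfold gg at h
    convert h using 2
    · ext p
      have : ¬ ((2 * (r.2 : ℕ) + 1) % 2 = 0) := by omega
      simp [LL, this]
    · ext r'
      unfold aa
      rw [Pi.single_apply]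
      refine if_congr ?_ rfl rfl
      constructor
      · rintro rfl; exact ⟨by omega, rfl, by omega⟩
      · rintro ⟨_, h1, h2⟩; exact Prod.ext h1 (Fin.ext (by omega))

end rep

/-- colour of a generator -/
def col {N : ℕ} : GenA N → Bool
  | GenA.u _ => true
  | GenA.v _ => false

theorem idx_lt {N : ℕ} (a : GenA N) : idx a < N := by
  cases a <;> exact Fin.isLt _

/-- image of a generator in the quotient -/
noncomputable def X (m N : ℕ) (q : ℂ) (a : GenA N) : AlgA m N q :=
  RingQuot.mkAlgHom ℂ (RelA m N q) (FreeAlgebra.ι ℂ a)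

theorem X_pow (m N : ℕ) (q : ℂ) (a : GenA N) : X m N q a ^ m = 1 := by
  unfold X
  rw [← map_pow, ← map_one (RingQuot.mkAlgHom ℂ (RelA m N q))]
  cases a with
  | u i => exact RingQuot.mkAlgHom_rel ℂ (RelA.upow i)
  | v i => exact RingQuot.mkAlgHom_rel ℂ (RelA.vpow i)

theorem X_rel (m N : ℕ) (q : ℂ) (a b : GenA N) (c : ℂ)
    (h : RelA m N q (FreeAlgebra.ι ℂ a * FreeAlgebra.ι ℂ b)
      (c • (FreeAlgebra.ι ℂ b * FreeAlgebra.ι ℂ a))) :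
    X m N q a * X m N q b = c • (X m N q b * X m N q a) := by
  unfold X
  rw [← map_mul, ← map_mul, ← map_smul]
  exact RingQuot.mkAlgHom_rel ℂ h

theorem X_comm (m N : ℕ) (q : ℂ) (hq : q ≠ 0) (a b : GenA N) :
    ∃ c : ℂ, X m N q b * X m N q a = c • (X m N q a * X m N q b) := by
  have hone : ∀ a b : GenA N, RelA m N q (FreeAlgebra.ι ℂ a * FreeAlgebra.ι ℂ b)
      (FreeAlgebra.ι ℂ b * FreeAlgebra.ι ℂ a) → X m N q a * X m N q b = X m N q b * X m N q a := by
    intro a b h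
    have := X_rel m N q a b 1 (by rwa [one_smul])
    rwa [one_smul] at this
  have key : ∀ a b : GenA N, idx a ≤ idx b → ∃ c : ℂ, c ≠ 0 ∧
      X m N q a * X m N q b = c • (X m N q b * X m N q a) := by
    intro a b hab
    by_cases hfar : idx a + 2 ≤ idx b
    · exact ⟨1, one_ne_zero, by
        rw [one_smul]
        refine hone a b (RelA.far a b ?_)
        rw [abs_sub_comm, abs_of_nonneg (by omega)]; omega⟩
    · by_cases h1 : idx b = idx a + 1
      · cases a <;> cases b
        · exact ⟨q, hq, X_rel _ _ _ _ _ _ (RelA.uuadj _ _ h1)⟩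
        · exact ⟨1, one_ne_zero, by rw [one_smul]; exact hone _ _ (RelA.uvadj _ _ h1)⟩
        · exact ⟨1, one_ne_zero, by rw [one_smul]; exact hone _ _ (RelA.vuadj _ _ h1)⟩
        · exact ⟨q, hq, X_rel _ _ _ _ _ _ (RelA.vvadj _ _ h1)⟩
      · have h0 : idx a = idx b := by omega
        refine ⟨1, one_ne_zero, ?_⟩
        rw [one_smul]
        cases a <;> cases b <;> obtain rfl := Fin.ext h0
        · rfl
        · exact hone _ _ (RelA.uvsame _)
        · exact (hone _ _ (RelA.uvsame _)).symm
        · rfl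
  rcases le_total (idx b) (idx a) with h | h
  · obtain ⟨c, -, hc⟩ := key b a h
    exact ⟨c, hc⟩
  · obtain ⟨c, hc0, hc⟩ := key a b h
    exact ⟨c⁻¹, by rw [hc, smul_smul, inv_mul_cancel₀ hc0, one_smul]⟩

theorem X_adjoin (m N : ℕ) (q : ℂ) : Algebra.adjoin ℂ (Set.range (X m N q)) = ⊤ := by
  have : Set.range (X m N q) =
      RingQuot.mkAlgHom ℂ (RelA m N q) '' Set.range (FreeAlgebra.ι ℂ) := by
    rw [← Set.range_comp]; rfl
  rw [this, ← AlgHom.map_adjoin, FreeAlgebra.adjoin_range_ι, Algebra.map_top,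
    AlgHom.range_eq_top]
  exact RingQuot.mkAlgHom_surjective ℂ _

theorem A_finrank (m N : ℕ) (hm : 0 < m) (q : ℂ) (hq : q ≠ 0) :
    Module.Finite ℂ (AlgA m N q) ∧ Module.finrank ℂ (AlgA m N q) ≤ m ^ (2 * N) := by
  have := finrank_le_lemma (X m N q) m hm (X_pow m N q) (X_comm m N q hq)
    ((List.finRange N).map GenA.u ++ (List.finRange N).map GenA.v)
    (by intro a; cases a <;> simp) (X_adjoin m N q)
  simpa [two_mul] using this

/-- The representation. -/
theorem exists_rep (m k : ℕ) [NeZero m] (q : ℂ) (χ : AddChar (ZMod m) ℂ) (hχ1 : χ 1 = q) :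
    ∃ φ : AlgA m (2 * k + 1) q →ₐ[ℂ] (TT m → Matrix (II m k) (II m k) ℂ),
      ∀ a, φ (X m (2 * k + 1) q a) = gg χ k (col a) (idx a) := by
  let f := FreeAlgebra.lift ℂ (fun a : GenA (2 * k + 1) => gg χ k (col a) (idx a))
  have hf : ∀ a, f (FreeAlgebra.ι ℂ a) = gg χ k (col a) (idx a) := by
    intro a; simp [f]
  have hrel : ∀ ⦃x y⦄, RelA m (2 * k + 1) q x y → f x = f y := by
    have hcomm : ∀ (a b : GenA (2 * k + 1)) (z : ZMod m),
        BB m (col a) (idx a) (col b) (idx b) - BB m (col b) (idx b) (col a) (idx a) = z →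
        f (FreeAlgebra.ι ℂ a) * f (FreeAlgebra.ι ℂ b)
          = χ z • (f (FreeAlgebra.ι ℂ b) * f (FreeAlgebra.ι ℂ a)) := by
      intro a b z h
      rw [hf, hf, gg_comm χ _ _ _ _ (idx_lt a) (idx_lt b), h]
    have hcomm0 : ∀ (a b : GenA (2 * k + 1)),
        BB m (col a) (idx a) (col b) (idx b) - BB m (col b) (idx b) (col a) (idx a) = 0 →
        f (FreeAlgebra.ι ℂ a) * f (FreeAlgebra.ι ℂ b)
          = f (FreeAlgebra.ι ℂ b) * f (FreeAlgebra.ι ℂ a) := by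
      intro a b h
      rw [hcomm a b 0 h, AddChar.map_zero_eq_one, one_smul]
    have hadj : ∀ (s : Bool) (i j : ℕ), j = i + 1 → BB m s i s j - BB m s j s i = 1 := by
      rintro s i j rfl
      unfold BB
      rcases Nat.mod_two_eq_zero_or_one i with h | h
      · have h' : (i + 1) % 2 = 1 := by omega
        simp [h, h']
      · have h' : (i + 1) % 2 = 0 := by omega
        have h'' : ¬ (i = i + 1 + 1) := by omega
        simp [h, h', h'']
    have hcol : ∀ (s s' : Bool) (i j : ℕ), s ≠ s' → BB m s i s' j - BB m s' j s i = 0 := by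
      intro s s' i j h
      simp [BB, h, h.symm]
    intro x y h
    induction h with
    | upow i => rw [map_pow, hf, map_one]; exact gg_pow χ _ _ (idx_lt _)
    | vpow i => rw [map_pow, hf, map_one]; exact gg_pow χ _ _ (idx_lt _)
    | uvsame i => rw [map_mul, map_mul]; exact hcomm0 _ _ (hcol _ _ _ _ (by simp [col]))
    | uuadj i j hij =>
      rw [map_smul, map_mul, map_mul, ← hχ1]; exact hcomm _ _ 1 (hadj _ _ _ hij)
    | vvadj i j hij =>
      rw [map_smul, map_mul, map_mul, ← hχ1]; exact hcomm _ _ 1 (hadj _ _ _ hij)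
    | uvadj i j hij => rw [map_mul, map_mul]; exact hcomm0 _ _ (hcol _ _ _ _ (by simp [col]))
    | vuadj i j hij => rw [map_mul, map_mul]; exact hcomm0 _ _ (hcol _ _ _ _ (by simp [col]))
    | far a b hab =>
      rw [map_mul, map_mul]
      refine hcomm0 _ _ ?_
      have h1 : ¬ (idx b = idx a + 1) := by intro h; rw [h] at hab; simp at hab
      have h2 : ¬ (idx a = idx b + 1) := by intro h; rw [h] at hab; simp at hab
      simp [BB, h1, h2, Ne.symm h1, Ne.symm h2, eq_comm]
  refine ⟨RingQuot.liftAlgHom ℂ ⟨f, hrel⟩, fun a => ?_⟩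
  unfold X
  rw [RingQuot.liftAlgHom_mkAlgHom_apply]
  exact hf a

theorem exists_equiv (m k : ℕ) [NeZero m] (q : ℂ) (hq : IsPrimitiveRoot q m) (hm : 1 < m) :
    Nonempty (AlgA m (2 * k + 1) q ≃ₐ[ℂ] (TT m → Matrix (II m k) (II m k) ℂ)) := by
  have hχ := AddChar.zmodChar_primitive_of_primitive_root m hq
  set χ := AddChar.zmodChar m ((IsPrimitiveRoot.iff_def q m).mp hq).left with hχdef
  have hχ1 : χ 1 = q := by
    have := AddChar.zmodChar_apply' ((IsPrimitiveRoot.iff_def q m).mp hq).left 1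
    simpa using this
  obtain ⟨φ, hφ⟩ := exists_rep m k q χ hχ1
  have hsurj : φ.range = ⊤ := by
    apply gg_surj χ (fun z h => (AddChar.IsPrimitive.zmod_char_eq_one_iff m hχ z).1 h)
    intro s i hi
    cases s
    · exact ⟨X m _ q (GenA.v ⟨i, hi⟩), hφ _⟩
    · exact ⟨X m _ q (GenA.u ⟨i, hi⟩), hφ _⟩
  rw [AlgHom.range_eq_top] at hsurj
  obtain ⟨hfin, hle⟩ := A_finrank m (2 * k + 1) (by omega) q (hq.ne_zero (by omega))
  have hB : Module.finrank ℂ (TT m → Matrix (II m k) (II m k) ℂ) = m ^ (2 * (2 * k + 1)) := by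
    rw [Module.finrank_pi_fintype]
    simp only [Module.finrank_matrix, Module.finrank_self, Finset.sum_const, Finset.card_univ]
    simp [ZMod.card]
    ring
  have hge := LinearMap.finrank_le_finrank_of_surjective (f := φ.toLinearMap) hsurj
  have heq : Module.finrank ℂ (AlgA m (2 * k + 1) q)
      = Module.finrank ℂ (TT m → Matrix (II m k) (II m k) ℂ) := by omega
  have hinj := (LinearMap.injective_iff_surjective_of_finrank_eq_finrank (f := φ.toLinearMap)
    heq).2 hsurj
  exact ⟨AlgEquiv.ofBijective φ ⟨hinj, hsurj⟩⟩

theorem statement12 (m : ℕ) (hm : 3 ≤ m) (hodd : Odd m) (q : ℂ)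
    (hq : IsPrimitiveRoot q m) (n : ℕ) (hn : Even n) (hn2 : 2 ≤ n) :
    Module.finrank ℂ (Subalgebra.center ℂ (AlgA m (n - 1) q)) = m ^ 2 ∧
    Nonempty (AlgA m (n - 1) q ≃ₐ[ℂ]
      (Fin (m ^ 2) → Matrix (Fin (m ^ (n - 2))) (Fin (m ^ (n - 2))) ℂ)) := by
  have : NeZero m := ⟨by omega⟩
  obtain ⟨k, hk⟩ := hn
  have hn1 : n - 1 = 2 * (k - 1) + 1 := by omega
  have hn2' : n - 2 = 2 * (k - 1) := by omega
  rw [hn1, hn2']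
  generalize k - 1 = l
  obtain ⟨e⟩ := exists_equiv m l q hq (by omega)
  have hT : Fintype.card (TT m) = m ^ 2 := by simp [ZMod.card]
  have hI : Fintype.card (II m l) = m ^ (2 * l) := by simp [ZMod.card]
  refine ⟨(center_lemma e).trans hT, ⟨?_⟩⟩
  let eT := Fintype.equivFinOfCardEq hT
  let eI := Fintype.equivFinOfCardEq hI
  exact (e.trans (AlgEquiv.piCongrRight fun _ => Matrix.reindexAlgEquiv ℂ ℂ eI)).trans
    (AlgEquiv.piCongrLeft ℂ (fun _ => Matrix (Fin (m ^ (2 * l))) (Fin (m ^ (2 * l))) ℂ) eT)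

end Stmt12
end

section
/- There is a unique ℂ-algebra automorphism ι of 𝒜ₙ(ℤ_m × ℤ_m, χ) with ι(u_i) = u_i^{m−1} and ι(v_i) = v_i^{m−1} for all i; it satisfies ι² = id, and its fixed-point subalgebra 𝒞ₙ = {a : ι(a) = a} has ℂ-dimension (m^{2(n−1)} + 1)/2. -/
/-!
STATEMENT 13: There is a unique ℂ-algebra automorphism ι of 𝒜ₙ(ℤ_m × ℤ_m, χ)
with ι(u_i) = u_i^{m−1} and ι(v_i) = v_i^{m−1}; it satisfies ι² = id, and its
fixed-point subalgebra 𝒞ₙ has ℂ-dimension (m^{2(n−1)} + 1)/2 (stated here as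
2·dim 𝒞ₙ = m^{2(n−1)} + 1).
-/

namespace Stmt13

/-- Generators u_i, v_i (i = 1,…,n−1, indexed by `Fin N` with `N = n−1`)
of 𝒜ₙ(ℤ_m × ℤ_m, χ). -/
inductive GenA (N : ℕ) : Type
  | u (i : Fin N) : GenA N
  | v (i : Fin N) : GenA N

/-- The underlying index of a generator. -/
def idx {N : ℕ} : GenA N → ℕ
  | GenA.u i => (i : ℕ)
  | GenA.v i => (i : ℕ)

open GenA in
/-- The defining relations of 𝒜ₙ(ℤ_m × ℤ_m, χ): u_i^m = v_i^m = 1,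
u_iv_i = v_iu_i, u_iu_{i+1} = q u_{i+1}u_i, v_iv_{i+1} = q v_{i+1}v_i, and all
other pairs of generators commute. -/
inductive RelA (m N : ℕ) (q : ℂ) :
    FreeAlgebra ℂ (GenA N) → FreeAlgebra ℂ (GenA N) → Prop
  | upow (i : Fin N) : RelA m N q (FreeAlgebra.ι ℂ (u i) ^ m) 1
  | vpow (i : Fin N) : RelA m N q (FreeAlgebra.ι ℂ (v i) ^ m) 1
  | uvsame (i : Fin N) :
      RelA m N q (FreeAlgebra.ι ℂ (u i) * FreeAlgebra.ι ℂ (v i))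
        (FreeAlgebra.ι ℂ (v i) * FreeAlgebra.ι ℂ (u i))
  | uuadj (i j : Fin N) (hij : (j : ℕ) = (i : ℕ) + 1) :
      RelA m N q (FreeAlgebra.ι ℂ (u i) * FreeAlgebra.ι ℂ (u j))
        (q • (FreeAlgebra.ι ℂ (u j) * FreeAlgebra.ι ℂ (u i)))
  | vvadj (i j : Fin N) (hij : (j : ℕ) = (i : ℕ) + 1) :
      RelA m N q (FreeAlgebra.ι ℂ (v i) * FreeAlgebra.ι ℂ (v j))
        (q • (FreeAlgebra.ι ℂ (v j) * FreeAlgebra.ι ℂ (v i)))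
  | uvadj (i j : Fin N) (hij : (j : ℕ) = (i : ℕ) + 1) :
      RelA m N q (FreeAlgebra.ι ℂ (u i) * FreeAlgebra.ι ℂ (v j))
        (FreeAlgebra.ι ℂ (v j) * FreeAlgebra.ι ℂ (u i))
  | vuadj (i j : Fin N) (hij : (j : ℕ) = (i : ℕ) + 1) :
      RelA m N q (FreeAlgebra.ι ℂ (v i) * FreeAlgebra.ι ℂ (u j))
        (FreeAlgebra.ι ℂ (u j) * FreeAlgebra.ι ℂ (v i))
  | far (a b : GenA N) (hab : 2 ≤ |(idx a : ℤ) - (idx b : ℤ)|) :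
      RelA m N q (FreeAlgebra.ι ℂ a * FreeAlgebra.ι ℂ b)
        (FreeAlgebra.ι ℂ b * FreeAlgebra.ι ℂ a)

/-- The algebra 𝒜ₙ(ℤ_m × ℤ_m, χ) (with `N = n − 1`). -/
abbrev AlgA (m N : ℕ) (q : ℂ) : Type := RingQuot (RelA m N q)

/-- The generator u_i of 𝒜ₙ(ℤ_m × ℤ_m, χ). -/
noncomputable def U (m N : ℕ) (q : ℂ) (i : Fin N) : AlgA m N q :=
  RingQuot.mkAlgHom ℂ (RelA m N q) (FreeAlgebra.ι ℂ (GenA.u i))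

/-- The generator v_i of 𝒜ₙ(ℤ_m × ℤ_m, χ). -/
noncomputable def V (m N : ℕ) (q : ℂ) (i : Fin N) : AlgA m N q :=
  RingQuot.mkAlgHom ℂ (RelA m N q) (FreeAlgebra.ι ℂ (GenA.v i))


def genEquiv (N : ℕ) : Fin N ⊕ Fin N ≃ GenA N where
  toFun := fun x => Sum.casesOn x GenA.u GenA.v
  invFun := fun x => GenA.casesOn x Sum.inl Sum.inr
  left_inv := by rintro (i | i) <;> rfl
  right_inv := by rintro (i | i) <;> rfl

instance (N : ℕ) : Fintype (GenA N) := Fintype.ofEquiv _ (genEquiv N)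
instance (N : ℕ) : DecidableEq (GenA N) := (genEquiv N).symm.decidableEq

theorem card_gen (N : ℕ) : Fintype.card (GenA N) = 2 * N := by
  rw [← Fintype.card_congr (genEquiv N)]; simp; ring

/-- exponent matrix -/
def cc (m N : ℕ) : Matrix (GenA N) (GenA N) (ZMod m)
  | GenA.u i, GenA.u j => if (j : ℕ) = i + 1 then 1 else if (i : ℕ) = j + 1 then -1 else 0
  | GenA.v i, GenA.v j => if (j : ℕ) = i + 1 then 1 else if (i : ℕ) = j + 1 then -1 else 0
  | GenA.u _, GenA.v _ => 0
  | GenA.v _, GenA.u _ => 0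

theorem cc_anti (m N : ℕ) (a b : GenA N) : cc m N a b = - cc m N b a := by
  rcases a with i | i <;> rcases b with j | j <;> simp only [cc, neg_zero]
  all_goals
    split_ifs <;> first | omega | simp

/-- image of a generator -/
noncomputable def g (m N : ℕ) (q : ℂ) (a : GenA N) : AlgA m N q :=
  RingQuot.mkAlgHom ℂ (RelA m N q) (FreeAlgebra.ι ℂ a)

section
set_option linter.unusedSectionVars false
variable {m N : ℕ} [NeZero m] {q : ℂ} (hq : q ^ m = 1)

theorem g_pow (a : GenA N) : g m N q a ^ m = 1 := by
  rcases a with i | i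
  · have := RingQuot.mkAlgHom_rel ℂ (RelA.upow (m := m) (q := q) i)
    simpa [g] using this
  · have := RingQuot.mkAlgHom_rel ℂ (RelA.vpow (m := m) (q := q) i)
    simpa [g] using this

/-- the additive character -/
noncomputable abbrev psi (hq : q ^ m = 1) : AddChar (ZMod m) ℂ := AddChar.zmodChar m hq

theorem psi_one : psi hq 1 = q := by
  have := AddChar.zmodChar_apply' hq 1
  simpa using this

theorem psi_ne (k : ZMod m) : psi hq k ≠ 0 := by
  intro h0
  have h2 : psi hq k * psi hq (-k) = 1 := by
    rw [← AddChar.map_add_eq_mul]; simp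
  rw [h0] at h2
  simp at h2

theorem far_rel (a b : GenA N) (h : 2 ≤ |(idx a : ℤ) - (idx b : ℤ)|) :
    g m N q a * g m N q b = g m N q b * g m N q a := by
  have := RingQuot.mkAlgHom_rel ℂ (RelA.far (m := m) (q := q) a b h)
  simpa [g] using this

include hq in
theorem flip_rel {B : Type*} [Ring B] [Algebra ℂ B] (x y : B) (h : x * y = q • (y * x)) :
    y * x = psi hq (-1) • (x * y) := by
  rw [h, smul_smul]
  have : psi hq (-1) * q = 1 := by
    have h2 : psi hq (-1) * psi hq 1 = 1 := by
      rw [← AddChar.map_add_eq_mul]; simp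
    rwa [psi_one hq] at h2
  rw [this, one_smul]

theorem g_comm (a b : GenA N) :
    g m N q a * g m N q b = psi hq (cc m N a b) • (g m N q b * g m N q a) := by
  have huu : ∀ i j : Fin N, (j : ℕ) = i + 1 → g m N q (.u i) * g m N q (.u j) =
      q • (g m N q (.u j) * g m N q (.u i)) := fun i j h => by
    have := RingQuot.mkAlgHom_rel ℂ (RelA.uuadj (m := m) (q := q) i j h)
    simpa [g] using this
  have hvv : ∀ i j : Fin N, (j : ℕ) = i + 1 → g m N q (.v i) * g m N q (.v j) =
      q • (g m N q (.v j) * g m N q (.v i)) := fun i j h => by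
    have := RingQuot.mkAlgHom_rel ℂ (RelA.vvadj (m := m) (q := q) i j h)
    simpa [g] using this
  have huv : ∀ i j : Fin N, g m N q (.u i) * g m N q (.v j) =
      g m N q (.v j) * g m N q (.u i) := fun i j => by
    by_cases h1 : (j : ℕ) = i
    · have : j = i := Fin.ext h1
      subst this
      have := RingQuot.mkAlgHom_rel ℂ (RelA.uvsame (m := m) (q := q) j)
      simpa [g] using this
    by_cases h2 : (j : ℕ) = i + 1
    · have := RingQuot.mkAlgHom_rel ℂ (RelA.uvadj (m := m) (q := q) i j h2)
      simpa [g] using this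
    by_cases h3 : (i : ℕ) = j + 1
    · have := RingQuot.mkAlgHom_rel ℂ (RelA.vuadj (m := m) (q := q) j i h3)
      simpa [g] using this.symm
    · apply far_rel
      simp only [idx]
      rw [le_abs]; omega
  rcases a with i | i <;> rcases b with j | j <;> simp only [cc]
  · split_ifs with h1 h2
    · rw [psi_one]; exact huu i j h1
    · exact flip_rel hq _ _ (huu j i h2)
    · simp only [AddChar.map_zero_eq_one, one_smul]
      by_cases h3 : i = j
      · rw [h3]
      have : (i : ℕ) ≠ j := fun h => h3 (Fin.ext h)
      apply far_rel
      simp only [idx]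
      rw [le_abs]; omega
  · simp only [AddChar.map_zero_eq_one, one_smul]; exact huv i j
  · simp only [AddChar.map_zero_eq_one, one_smul]; exact (huv j i).symm
  · split_ifs with h1 h2
    · rw [psi_one]; exact hvv i j h1
    · exact flip_rel hq _ _ (hvv j i h2)
    · simp only [AddChar.map_zero_eq_one, one_smul]
      by_cases h3 : i = j
      · rw [h3]
      have : (i : ℕ) ≠ j := fun h => h3 (Fin.ext h)
      apply far_rel
      simp only [idx]
      rw [le_abs]; omega

theorem lift_exists {B : Type*} [Ring B] [Algebra ℂ B] (f : GenA N → B)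
    (hp : ∀ a, f a ^ m = 1)
    (hc : ∀ a b, f a * f b = psi hq (cc m N a b) • (f b * f a)) :
    ∃ F : AlgA m N q →ₐ[ℂ] B, ∀ a, F (g m N q a) = f a := by
  refine ⟨RingQuot.liftAlgHom ℂ ⟨FreeAlgebra.lift ℂ f, ?_⟩, fun a => ?_⟩
  · intro x y h
    cases h with
    | upow i => simpa using hp _
    | vpow i => simpa using hp _
    | uvsame i => simpa [cc] using hc (.u i) (.v i)
    | uuadj i j h => have := hc (.u i) (.u j); simp only [cc, h, if_true, psi_one] at this; simpa using this
    | vvadj i j h => have := hc (.v i) (.v j); simp only [cc, h, if_true, psi_one] at this; simpa using this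
    | uvadj i j h => simpa [cc] using hc (.u i) (.v j)
    | vuadj i j h => simpa [cc] using hc (.v i) (.u j)
    | far a b h =>
      have h0 : cc m N a b = 0 := by
        rw [le_abs] at h
        rcases a with i | i <;> rcases b with j | j <;> simp only [cc, idx] at h ⊢
        all_goals rw [if_neg (by omega), if_neg (by omega)]
      have := hc a b
      rw [h0] at this
      simpa using this
  · simp [g]

theorem hom_ext {B : Type*} [Ring B] [Algebra ℂ B] (F F' : AlgA m N q →ₐ[ℂ] B)
    (h : ∀ a, F (g m N q a) = F' (g m N q a)) : F = F' := by
  apply RingQuot.ringQuot_ext'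
  apply FreeAlgebra.hom_ext
  funext a
  exact h a

/-- ordered monomials -/
noncomputable def mon (m : ℕ) (q : ℂ) (L : List (GenA N)) (x : GenA N → ℕ) : AlgA m N q :=
  (L.map (fun a => g m N q a ^ x a)).prod

include hq in
theorem g_comm_pow (a b : GenA N) (k : ℕ) :
    ∃ c : ℂ, g m N q b * g m N q a ^ k = c • (g m N q a ^ k * g m N q b) := by
  induction k with
  | zero => exact ⟨1, by simp⟩
  | succ k ih =>
    obtain ⟨c, hc⟩ := ih
    refine ⟨c * psi hq (cc m N b a), ?_⟩
    rw [pow_succ, ← mul_assoc, hc, smul_mul_assoc, mul_assoc, g_comm hq b a,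
      mul_smul_comm, smul_smul, mul_assoc]

include hq in
theorem g_mul_mon (L : List (GenA N)) (hL : L.Nodup) (b : GenA N) (hb : b ∈ L)
    (x : GenA N → ℕ) :
    ∃ c : ℂ, g m N q b * mon m q L x = c • mon m q L (Function.update x b (x b + 1)) := by
  induction L with
  | nil => simp at hb
  | cons a L ih =>
    rw [List.nodup_cons] at hL
    by_cases hab : b = a
    · subst hab
      refine ⟨1, ?_⟩
      simp only [mon, List.map_cons, List.prod_cons, Function.update_self, one_smul]
      rw [← mul_assoc, ← pow_succ']
      congr 2
      apply List.map_congr_left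
      intro a ha
      rw [Function.update_of_ne]
      rintro rfl; exact hL.1 ha
    · have hb' : b ∈ L := by simpa [hab] using hb
      obtain ⟨c, hc⟩ := ih hL.2 hb'
      obtain ⟨d, hd⟩ := g_comm_pow (m := m) hq a b (x a)
      refine ⟨d * c, ?_⟩
      simp only [mon, List.map_cons, List.prod_cons] at hc ⊢
      rw [Function.update_of_ne (Ne.symm hab), ← mul_assoc, hd, smul_mul_assoc, mul_assoc, hc,
        mul_smul_comm, smul_smul]

theorem mon_mod (L : List (GenA N)) (x : GenA N → ℕ) :
    mon m q L x = mon m q L (fun a => ((x a : ZMod m)).val) := by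
  unfold mon
  congr 2
  funext a
  beta_reduce
  rw [ZMod.val_natCast]
  exact pow_eq_pow_mod _ (g_pow a)

include hq in
theorem span_top :
    Submodule.span ℂ (Set.range (fun x : GenA N → ZMod m =>
      mon m q Finset.univ.toList (fun a => (x a).val))) = ⊤ := by
  set S := Submodule.span ℂ (Set.range (fun x : GenA N → ZMod m =>
      mon m q Finset.univ.toList (fun a => (x a).val))) with hS
  have hmem : ∀ x : GenA N → ℕ, mon m q Finset.univ.toList x ∈ S := fun x => by
    rw [mon_mod]
    exact Submodule.subset_span ⟨fun a => (x a : ZMod m), rfl⟩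
  have key : ∀ a : FreeAlgebra ℂ (GenA N), ∀ s ∈ S,
      RingQuot.mkAlgHom ℂ (RelA m N q) a * s ∈ S := by
    intro a
    induction a using FreeAlgebra.induction with
    | grade0 r =>
      intro s hs
      rw [AlgHom.commutes, ← Algebra.smul_def]
      exact S.smul_mem _ hs
    | grade1 b =>
      intro s hs
      induction hs using Submodule.span_induction with
      | mem s h =>
        obtain ⟨x, rfl⟩ := h
        obtain ⟨c, hc⟩ := g_mul_mon (m := m) hq Finset.univ.toList (Finset.nodup_toList _) b
          (by simp) (fun a => (x a).val)
        change g m N q b * _ ∈ S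
        rw [hc]
        exact S.smul_mem _ (hmem _)
      | zero => simp
      | add x y _ _ hx hy => rw [mul_add]; exact S.add_mem hx hy
      | smul c x _ hx => rw [mul_smul_comm]; exact S.smul_mem _ hx
    | mul a b ha hb =>
      intro s hs
      rw [map_mul, mul_assoc]
      exact ha _ (hb _ hs)
    | add a b ha hb =>
      intro s hs
      rw [map_add, add_mul]
      exact S.add_mem (ha _ hs) (hb _ hs)
  rw [eq_top_iff]
  intro a _
  obtain ⟨a, rfl⟩ := RingQuot.mkAlgHom_surjective ℂ (RelA m N q) a
  have h1 : (1 : AlgA m N q) ∈ S := by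
    have := hmem 0
    simpa [mon] using this
  simpa using key a 1 h1

/-- the form -/
noncomputable def om (m : ℕ) (x y : GenA N → ZMod m) : ZMod m :=
  (((m + 1) / 2 : ℕ) : ZMod m) * (x ⬝ᵥ (cc m N).mulVec y)

theorem om_add_left (x y z : GenA N → ZMod m) : om m (x + y) z = om m x z + om m y z := by
  simp [om, add_dotProduct, mul_add]

theorem om_sub_right (x y z : GenA N → ZMod m) : om m x (y - z) = om m x y - om m x z := by
  simp [om, Matrix.mulVec_sub, dotProduct_sub, mul_sub]

theorem om_neg_left (x y : GenA N → ZMod m) : om m (-x) y = - om m x y := by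
  simp [om]

theorem om_neg_right (x y : GenA N → ZMod m) : om m x (-y) = - om m x y := by
  simp [om, Matrix.mulVec_neg]

theorem om_smul_left (k : ZMod m) (x y : GenA N → ZMod m) : om m (k • x) y = k * om m x y := by
  simp [om]; ring

theorem om_anti (x y : GenA N → ZMod m) : om m x y = - om m y x := by
  have : (cc m N) = - (cc m N).transpose := by
    ext a b; simpa using cc_anti m N a b
  unfold om
  rw [Matrix.dotProduct_mulVec, dotProduct_comm]
  conv_lhs => rw [this]
  rw [Matrix.vecMul_neg, Matrix.vecMul_transpose]
  simp

theorem two_half (hodd : Odd m) : (2 : ZMod m) * (((m + 1) / 2 : ℕ) : ZMod m) = 1 := by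
  have h : 2 * ((m + 1) / 2) = m + 1 := by
    obtain ⟨k, rfl⟩ := hodd; omega
  have := congrArg (Nat.cast : ℕ → ZMod m) h
  push_cast at this
  simpa using this

theorem eq_zero_of_neg (hodd : Odd m) (x : ZMod m) (h : x = -x) : x = 0 := by
  have h2 : 2 * x = 0 := by linear_combination h
  calc x = (2 * (((m + 1) / 2 : ℕ) : ZMod m)) * x := by rw [two_half hodd, one_mul]
    _ = (((m + 1) / 2 : ℕ) : ZMod m) * (2 * x) := by ring
    _ = 0 := by rw [h2, mul_zero]

theorem om_self (hodd : Odd m) (x : GenA N → ZMod m) : om m x x = 0 :=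
  eq_zero_of_neg hodd _ (om_anti x x)

theorem om_single (hodd : Odd m) (a b : GenA N) :
    2 * om m (Pi.single a 1) (Pi.single b 1) = cc m N a b := by
  unfold om
  rw [← mul_assoc, two_half hodd]
  simp

/-- Weyl operators -/
noncomputable def Op (hq : q ^ m = 1) (x : GenA N → ZMod m) :
    Module.End ℂ ((GenA N → ZMod m) → ℂ) where
  toFun f := fun y => psi hq (om m x y) * f (y - x)
  map_add' f f' := by funext y; simp [mul_add]
  map_smul' c f := by funext y; simp; ring

theorem Op_mul (x y : GenA N → ZMod m) :
    Op hq x * Op hq y = psi hq (om m x y) • Op hq (x + y) := by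
  refine LinearMap.ext fun f => ?_
  funext z
  simp only [Op, Module.End.mul_apply, LinearMap.coe_mk, AddHom.coe_mk, LinearMap.smul_apply,
    Pi.smul_apply, smul_eq_mul]
  rw [← mul_assoc, ← mul_assoc, ← AddChar.map_add_eq_mul, ← AddChar.map_add_eq_mul,
    om_sub_right, om_add_left, om_anti y x, sub_sub]
  congr 2
  ring

theorem Op_zero : Op hq (0 : GenA N → ZMod m) = 1 := by
  refine LinearMap.ext fun f => ?_
  funext z
  simp [Op, om]

theorem Op_pow (hodd : Odd m) (x : GenA N → ZMod m) (k : ℕ) :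
    Op hq x ^ k = Op hq ((k : ZMod m) • x) := by
  induction k with
  | zero => simp [Op_zero]
  | succ k ih =>
    rw [pow_succ, ih, Op_mul, om_smul_left, om_self hodd, mul_zero, AddChar.map_zero_eq_one,
      one_smul, Nat.cast_succ, add_smul, one_smul]

theorem Op_comm (x y : GenA N → ZMod m) :
    Op hq x * Op hq y = psi hq (2 * om m x y) • (Op hq y * Op hq x) := by
  rw [Op_mul, Op_mul, smul_smul, ← AddChar.map_add_eq_mul, om_anti y x, add_comm y x]
  congr 2
  ring

theorem Op_pow_m (hodd : Odd m) (x : GenA N → ZMod m) : Op hq x ^ m = 1 := by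
  rw [Op_pow hq hodd]; simp [Op_zero]

theorem Op_pow_pred (hodd : Odd m) (x : GenA N → ZMod m) :
    Op hq x ^ (m - 1) = Op hq (-x) := by
  rw [Op_pow hq hodd, Nat.cast_sub (NeZero.one_le)]; simp

/-- reflection -/
noncomputable def Rf (m N : ℕ) : Module.End ℂ ((GenA N → ZMod m) → ℂ) where
  toFun f := fun y => f (-y)
  map_add' f f' := rfl
  map_smul' c f := rfl

theorem Rf_Rf : Rf m N * Rf m N = 1 := by
  refine LinearMap.ext fun f => ?_; funext y; simp [Rf]

theorem Rf_Op (x : GenA N → ZMod m) : Rf m N * Op hq x * Rf m N = Op hq (-x) := by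
  refine LinearMap.ext fun f => ?_; funext y
  simp only [Op, Rf, Module.End.mul_apply, LinearMap.coe_mk, AddHom.coe_mk]
  rw [om_neg_left, om_neg_right]
  congr 2
  abel

theorem rho_exists (hodd : Odd m) : ∃ F : AlgA m N q →ₐ[ℂ] Module.End ℂ ((GenA N → ZMod m) → ℂ),
    ∀ a, F (g m N q a) = Op hq (Pi.single a 1) := by
  apply lift_exists hq
  · intro a; exact Op_pow_m hq hodd _
  · intro a b; rw [Op_comm, om_single hodd]

/-- delta at zero -/
noncomputable def dl (m N : ℕ) : (GenA N → ZMod m) → ℂ := Pi.single 0 1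

theorem Op_dl (x : GenA N → ZMod m) (hodd : Odd m) : Op hq x (dl m N) = Pi.single x 1 := by
  funext y
  simp only [Op, dl, LinearMap.coe_mk, AddHom.coe_mk, Pi.single_apply, sub_eq_zero]
  split_ifs with h
  · subst h; simp [om_self hodd]
  · simp

theorem ev_mon (hodd : Odd m) (F : AlgA m N q →ₐ[ℂ] Module.End ℂ ((GenA N → ZMod m) → ℂ))
    (hF : ∀ a, F (g m N q a) = Op hq (Pi.single a 1)) (L : List (GenA N)) (x : GenA N → ℕ) :
    ∃ c : ℂ, c ≠ 0 ∧ F (mon m q L x) =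
      c • Op hq ((L.map (fun a => ((x a : ZMod m) • (Pi.single a 1 : GenA N → ZMod m)))).sum) := by
  induction L with
  | nil => exact ⟨1, one_ne_zero, by simp [mon, Op_zero]⟩
  | cons a L ih =>
    obtain ⟨c, hc0, hc⟩ := ih
    simp only [mon, List.map_cons, List.prod_cons, List.sum_cons, map_mul, map_pow] at hc ⊢
    rw [hc, hF, Op_pow hq hodd, mul_smul_comm, Op_mul, smul_smul]
    refine ⟨_, ?_, rfl⟩
    exact mul_ne_zero hc0 (psi_ne hq _)

theorem ev_bij (hodd : Odd m) (F : AlgA m N q →ₐ[ℂ] Module.End ℂ ((GenA N → ZMod m) → ℂ))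
    (hF : ∀ a, F (g m N q a) = Op hq (Pi.single a 1)) :
    Function.Bijective ((LinearMap.applyₗ (dl m N)) ∘ₗ F.toLinearMap :
      AlgA m N q →ₗ[ℂ] ((GenA N → ZMod m) → ℂ)) := by
  set ev := ((LinearMap.applyₗ (dl m N)) ∘ₗ F.toLinearMap :
      AlgA m N q →ₗ[ℂ] ((GenA N → ZMod m) → ℂ)) with hev
  have hs : Function.Surjective ev := by
    rw [← LinearMap.range_eq_top, eq_top_iff, ← (Pi.basisFun ℂ (GenA N → ZMod m)).span_eq,
      Submodule.span_le]
    rintro _ ⟨x, rfl⟩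
    obtain ⟨c, hc0, hc⟩ := ev_mon hq hodd F hF Finset.univ.toList (fun a => (x a).val)
    refine ⟨c⁻¹ • mon m q Finset.univ.toList (fun a => (x a).val), ?_⟩
    rw [map_smul]
    change c⁻¹ • (F _ (dl m N)) = _
    rw [hc, LinearMap.smul_apply, smul_smul, inv_mul_cancel₀ hc0, one_smul, Op_dl hq _ hodd,
      Pi.basisFun_apply]
    congr 1
    rw [Finset.sum_map_toList]
    funext b
    simp [Finset.sum_apply, Pi.single_apply]
  have hst := span_top (m := m) (N := N) hq
  have hfin : Module.Finite ℂ (AlgA m N q) :=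
    ⟨⟨(Set.finite_range _).toFinset, by rw [Set.Finite.coe_toFinset]; exact hst⟩⟩
  have hle : Module.finrank ℂ (AlgA m N q) ≤ Fintype.card (GenA N → ZMod m) := by
    rw [← finrank_top, ← hst]
    exact finrank_range_le_card _
  have hge := LinearMap.finrank_le_finrank_of_surjective hs
  rw [Module.finrank_fintype_fun_eq_card] at hge
  refine ⟨?_, hs⟩
  rw [LinearMap.injective_iff_surjective_of_finrank_eq_finrank]
  · exact hs
  · rw [Module.finrank_fintype_fun_eq_card]; exact le_antisymm hle hge

theorem rf_conj (hodd : Odd m) (F : AlgA m N q →ₐ[ℂ] Module.End ℂ ((GenA N → ZMod m) → ℂ))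
    (hF : ∀ a, F (g m N q a) = Op hq (Pi.single a 1)) (φ : AlgA m N q →ₐ[ℂ] AlgA m N q)
    (hφ : ∀ a, φ (g m N q a) = g m N q a ^ (m - 1)) (a : AlgA m N q) :
    F (φ a) = Rf m N * F a * Rf m N := by
  obtain ⟨a, rfl⟩ := RingQuot.mkAlgHom_surjective ℂ (RelA m N q) a
  induction a using FreeAlgebra.induction with
  | grade0 r =>
    simp only [AlgHom.commutes]
    rw [← Algebra.commutes, mul_assoc, Rf_Rf, mul_one]
  | grade1 b =>
    change F (φ (g m N q b)) = Rf m N * F (g m N q b) * Rf m N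
    rw [hφ, map_pow, hF, Rf_Op, Op_pow_pred hq hodd]
  | mul a b ha hb =>
    simp only [map_mul, ha, hb]
    calc _ = Rf m N * F (RingQuot.mkAlgHom ℂ (RelA m N q) a) * (Rf m N * Rf m N) *
        F (RingQuot.mkAlgHom ℂ (RelA m N q) b) * Rf m N := by simp only [mul_assoc]
      _ = _ := by rw [Rf_Rf, mul_one]; simp only [mul_assoc]
  | add a b ha hb => simp only [map_add, ha, hb, mul_add, add_mul]

theorem Rf_dl : Rf m N (dl m N) = dl m N := by
  funext y
  simp [Rf, dl, Pi.single_apply]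

theorem fixed_dim (hodd : Odd m) :
    2 * Module.finrank ℂ (LinearMap.ker (Rf m N - 1)) = m ^ (2 * N) + 1 := by
  set P : Module.End ℂ ((GenA N → ZMod m) → ℂ) := (2⁻¹ : ℂ) • (1 + Rf m N) with hP
  have hproj : LinearMap.IsProj (LinearMap.ker (Rf m N - 1)) P := by
    constructor
    · intro f
      rw [LinearMap.mem_ker, ← Module.End.mul_apply, hP, mul_smul_comm, sub_mul, mul_add, mul_add,
        Rf_Rf]
      simp [add_comm]
    · intro f hf
      rw [LinearMap.mem_ker, LinearMap.sub_apply, sub_eq_zero] at hf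
      rw [hP, LinearMap.smul_apply, LinearMap.add_apply, hf]
      funext y
      simp
      ring
  have ht := hproj.trace
  rw [hP, map_smul, map_add, LinearMap.trace_one, Module.finrank_fintype_fun_eq_card] at ht
  have hR : LinearMap.trace ℂ _ (Rf m N) = 1 := by
    rw [LinearMap.trace_eq_matrix_trace ℂ (Pi.basisFun ℂ (GenA N → ZMod m)), Matrix.trace]
    rw [Finset.sum_eq_single 0]
    · simp [LinearMap.toMatrix_apply, Rf]
    · intro x _ hx
      have : -x ≠ x := fun h => hx (by
        funext a
        exact eq_zero_of_neg hodd _ (congrFun h a).symm)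
      simp [LinearMap.toMatrix_apply, Rf, Pi.single_apply, this]
    · simp
  rw [hR, Fintype.card_fun, ZMod.card, card_gen, smul_eq_mul] at ht
  have : (2 : ℂ) * (Module.finrank ℂ (LinearMap.ker (Rf m N - 1)) : ℂ) = m ^ (2 * N) + 1 := by
    rw [← ht]; push_cast; ring
  exact_mod_cast this

include hq in
theorem exists_inv (hodd : Odd m) :
    ∃ φ : AlgA m N q →ₐ[ℂ] AlgA m N q, ∀ a, φ (g m N q a) = g m N q a ^ (m - 1) := by
  obtain ⟨F, hF⟩ := rho_exists (N := N) hq hodd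
  have hbij := ev_bij hq hodd F hF
  have hinj : Function.Injective F := fun a b h => hbij.1 (by
    change F a (dl m N) = F b (dl m N)
    rw [h])
  apply lift_exists hq
  · intro a
    rw [← pow_mul, mul_comm, pow_mul, g_pow, one_pow]
  · intro a b
    apply hinj
    rw [map_smul, map_mul, map_mul, map_pow, map_pow, hF, hF, Op_pow_pred hq hodd,
      Op_pow_pred hq hodd, Op_comm, om_neg_left, om_neg_right, neg_neg, om_single hodd]

include hq in
theorem inv_inv' (hodd : Odd m) (φ : AlgA m N q →ₐ[ℂ] AlgA m N q)
    (hφ : ∀ a, φ (g m N q a) = g m N q a ^ (m - 1)) (a : AlgA m N q) : φ (φ a) = a := by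
  obtain ⟨F, hF⟩ := rho_exists (N := N) hq hodd
  apply (ev_bij hq hodd F hF).1
  change F (φ (φ a)) (dl m N) = F a (dl m N)
  rw [rf_conj hq hodd F hF φ hφ, rf_conj hq hodd F hF φ hφ]
  congr 1
  calc _ = (Rf m N * Rf m N) * F a * (Rf m N * Rf m N) := by simp only [mul_assoc]
    _ = _ := by rw [Rf_Rf, mul_one, one_mul]

include hq in
theorem fix_dim (hodd : Odd m) (φ : AlgA m N q →ₐ[ℂ] AlgA m N q)
    (hφ : ∀ a, φ (g m N q a) = g m N q a ^ (m - 1)) :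
    2 * Module.finrank ℂ (AlgHom.equalizer φ (AlgHom.id ℂ (AlgA m N q))) = m ^ (2 * N) + 1 := by
  obtain ⟨F, hF⟩ := rho_exists (N := N) hq hodd
  have hbij := ev_bij hq hodd F hF
  set e := LinearEquiv.ofBijective _ hbij with he
  have hev : ∀ a, e (φ a) = Rf m N (e a) := by
    intro a
    change F (φ a) (dl m N) = Rf m N (F a (dl m N))
    rw [rf_conj hq hodd F hF φ hφ, Module.End.mul_apply, Module.End.mul_apply, Rf_dl]
  rw [← fixed_dim hodd]
  congr 1
  change Module.finrank ℂ (Subalgebra.toSubmodule (AlgHom.equalizer φ (AlgHom.id ℂ (AlgA m N q)))) = _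
  rw [← LinearEquiv.finrank_map_eq e]
  suffices hEq : Submodule.map (e : AlgA m N q →ₗ[ℂ] _) (Subalgebra.toSubmodule
      (AlgHom.equalizer φ (AlgHom.id ℂ (AlgA m N q)))) = LinearMap.ker (Rf m N - 1) by
    rw [hEq]
  ext f
  rw [Submodule.mem_map, LinearMap.mem_ker, LinearMap.sub_apply, sub_eq_zero]
  constructor
  · rintro ⟨a, ha, rfl⟩
    have ha' : φ a = a := ha
    change Rf m N (e a) = e a
    rw [← hev, ha']
  · intro h
    refine ⟨e.symm f, ?_, by simp⟩
    change φ (e.symm f) = e.symm f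
    apply e.injective
    rw [hev]
    simpa using h
end

theorem statement13 (m : ℕ) (hm : 3 ≤ m) (hodd : Odd m) (q : ℂ)
    (hq : IsPrimitiveRoot q m) (n : ℕ) (hn : 2 ≤ n) :
    (∃! φ : AlgA m (n - 1) q ≃ₐ[ℂ] AlgA m (n - 1) q,
      (∀ i : Fin (n - 1), φ (U m (n - 1) q i) = U m (n - 1) q i ^ (m - 1)) ∧
      (∀ i : Fin (n - 1), φ (V m (n - 1) q i) = V m (n - 1) q i ^ (m - 1))) ∧
    (∀ φ : AlgA m (n - 1) q ≃ₐ[ℂ] AlgA m (n - 1) q,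
      ((∀ i : Fin (n - 1), φ (U m (n - 1) q i) = U m (n - 1) q i ^ (m - 1)) ∧
       (∀ i : Fin (n - 1), φ (V m (n - 1) q i) = V m (n - 1) q i ^ (m - 1))) →
      (∀ a, φ (φ a) = a) ∧
      2 * Module.finrank ℂ
          (AlgHom.equalizer (φ : AlgA m (n - 1) q →ₐ[ℂ] AlgA m (n - 1) q)
            (AlgHom.id ℂ (AlgA m (n - 1) q))) =
        m ^ (2 * (n - 1)) + 1) := by
  have : NeZero m := ⟨by omega⟩
  have hq1 : q ^ m = 1 := hq.pow_eq_one
  have conv : ∀ φ : AlgA m (n - 1) q ≃ₐ[ℂ] AlgA m (n - 1) q,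
      ((∀ i : Fin (n - 1), φ (U m (n - 1) q i) = U m (n - 1) q i ^ (m - 1)) ∧
       (∀ i : Fin (n - 1), φ (V m (n - 1) q i) = V m (n - 1) q i ^ (m - 1))) →
      ∀ a, (φ : AlgA m (n - 1) q →ₐ[ℂ] AlgA m (n - 1) q) (g m (n - 1) q a) =
        g m (n - 1) q a ^ (m - 1) := by
    rintro φ ⟨h1, h2⟩ (i | i)
    · exact h1 i
    · exact h2 i
  refine ⟨?_, ?_⟩
  · obtain ⟨φ, hφ⟩ := exists_inv (N := n - 1) hq1 hodd
    refine ⟨AlgEquiv.ofAlgHom φ φ (AlgHom.ext (inv_inv' hq1 hodd φ hφ))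
      (AlgHom.ext (inv_inv' hq1 hodd φ hφ)), ⟨fun i => hφ (.u i), fun i => hφ (.v i)⟩, ?_⟩
    intro φ' h'
    have h := hom_ext (φ' : AlgA m (n - 1) q →ₐ[ℂ] AlgA m (n - 1) q) φ
      (fun a => by rw [hφ]; exact conv φ' h' a)
    apply AlgEquiv.ext
    intro a
    exact DFunLike.congr_fun h a
  · intro φ h
    exact ⟨inv_inv' hq1 hodd _ (conv φ h), fix_dim hq1 hodd _ (conv φ h)⟩


end Stmt13
end

section
/- For n ≥ 3 odd, the fixed-point subalgebra 𝒞ₙ of the inversion automorphism ι on 𝒜ₙ(ℤ_m × ℤ_m, χ) is isomorphic as a ℂ-algebra to the direct product of two matrix algebras M_{(m^{n−1}+1)/2}(ℂ) × M_{(m^{n−1}−1)/2}(ℂ); in particular it is a direct sum of two simple algebras of dimensions ((m^{n−1}±1)/2)². -/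
/-! Proof -/

namespace Stmt14

/-- Generators u_i, v_i (i = 1,…,n−1, indexed by `Fin N` with `N = n−1`)
of 𝒜ₙ(ℤ_m × ℤ_m, χ). -/
inductive GenA (N : ℕ) : Type
  | u (i : Fin N) : GenA N
  | v (i : Fin N) : GenA N

/-- The underlying index of a generator. -/
def idx {N : ℕ} : GenA N → ℕ
  | GenA.u i => (i : ℕ)
  | GenA.v i => (i : ℕ)

open GenA in
/-- The defining relations of 𝒜ₙ(ℤ_m × ℤ_m, χ): u_i^m = v_i^m = 1,
u_iv_i = v_iu_i, u_iu_{i+1} = q u_{i+1}u_i, v_iv_{i+1} = q v_{i+1}v_i, and all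
other pairs of generators commute. -/
inductive RelA (m N : ℕ) (q : ℂ) :
    FreeAlgebra ℂ (GenA N) → FreeAlgebra ℂ (GenA N) → Prop
  | upow (i : Fin N) : RelA m N q (FreeAlgebra.ι ℂ (u i) ^ m) 1
  | vpow (i : Fin N) : RelA m N q (FreeAlgebra.ι ℂ (v i) ^ m) 1
  | uvsame (i : Fin N) :
      RelA m N q (FreeAlgebra.ι ℂ (u i) * FreeAlgebra.ι ℂ (v i))
        (FreeAlgebra.ι ℂ (v i) * FreeAlgebra.ι ℂ (u i))
  | uuadj (i j : Fin N) (hij : (j : ℕ) = (i : ℕ) + 1) :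
      RelA m N q (FreeAlgebra.ι ℂ (u i) * FreeAlgebra.ι ℂ (u j))
        (q • (FreeAlgebra.ι ℂ (u j) * FreeAlgebra.ι ℂ (u i)))
  | vvadj (i j : Fin N) (hij : (j : ℕ) = (i : ℕ) + 1) :
      RelA m N q (FreeAlgebra.ι ℂ (v i) * FreeAlgebra.ι ℂ (v j))
        (q • (FreeAlgebra.ι ℂ (v j) * FreeAlgebra.ι ℂ (v i)))
  | uvadj (i j : Fin N) (hij : (j : ℕ) = (i : ℕ) + 1) :
      RelA m N q (FreeAlgebra.ι ℂ (u i) * FreeAlgebra.ι ℂ (v j))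
        (FreeAlgebra.ι ℂ (v j) * FreeAlgebra.ι ℂ (u i))
  | vuadj (i j : Fin N) (hij : (j : ℕ) = (i : ℕ) + 1) :
      RelA m N q (FreeAlgebra.ι ℂ (v i) * FreeAlgebra.ι ℂ (u j))
        (FreeAlgebra.ι ℂ (u j) * FreeAlgebra.ι ℂ (v i))
  | far (a b : GenA N) (hab : 2 ≤ |(idx a : ℤ) - (idx b : ℤ)|) :
      RelA m N q (FreeAlgebra.ι ℂ a * FreeAlgebra.ι ℂ b)
        (FreeAlgebra.ι ℂ b * FreeAlgebra.ι ℂ a)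

/-- The algebra 𝒜ₙ(ℤ_m × ℤ_m, χ) (with `N = n − 1`). -/
abbrev AlgA (m N : ℕ) (q : ℂ) : Type := RingQuot (RelA m N q)

/-- The generator u_i of 𝒜ₙ(ℤ_m × ℤ_m, χ). -/
noncomputable def U (m N : ℕ) (q : ℂ) (i : Fin N) : AlgA m N q :=
  RingQuot.mkAlgHom ℂ (RelA m N q) (FreeAlgebra.ι ℂ (GenA.u i))

/-- The generator v_i of 𝒜ₙ(ℤ_m × ℤ_m, χ). -/
noncomputable def V (m N : ℕ) (q : ℂ) (i : Fin N) : AlgA m N q :=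
  RingQuot.mkAlgHom ℂ (RelA m N q) (FreeAlgebra.ι ℂ (GenA.v i))


/-- Power hom from `ZMod m`. -/
def powHom {A : Type*} [Monoid A] (m : ℕ) [NeZero m] (x : A) (hx : x ^ m = 1) :
    Multiplicative (ZMod m) →* A where
  toFun k := x ^ (k.toAdd.val)
  map_one' := by simp
  map_mul' a b := by
    rw [toAdd_mul, ZMod.val_add, ← pow_eq_pow_mod _ hx, pow_add]

lemma span_lemma {A : Type*} [Ring A] [Algebra ℂ A] (m N : ℕ) (hm : 3 ≤ m)
    (s t : Fin N → A) (hs : ∀ i, s i ^ m = 1) (ht : ∀ i, t i ^ m = 1)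
    (hss : ∀ i j, Commute (s i) (s j)) (htt : ∀ i j, Commute (t i) (t j))
    (hts : ∀ j i, ∃ c : ℂ, t j * s i = c • (s i * t j))
    (hgen : Algebra.adjoin ℂ (Set.range s ∪ Set.range t) = ⊤) :
    FiniteDimensional ℂ A ∧ Module.finrank ℂ A ≤ m ^ N * m ^ N := by
  classical
  have : NeZero m := ⟨by omega⟩
  have cs : Pairwise fun i j => ∀ x y, Commute (powHom m (s i) (hs i) x) (powHom m (s j) (hs j) y) :=
    fun i j _ x y => (hss i j).pow_pow _ _
  have ct : Pairwise fun i j => ∀ x y, Commute (powHom m (t i) (ht i) x) (powHom m (t j) (ht j) y) :=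
    fun i j _ x y => (htt i j).pow_pow _ _
  let S := MonoidHom.noncommPiCoprod (fun i => powHom m (s i) (hs i)) cs
  let T := MonoidHom.noncommPiCoprod (fun i => powHom m (t i) (ht i)) ct
  have h1 : (ZMod.val (1 : ZMod m)) = 1 := by
    have : Fact (1 < m) := ⟨by omega⟩
    exact ZMod.val_one m
  have Ss : ∀ i, S (Pi.mulSingle i (Multiplicative.ofAdd 1)) = s i := fun i => by
    simp only [S]
    rw [MonoidHom.noncommPiCoprod_mulSingle]
    simp [powHom, h1]
  have Tt : ∀ i, T (Pi.mulSingle i (Multiplicative.ofAdd 1)) = t i := fun i => by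
    simp only [T]
    rw [MonoidHom.noncommPiCoprod_mulSingle]
    simp [powHom, h1]
  have comm : ∀ j a, ∃ c : ℂ, t j * S a = c • (S a * t j) := by
    intro j a
    let K : Submonoid A :=
      { carrier := {x | ∃ c : ℂ, t j * x = c • (x * t j)}
        one_mem' := ⟨1, by simp⟩
        mul_mem' := by
          rintro x y ⟨c, hc⟩ ⟨d, hd⟩
          refine ⟨c * d, ?_⟩
          rw [← mul_assoc, hc, smul_mul_assoc, mul_assoc, hd, mul_smul_comm, smul_smul, mul_assoc] }
    have : MonoidHom.mrange S ≤ K := by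
      simp only [S]
      rw [MonoidHom.noncommPiCoprod_mrange]
      refine iSup_le fun i => ?_
      rintro _ ⟨k, rfl⟩
      exact K.pow_mem (hts j i) _
    exact this ⟨a, rfl⟩
  let b : (Fin N → Multiplicative (ZMod m)) × (Fin N → Multiplicative (ZMod m)) → A :=
    fun p => S p.1 * T p.2
  let M := Submodule.span ℂ (Set.range b)
  have key : ∀ x : A, ∀ y ∈ M, x * y ∈ M := by
    let K : Subalgebra ℂ A :=
      { carrier := {x | ∀ y ∈ M, x * y ∈ M}
        mul_mem' := fun {x y} hx hy z hz => by rw [mul_assoc]; exact hx _ (hy _ hz)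
        add_mem' := fun {x y} hx hy z hz => by rw [add_mul]; exact M.add_mem (hx _ hz) (hy _ hz)
        algebraMap_mem' := fun r z hz => by
          rw [Algebra.algebraMap_eq_smul_one, smul_mul_assoc, one_mul]; exact M.smul_mem _ hz }
    have mk : ∀ x : A, (∀ p, x * b p ∈ M) → x ∈ K := by
      intro x hx y hy
      have : M ≤ M.comap (LinearMap.mulLeft ℂ x) := by
        refine Submodule.span_le.2 ?_
        rintro _ ⟨p, rfl⟩
        exact hx p
      exact this hy
    have : (⊤ : Subalgebra ℂ A) ≤ K := by
      rw [← hgen]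
      refine Algebra.adjoin_le ?_
      rintro x (⟨i, rfl⟩ | ⟨i, rfl⟩)
      · refine mk _ fun p => Submodule.subset_span ⟨(Pi.mulSingle i (Multiplicative.ofAdd 1) * p.1, p.2), ?_⟩
        simp only [b, map_mul, Ss, mul_assoc]
      · refine mk _ fun p => ?_
        obtain ⟨c, hc⟩ := comm i p.1
        have : t i * b p = c • b (p.1, Pi.mulSingle i (Multiplicative.ofAdd 1) * p.2) := by
          simp only [b, map_mul, Tt]
          rw [← mul_assoc, hc, smul_mul_assoc, mul_assoc]
        rw [this]
        exact M.smul_mem _ (Submodule.subset_span ⟨_, rfl⟩)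
    exact fun x => this (Algebra.mem_top)
  have top : M = ⊤ := by
    refine eq_top_iff.2 fun x _ => ?_
    have h := key x 1 (Submodule.subset_span ⟨1, by simp [b]⟩)
    simpa using h
  have fin : FiniteDimensional ℂ A :=
    ⟨by rw [← top]; exact Submodule.fg_span (Set.finite_range b)⟩
  refine ⟨fin, ?_⟩
  have h := finrank_range_le_card (R := ℂ) b
  rw [Set.finrank] at h
  change Module.finrank ℂ M ≤ _ at h
  rw [top, finrank_top] at h
  refine h.trans (le_of_eq ?_)
  simp [ZMod.card]

lemma eq_neg_zero {V : Type*} [AddCommGroup V] [Module ℂ V] {x : V} (h : x = -x) : x = 0 := by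
  have h2 : (2 : ℂ) • x = 0 := by
    rw [two_smul]
    nth_rewrite 2 [h]
    exact add_neg_cancel x
  simpa using h2

lemma basis_lemma {V : Type*} [AddCommGroup V] [Module ℂ V] [FiniteDimensional ℂ V]
    (P : Module.End ℂ V) (hP : P * P = 1) :
    ∃ (a b : ℕ) (B : Module.Basis (Fin a ⊕ Fin b) ℂ V),
      LinearMap.toMatrix B B P = Matrix.fromBlocks 1 0 0 (-1) := by
  have hPP : ∀ v, P (P v) = v := fun v => by
    have := congrArg (fun f => f v) hP
    simpa using this
  let W₁ := LinearMap.ker (P - 1)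
  let W₂ := LinearMap.ker (P + 1)
  have m1 : ∀ v, v ∈ W₁ ↔ P v = v := fun v => by simp [W₁, sub_eq_zero]
  have m2 : ∀ v, v ∈ W₂ ↔ P v = -v := fun v => by simp [W₂, ← eq_neg_iff_add_eq_zero]
  have hc : IsCompl W₁ W₂ := by
    constructor
    · rw [Submodule.disjoint_def]
      intro x h1 h2
      rw [m1] at h1
      rw [m2, h1] at h2
      exact eq_neg_zero h2
    · rw [codisjoint_iff, eq_top_iff]
      intro x _
      have : x = (2⁻¹ : ℂ) • (x + P x) + (2⁻¹ : ℂ) • (x - P x) := by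
        rw [← smul_add, add_add_sub_cancel, ← two_smul ℂ x, smul_smul]; simp
      rw [this]
      refine Submodule.add_mem_sup (W₁.smul_mem _ ?_) (W₂.smul_mem _ ?_)
      · rw [m1, map_add, hPP, add_comm]
      · rw [m2, map_sub, hPP, neg_sub]
  let B := ((Module.finBasis ℂ W₁).prod (Module.finBasis ℂ W₂)).map
    (Submodule.prodEquivOfIsCompl W₁ W₂ hc)
  refine ⟨_, _, B, ?_⟩
  have e1 : ∀ i, P (B (Sum.inl i)) = B (Sum.inl i) := fun i => by
    rw [← m1]; simp [B]
  have e2 : ∀ i, P (B (Sum.inr i)) = - B (Sum.inr i) := fun i => by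
    rw [← m2]; simp [B]
  ext i j
  rw [LinearMap.toMatrix_apply]
  rcases j with j | j
  · rw [e1, Module.Basis.repr_self]
    rcases i with i | i
    · rw [Matrix.fromBlocks_apply₁₁, Matrix.one_apply, Finsupp.single_apply]
      simp only [Sum.inl.injEq, eq_comm]
    · rw [Matrix.fromBlocks_apply₂₁, Finsupp.single_apply]
      simp
  · rw [e2, map_neg, Module.Basis.repr_self]
    rcases i with i | i
    · rw [Matrix.fromBlocks_apply₁₂, Finsupp.neg_apply, Finsupp.single_apply]
      simp
    · rw [Matrix.fromBlocks_apply₂₂, Matrix.neg_apply, Matrix.one_apply, Finsupp.neg_apply,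
        Finsupp.single_apply]
      simp only [Sum.inr.injEq, eq_comm]

/-- block diagonal hom -/
def blk (a b : ℕ) : (Matrix (Fin a) (Fin a) ℂ × Matrix (Fin b) (Fin b) ℂ) →ₐ[ℂ]
    Matrix (Fin a ⊕ Fin b) (Fin a ⊕ Fin b) ℂ where
  toFun p := Matrix.fromBlocks p.1 0 0 p.2
  map_one' := by simp
  map_zero' := by simp
  map_mul' p r := by simp [Matrix.fromBlocks_multiply]
  map_add' p r := by simp [Matrix.fromBlocks_add]
  commutes' r := by
    ext i j
    rcases i with i | i <;> rcases j with j | j <;>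
      simp [Matrix.algebraMap_matrix_apply]

lemma blk_comm {a b : ℕ} (M : Matrix (Fin a ⊕ Fin b) (Fin a ⊕ Fin b) ℂ)
    (h : Matrix.fromBlocks 1 0 0 (-1) * M = M * Matrix.fromBlocks 1 0 0 (-1)) :
    ∃ p, blk a b p = M := by
  refine ⟨(M.toBlocks₁₁, M.toBlocks₂₂), ?_⟩
  rw [← Matrix.fromBlocks_toBlocks M] at h
  simp only [Matrix.fromBlocks_multiply, Matrix.fromBlocks_inj] at h
  obtain ⟨-, h1, h2, -⟩ := h
  simp only [Matrix.one_mul, Matrix.zero_mul, Matrix.mul_zero, Matrix.mul_one, zero_add, add_zero,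
    Matrix.mul_neg, Matrix.neg_mul] at h1 h2
  have h1' : M.toBlocks₁₂ = 0 := eq_neg_zero h1
  have h2' : M.toBlocks₂₁ = 0 := eq_neg_zero h2.symm
  conv_rhs => rw [← Matrix.fromBlocks_toBlocks M]
  rw [h1', h2']
  rfl

lemma blk_comm' {a b : ℕ} (p) :
    Matrix.fromBlocks 1 0 0 (-1) * blk a b p = blk a b p * Matrix.fromBlocks 1 0 0 (-1) := by
  simp [blk, Matrix.fromBlocks_multiply]

lemma final_lemma {A : Type*} [Ring A] [Algebra ℂ A] {V : Type*} [AddCommGroup V] [Module ℂ V]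
    [FiniteDimensional ℂ V] (ρ : A ≃ₐ[ℂ] Module.End ℂ V) (P : Module.End ℂ V) (hP : P * P = 1)
    (d : ℕ) (hd : Module.finrank ℂ V = d) (htr : LinearMap.trace ℂ V P = 1)
    (φ : A →ₐ[ℂ] A) (hφ : ∀ x, ρ (φ x) = P * ρ x * P) :
    Nonempty (AlgHom.equalizer φ (AlgHom.id ℂ A) ≃ₐ[ℂ]
      (Matrix (Fin ((d + 1) / 2)) (Fin ((d + 1) / 2)) ℂ ×
        Matrix (Fin ((d - 1) / 2)) (Fin ((d - 1) / 2)) ℂ)) := by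
  obtain ⟨a, b, B, hB⟩ := basis_lemma P hP
  have hab : d = a + b := by
    rw [← hd, Module.finrank_eq_card_basis B]; simp
  have hab' : a = b + 1 := by
    rw [LinearMap.trace_eq_matrix_trace ℂ B, hB] at htr
    simp [Matrix.trace, Fintype.sum_sum_type] at htr
    have : (a : ℂ) = ((b + 1 : ℕ) : ℂ) := by push_cast; linear_combination htr
    exact_mod_cast this
  have ha : (d + 1) / 2 = a := by omega
  have hb : (d - 1) / 2 = b := by omega
  rw [ha, hb]
  let σ : A ≃ₐ[ℂ] Matrix (Fin a ⊕ Fin b) (Fin a ⊕ Fin b) ℂ := ρ.trans (LinearMap.toMatrixAlgEquiv B)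
  have hσ : ∀ x, σ (φ x) = Matrix.fromBlocks 1 0 0 (-1) * σ x * Matrix.fromBlocks 1 0 0 (-1) := by
    intro x
    rw [← hB]
    simp only [σ, AlgEquiv.trans_apply, hφ, map_mul]
    rfl
  have sq : (Matrix.fromBlocks 1 0 0 (-1) : Matrix (Fin a ⊕ Fin b) (Fin a ⊕ Fin b) ℂ) *
      Matrix.fromBlocks 1 0 0 (-1) = 1 := by simp [Matrix.fromBlocks_multiply]
  let Ψ := (σ.symm : _ →ₐ[ℂ] A).comp (blk a b)
  have inj : Function.Injective Ψ := by
    refine σ.symm.injective.comp ?_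
    intro p r h
    have h' : Matrix.fromBlocks p.1 0 0 p.2 = Matrix.fromBlocks r.1 0 0 r.2 := h
    rw [Matrix.fromBlocks_inj] at h'
    exact Prod.ext h'.1 h'.2.2.2
  have hr : Ψ.range = AlgHom.equalizer φ (AlgHom.id ℂ A) := by
    ext x
    rw [AlgHom.mem_equalizer, AlgHom.id_apply, ← σ.injective.eq_iff, hσ]
    constructor
    · rintro ⟨p, rfl⟩
      have : σ (Ψ p) = blk a b p := σ.apply_symm_apply _
      change _ * σ (Ψ p) * _ = σ (Ψ p)
      rw [this, blk_comm', mul_assoc, sq, mul_one]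
    · intro h
      obtain ⟨p, hp⟩ := blk_comm (σ x) (by
        conv_rhs => rw [← h]
        rw [mul_assoc, sq, mul_one])
      refine ⟨p, ?_⟩
      change σ.symm (blk a b p) = x
      rw [hp, σ.symm_apply_apply]
  exact ⟨((AlgEquiv.ofInjective Ψ inj).trans (Subalgebra.equivOfEq _ _ hr)).symm⟩

section rep
variable {m N : ℕ}

/-- shifted extension by zero -/
def yy (x : Fin N → ZMod m) (k : ℕ) : ZMod m :=
  if h : 1 ≤ k ∧ k - 1 < N then x ⟨k - 1, h.2⟩ else 0

lemma yy_add (x z : Fin N → ZMod m) (k : ℕ) : yy (x + z) k = yy x k + yy z k := by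
  unfold yy; split_ifs <;> simp

lemma yy_neg (x : Fin N → ZMod m) (k : ℕ) : yy (-x) k = - yy x k := by
  unfold yy; split_ifs <;> simp

lemma yy_sub (x z : Fin N → ZMod m) (k : ℕ) : yy (x - z) k = yy x k - yy z k := by
  rw [sub_eq_add_neg, yy_add, yy_neg, sub_eq_add_neg]

lemma yy_single (i : Fin N) (k : ℕ) :
    yy (Pi.single i (1 : ZMod m)) k = if k = i + 1 then 1 else 0 := by
  have := i.2
  unfold yy
  split_ifs with h h' h'
  · have : (⟨k - 1, h.2⟩ : Fin N) = i := Fin.ext (by simp; omega)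
    rw [this, Pi.single_eq_same]
  · refine Pi.single_eq_of_ne ?_ _
    intro h2
    have := congrArg Fin.val h2
    simp at this
    omega
  · omega
  · rfl

lemma yy_inj (hN : Even N) (x : Fin N → ZMod m) (h : ∀ j : Fin N, yy x j = yy x (j + 2)) :
    x = 0 := by
  have h0 : yy x 0 = 0 := by simp [yy]
  have hl : yy x (N + 1) = 0 := by simp [yy]
  have ev : ∀ k, 2 * k ≤ N → yy x (2 * k) = 0 := by
    intro k
    induction k with
    | zero => intro _; exact h0
    | succ k ih =>
      intro hk
      have := h ⟨2 * k, by omega⟩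
      simp only at this
      rw [show 2 * (k + 1) = 2 * k + 2 by ring, ← this]
      exact ih (by omega)
  have od : ∀ k, 2 * k ≤ N → yy x (N + 1 - 2 * k) = 0 := by
    intro k
    induction k with
    | zero => intro _; exact hl
    | succ k ih =>
      intro hk
      have := h ⟨N + 1 - 2 * (k + 1), by omega⟩
      simp only at this
      rw [this, show N + 1 - 2 * (k + 1) + 2 = N + 1 - 2 * k by omega]
      exact ih (by omega)
  obtain ⟨r, hr⟩ := hN
  funext i
  have hi := i.2
  have hx : x i = yy x (i + 1) := by simp [yy]
  rw [hx]
  rcases Nat.even_or_odd (i : ℕ) with ⟨k, hk⟩ | ⟨k, hk⟩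
  · have := od (r - k) (by omega)
    rwa [show N + 1 - 2 * (r - k) = i + 1 by omega] at this
  · have := ev (k + 1) (by omega)
    rwa [show 2 * (k + 1) = i + 1 by omega] at this

/-- translation -/
noncomputable def Tr (a : Fin N → ZMod m) : Module.End ℂ ((Fin N → ZMod m) → ℂ) :=
  LinearMap.funLeft ℂ ℂ (fun x => x + a)

/-- parity -/
noncomputable def Pa (m N : ℕ) : Module.End ℂ ((Fin N → ZMod m) → ℂ) :=
  LinearMap.funLeft ℂ ℂ (fun x => -x)

/-- multiplication -/
noncomputable def Dg (g : (Fin N → ZMod m) → ℂ) : Module.End ℂ ((Fin N → ZMod m) → ℂ) :=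
  Algebra.lmul ℂ ((Fin N → ZMod m) → ℂ) g

/-- the characters -/
noncomputable def dd (χ : AddChar (ZMod m) ℂ) (j : ℕ) : (Fin N → ZMod m) → ℂ :=
  fun x => χ (yy x j - yy x (j + 2))

@[simp] lemma Tr_apply (a : Fin N → ZMod m) (f) (x) : Tr a f x = f (x + a) := rfl
@[simp] lemma Pa_apply (f) (x : Fin N → ZMod m) : Pa m N f x = f (-x) := rfl
@[simp] lemma Dg_apply (g) (f) (x : Fin N → ZMod m) : Dg g f x = g x * f x := rfl

lemma Tr_add (a b : Fin N → ZMod m) : Tr (a + b) = Tr a * Tr b := by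
  refine LinearMap.ext fun f => funext fun x => ?_
  simp [add_assoc]

lemma Tr_zero : Tr (0 : Fin N → ZMod m) = 1 := by
  refine LinearMap.ext fun f => funext fun x => ?_
  simp

lemma Dg_mul (a b : (Fin N → ZMod m) → ℂ) : Dg (a * b) = Dg a * Dg b := by
  refine LinearMap.ext fun f => funext fun x => ?_
  simp [mul_assoc]

lemma Dg_one : Dg (1 : (Fin N → ZMod m) → ℂ) = 1 := by
  refine LinearMap.ext fun f => funext fun x => ?_
  simp

lemma Tr_pow (a : Fin N → ZMod m) (k : ℕ) : Tr a ^ k = Tr (k • a) := by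
  induction k with
  | zero => simp [Tr_zero]
  | succ k ih => rw [pow_succ, ih, succ_nsmul, Tr_add]

lemma Dg_pow (a : (Fin N → ZMod m) → ℂ) (k : ℕ) : Dg a ^ k = Dg (a ^ k) := by
  induction k with
  | zero => simp [Dg_one]
  | succ k ih => rw [pow_succ, ih, pow_succ, Dg_mul]

lemma Tr_pow_m (a : Fin N → ZMod m) : Tr a ^ m = 1 := by
  rw [Tr_pow, ← Tr_zero]
  congr 1
  funext i
  simp

lemma dd_pow_m (χ : AddChar (ZMod m) ℂ) (j : ℕ) : Dg (N := N) (dd χ j) ^ m = 1 := by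
  rw [Dg_pow, ← Dg_one]
  congr 1
  funext x
  simp only [dd, Pi.pow_apply, Pi.one_apply]
  rw [← AddChar.map_nsmul_eq_pow]
  simp

lemma Tr_comm (a b : Fin N → ZMod m) : Tr a * Tr b = Tr b * Tr a := by
  rw [← Tr_add, add_comm, Tr_add]

lemma Dg_comm (a b : (Fin N → ZMod m) → ℂ) : Dg a * Dg b = Dg b * Dg a := by
  rw [← Dg_mul, mul_comm, Dg_mul]

lemma Tr_Dg (χ : AddChar (ZMod m) ℂ) (i j : Fin N) :
    Tr (Pi.single i 1) * Dg (dd χ j) =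
      χ ((if (j : ℕ) = i + 1 then 1 else 0) - (if (j : ℕ) + 1 = i then 1 else 0)) •
        (Dg (dd χ j) * Tr (Pi.single i 1)) := by
  refine LinearMap.ext fun f => funext fun x => ?_
  simp only [Module.End.mul_apply, Tr_apply, Dg_apply, LinearMap.smul_apply, Pi.smul_apply, dd,
    smul_eq_mul, yy_add, yy_single]
  rw [← mul_assoc, ← AddChar.map_add_eq_mul]
  congr 2
  have : ((j : ℕ) + 2 = i + 1) ↔ ((j : ℕ) + 1 = i) := by omega
  simp only [this]
  ring

lemma Pa_sq : Pa m N * Pa m N = 1 := by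
  refine LinearMap.ext fun f => funext fun x => ?_
  simp

lemma Tr_Pa (a : Fin N → ZMod m) : Tr a * (Pa m N * Tr a * Pa m N) = 1 := by
  refine LinearMap.ext fun f => funext fun x => ?_
  simp

lemma Dg_Pa (χ : AddChar (ZMod m) ℂ) (j : ℕ) :
    Dg (dd χ j) * (Pa m N * Dg (dd χ j) * Pa m N) = 1 := by
  refine LinearMap.ext fun f => funext fun x => ?_
  simp only [Module.End.mul_apply, Dg_apply, Pa_apply, dd, yy_neg, neg_neg, Module.End.one_apply]
  rw [← mul_assoc, ← AddChar.map_add_eq_mul]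
  simp

lemma Pa_trace [NeZero m] (hm : Odd m) : LinearMap.trace ℂ _ (Pa m N) = 1 := by
  classical
  rw [LinearMap.trace_eq_matrix_trace ℂ (Pi.basisFun ℂ (Fin N → ZMod m)), Matrix.trace]
  rw [Finset.sum_eq_single 0]
  · simp
  · intro x _ hx
    simp only [Matrix.diag_apply, LinearMap.toMatrix_apply, Pi.basisFun_apply, Pi.basisFun_repr,
      Pa_apply]
    refine Pi.single_eq_of_ne ?_ _
    intro h
    apply hx
    funext i
    have := congrFun h i
    simp only [Pi.neg_apply] at this
    have := (ZMod.neg_eq_self_iff _).1 this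
    rcases this with h | h
    · exact h
    · exfalso
      obtain ⟨k, hk⟩ := hm
      omega
  · simp

/-- surjectivity core -/
lemma surj_lemma [NeZero m] (hN : Even N) (χ : AddChar (ZMod m) ℂ)
    (hχ : Function.Injective χ) (R : Subalgebra ℂ (Module.End ℂ ((Fin N → ZMod m) → ℂ)))
    (h1 : ∀ i, Tr (Pi.single i 1) ∈ R) (h2 : ∀ j : Fin N, Dg (dd χ j) ∈ R) : R = ⊤ := by
  classical
  let D : Subalgebra ℂ ((Fin N → ZMod m) → ℂ) := R.comap (Algebra.lmul ℂ _)
  have hsep : ∀ x z : Fin N → ZMod m, x ≠ z → ∃ g ∈ D, g x = 1 ∧ g z = 0 := by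
    intro x z hxz
    have : ∃ j : Fin N, dd χ j x ≠ dd χ j z := by
      by_contra! hc
      apply hxz
      rw [← sub_eq_zero]
      apply yy_inj hN
      intro j
      have := hχ (hc j)
      rw [yy_sub, yy_sub]
      linear_combination this
    obtain ⟨j, hj⟩ := this
    refine ⟨(dd χ j x - dd χ j z)⁻¹ • (dd χ j - algebraMap ℂ _ (dd χ j z)),
      D.smul_mem (D.sub_mem (h2 j) (D.algebraMap_mem _)) _, ?_, ?_⟩
    · simp [inv_mul_cancel₀ (sub_ne_zero.2 hj)]
    · simp
  have hdel : ∀ x : Fin N → ZMod m, (Pi.single x 1 : (Fin N → ZMod m) → ℂ) ∈ D := by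
    intro x
    choose! g hg using hsep x
    have : (Pi.single x 1 : (Fin N → ZMod m) → ℂ) = ∏ z ∈ Finset.univ.erase x, g z := by
      funext w
      rw [Finset.prod_apply]
      by_cases hw : w = x
      · subst hw
        rw [Pi.single_eq_same, Finset.prod_eq_one]
        intro z hz
        exact (hg z (Finset.ne_of_mem_erase hz).symm).2.1
      · rw [Pi.single_eq_of_ne hw, eq_comm]
        refine Finset.prod_eq_zero (Finset.mem_erase.2 ⟨hw, Finset.mem_univ w⟩) ?_
        exact (hg w (Ne.symm hw)).2.2
    rw [this]
    exact D.prod_mem fun z hz => (hg z (Finset.ne_of_mem_erase hz).symm).1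
  have hTr : ∀ a : Fin N → ZMod m, Tr a ∈ R := by
    let K : AddSubmonoid (Fin N → ZMod m) :=
      { carrier := {a | Tr a ∈ R}
        zero_mem' := by
          change Tr 0 ∈ R
          rw [Tr_zero]; exact R.one_mem
        add_mem' := fun {a b} ha hb => by
          change Tr (a + b) ∈ R
          rw [Tr_add]; exact R.mul_mem ha hb }
    intro a
    change a ∈ K
    rw [← Finset.univ_sum_single a]
    refine K.sum_mem fun i _ => ?_
    have : Pi.single i (a i) = (a i).val • (Pi.single i 1 : Fin N → ZMod m) := by
      rw [← Pi.single_smul']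
      simp
    rw [this]
    exact K.nsmul_mem (h1 i) _
  rw [eq_top_iff]
  intro f _
  have : f = ∑ x, ∑ y, (f (Pi.single y 1) x) • (Dg (Pi.single x 1) * Tr (y - x)) := by
    refine LinearMap.ext fun g => funext fun z => ?_
    rw [LinearMap.pi_apply_eq_sum_univ f g]
    simp only [LinearMap.sum_apply, Finset.sum_apply, LinearMap.smul_apply, Pi.smul_apply,
      Module.End.mul_apply, Dg_apply, Tr_apply, smul_eq_mul]
    symm
    rw [Finset.sum_eq_single z]
    · refine Finset.sum_congr rfl fun y _ => ?_
      have : (fun j => if y = j then (1 : ℂ) else 0) = Pi.single y 1 := by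
        funext j
        simp [Pi.single_apply, eq_comm]
      simp [this, mul_comm]
    · intro b _ hb
      refine Finset.sum_eq_zero fun y _ => ?_
      rw [Pi.single_eq_of_ne hb.symm]
      simp
    · simp
  rw [this]
  exact R.sum_mem fun x _ => R.sum_mem fun y _ => R.smul_mem (R.mul_mem (hdel x) (hTr _)) _

end rep

attribute [irreducible] Tr Dg dd

section alg
variable {m N : ℕ} {q : ℂ}

lemma U_pow (i) : U m N q i ^ m = 1 := by
  have := RingQuot.mkAlgHom_rel ℂ (RelA.upow (m := m) (N := N) (q := q) i)
  simpa [U] using this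

lemma V_pow (i) : V m N q i ^ m = 1 := by
  have := RingQuot.mkAlgHom_rel ℂ (RelA.vpow (m := m) (N := N) (q := q) i)
  simpa [V] using this

lemma UV_comm (i j) : Commute (U m N q i) (V m N q j) := by
  unfold Commute SemiconjBy U V
  rw [← map_mul, ← map_mul]
  rcases lt_trichotomy (i : ℕ) j with h | h | h
  · rcases eq_or_lt_of_le (Nat.succ_le_of_lt h) with h' | h'
    · exact RingQuot.mkAlgHom_rel ℂ (RelA.uvadj i j h'.symm)
    · refine RingQuot.mkAlgHom_rel ℂ (RelA.far _ _ ?_)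
      simp only [idx]
      rw [le_abs]; omega
  · obtain rfl := Fin.ext h
    exact RingQuot.mkAlgHom_rel ℂ (RelA.uvsame i)
  · rcases eq_or_lt_of_le (Nat.succ_le_of_lt h) with h' | h'
    · exact (RingQuot.mkAlgHom_rel ℂ (RelA.vuadj j i h'.symm)).symm
    · refine RingQuot.mkAlgHom_rel ℂ (RelA.far _ _ ?_)
      simp only [idx]
      rw [le_abs]; omega

lemma UU_comm (i j : Fin N) (h1 : (j : ℕ) ≠ i + 1) (h2 : (i : ℕ) ≠ j + 1) :
    Commute (U m N q i) (U m N q j) := by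
  by_cases h : i = j
  · rw [h]
  · unfold Commute SemiconjBy U
    rw [← map_mul, ← map_mul]
    refine RingQuot.mkAlgHom_rel ℂ (RelA.far _ _ ?_)
    have : (i : ℕ) ≠ j := fun h' => h (Fin.ext h')
    simp only [idx]
    rw [le_abs]; omega

lemma VV_comm (i j : Fin N) (h1 : (j : ℕ) ≠ i + 1) (h2 : (i : ℕ) ≠ j + 1) :
    Commute (V m N q i) (V m N q j) := by
  by_cases h : i = j
  · rw [h]
  · unfold Commute SemiconjBy V
    rw [← map_mul, ← map_mul]
    refine RingQuot.mkAlgHom_rel ℂ (RelA.far _ _ ?_)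
    have : (i : ℕ) ≠ j := fun h' => h (Fin.ext h')
    simp only [idx]
    rw [le_abs]; omega

lemma UU_q (hq : q ≠ 0) (i j : Fin N) :
    ∃ c : ℂ, U m N q i * U m N q j = c • (U m N q j * U m N q i) := by
  by_cases h1 : (j : ℕ) = i + 1
  · have := RingQuot.mkAlgHom_rel ℂ (RelA.uuadj (m := m) (N := N) (q := q) i j h1)
    exact ⟨q, by simpa [U] using this⟩
  by_cases h2 : (i : ℕ) = j + 1
  · have := RingQuot.mkAlgHom_rel ℂ (RelA.uuadj (m := m) (N := N) (q := q) j i h2)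
    refine ⟨q⁻¹, ?_⟩
    rw [eq_inv_smul_iff₀ hq]
    symm
    simpa [U] using this
  · exact ⟨1, by rw [one_smul]; exact UU_comm i j h1 h2⟩

lemma VV_q (hq : q ≠ 0) (i j : Fin N) :
    ∃ c : ℂ, V m N q i * V m N q j = c • (V m N q j * V m N q i) := by
  by_cases h1 : (j : ℕ) = i + 1
  · have := RingQuot.mkAlgHom_rel ℂ (RelA.vvadj (m := m) (N := N) (q := q) i j h1)
    exact ⟨q, by simpa [V] using this⟩
  by_cases h2 : (i : ℕ) = j + 1
  · have := RingQuot.mkAlgHom_rel ℂ (RelA.vvadj (m := m) (N := N) (q := q) j i h2)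
    refine ⟨q⁻¹, ?_⟩
    rw [eq_inv_smul_iff₀ hq]
    symm
    simpa [V] using this
  · exact ⟨1, by rw [one_smul]; exact VV_comm i j h1 h2⟩

lemma alg_finite (hm : 3 ≤ m) (hq : q ≠ 0) :
    FiniteDimensional ℂ (AlgA m N q) ∧ Module.finrank ℂ (AlgA m N q) ≤ m ^ N * m ^ N := by
  refine span_lemma m N hm (fun i => if Even (i : ℕ) then U m N q i else V m N q i)
    (fun i => if Even (i : ℕ) then V m N q i else U m N q i) ?_ ?_ ?_ ?_ ?_ ?_
  · intro i; split_ifs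
    · exact U_pow i
    · exact V_pow i
  · intro i; split_ifs
    · exact V_pow i
    · exact U_pow i
  · intro i j; split_ifs with h1 h2 h2
    · exact UU_comm i j (by grind) (by grind)
    · exact UV_comm i j
    · exact (UV_comm j i).symm
    · exact VV_comm i j (by grind) (by grind)
  · intro i j; split_ifs with h1 h2 h2
    · exact VV_comm i j (by grind) (by grind)
    · exact (UV_comm j i).symm
    · exact UV_comm i j
    · exact UU_comm i j (by grind) (by grind)
  · intro i j; split_ifs with h1 h2 h2
    · exact ⟨1, by rw [one_smul]; exact (UV_comm j i).symm⟩
    · exact VV_q hq i j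
    · exact UU_q hq i j
    · exact ⟨1, by rw [one_smul]; exact UV_comm i j⟩
  · rw [eq_top_iff]
    have h : (RingQuot.mkAlgHom ℂ (RelA m N q)).range = ⊤ :=
      (AlgHom.range_eq_top _).2 (RingQuot.mkAlgHom_surjective ℂ _)
    rw [← h, ← Algebra.map_top, ← FreeAlgebra.adjoin_range_ι, AlgHom.map_adjoin]
    refine Algebra.adjoin_mono ?_
    rintro _ ⟨_, ⟨g, rfl⟩, rfl⟩
    rcases g with i | i
    · by_cases hi : Even (i : ℕ)
      · exact Or.inl ⟨i, by simp only [if_pos hi]; rfl⟩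
      · exact Or.inr ⟨i, by simp only [if_neg hi]; rfl⟩
    · by_cases hi : Even (i : ℕ)
      · exact Or.inr ⟨i, by simp only [if_pos hi]; rfl⟩
      · exact Or.inl ⟨i, by simp only [if_neg hi]; rfl⟩

/-- images of generators -/
noncomputable def gmap (χ : AddChar (ZMod m) ℂ) : GenA N → Module.End ℂ ((Fin N → ZMod m) → ℂ)
  | GenA.u i => if Even (i : ℕ) then Tr (Pi.single i 1) else Dg (dd χ i)
  | GenA.v i => if Even (i : ℕ) then Dg (dd χ i) else Tr (Pi.single i 1)

lemma TD_comm (χ : AddChar (ZMod m) ℂ) (i j : Fin N) (h1 : (j : ℕ) ≠ i + 1)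
    (h2 : (i : ℕ) ≠ j + 1) :
    Tr (Pi.single i 1) * Dg (dd χ j) = Dg (dd χ j) * Tr (Pi.single i 1) := by
  rw [Tr_Dg, if_neg h1, if_neg (Ne.symm h2)]; simp

lemma TD_q (χ : AddChar (ZMod m) ℂ) (hχ : χ 1 = q) (i j : Fin N) (h1 : (j : ℕ) = i + 1) :
    Tr (Pi.single i 1) * Dg (dd χ j) = q • (Dg (dd χ j) * Tr (Pi.single i 1)) := by
  rw [Tr_Dg, if_pos h1, if_neg (by omega)]; simp [hχ]

lemma DT_q (χ : AddChar (ZMod m) ℂ) (hχ : χ 1 = q) (i j : Fin N) (h1 : (j : ℕ) = i + 1) :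
    Dg (dd χ i) * Tr (Pi.single j 1) = q • (Tr (Pi.single j 1) * Dg (dd χ i)) := by
  rw [Tr_Dg, if_neg (by omega), if_pos h1.symm, smul_smul, ← hχ, ← AddChar.map_add_eq_mul]; simp

lemma gmap_rel (χ : AddChar (ZMod m) ℂ) (hχ : χ 1 = q) ⦃x y⦄ (h : RelA m N q x y) :
    FreeAlgebra.lift ℂ (gmap χ) x = FreeAlgebra.lift ℂ (gmap χ) y := by
  induction h with
  | upow i =>
    simp only [map_pow, map_one, FreeAlgebra.lift_ι_apply, gmap]
    split_ifs
    · exact Tr_pow_m _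
    · exact dd_pow_m _ _
  | vpow i =>
    simp only [map_pow, map_one, FreeAlgebra.lift_ι_apply, gmap]
    split_ifs
    · exact dd_pow_m _ _
    · exact Tr_pow_m _
  | uvsame i =>
    simp only [map_mul, FreeAlgebra.lift_ι_apply, gmap]
    split_ifs
    · exact TD_comm χ i i (by omega) (by omega)
    · exact (TD_comm χ i i (by omega) (by omega)).symm
  | uuadj i j hij =>
    simp only [map_mul, map_smul, FreeAlgebra.lift_ι_apply, gmap]
    split_ifs with h1 h2 h2
    · grind
    · exact TD_q χ hχ i j hij
    · exact DT_q χ hχ i j hij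
    · grind
  | vvadj i j hij =>
    simp only [map_mul, map_smul, FreeAlgebra.lift_ι_apply, gmap]
    split_ifs with h1 h2 h2
    · grind
    · exact DT_q χ hχ i j hij
    · exact TD_q χ hχ i j hij
    · grind
  | uvadj i j hij =>
    simp only [map_mul, FreeAlgebra.lift_ι_apply, gmap]
    split_ifs with h1 h2 h2
    · grind
    · exact Tr_comm _ _
    · exact Dg_comm _ _
    · grind
  | vuadj i j hij =>
    simp only [map_mul, FreeAlgebra.lift_ι_apply, gmap]
    split_ifs with h1 h2 h2
    · grind
    · exact Dg_comm _ _
    · exact Tr_comm _ _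
    · grind
  | far a b hab =>
    rw [le_abs] at hab
    simp only [map_mul, FreeAlgebra.lift_ι_apply]
    rcases a with i | i <;> rcases b with j | j <;> simp only [idx] at hab <;>
      simp only [gmap] <;> split_ifs <;>
      first
      | exact Tr_comm _ _
      | exact Dg_comm _ _
      | exact TD_comm χ _ _ (by omega) (by omega)
      | exact (TD_comm χ _ _ (by omega) (by omega)).symm

end alg

theorem statement14 (m : ℕ) (hm : 3 ≤ m) (hodd : Odd m) (q : ℂ)
    (hq : IsPrimitiveRoot q m) (n : ℕ) (hn : Odd n) (hn3 : 3 ≤ n) :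
    ∀ φ : AlgA m (n - 1) q ≃ₐ[ℂ] AlgA m (n - 1) q,
      ((∀ i : Fin (n - 1), φ (U m (n - 1) q i) = U m (n - 1) q i ^ (m - 1)) ∧
       (∀ i : Fin (n - 1), φ (V m (n - 1) q i) = V m (n - 1) q i ^ (m - 1))) →
      Nonempty
        ((AlgHom.equalizer (φ : AlgA m (n - 1) q →ₐ[ℂ] AlgA m (n - 1) q)
            (AlgHom.id ℂ (AlgA m (n - 1) q))) ≃ₐ[ℂ]
          (Matrix (Fin ((m ^ (n - 1) + 1) / 2)) (Fin ((m ^ (n - 1) + 1) / 2)) ℂ ×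
            Matrix (Fin ((m ^ (n - 1) - 1) / 2)) (Fin ((m ^ (n - 1) - 1) / 2)) ℂ)) := by
  rintro φ ⟨hU, hV⟩
  have hN : Even (n - 1) := by grind
  generalize n - 1 = N at *
  have : NeZero m := ⟨by omega⟩
  let χ : AddChar (ZMod m) ℂ := AddChar.zmodChar m hq.pow_eq_one
  have hχ1 : χ 1 = q := by
    have := AddChar.zmodChar_apply' hq.pow_eq_one 1
    simpa using this
  have hχ : Function.Injective χ := by
    intro a b hab
    simp only [χ, AddChar.zmodChar_apply] at hab
    exact ZMod.val_injective m (hq.pow_inj (ZMod.val_lt a) (ZMod.val_lt b) hab)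
  let ρ : AlgA m N q →ₐ[ℂ] Module.End ℂ ((Fin N → ZMod m) → ℂ) :=
    RingQuot.liftAlgHom ℂ ⟨FreeAlgebra.lift ℂ (gmap χ), gmap_rel χ hχ1⟩
  have hρ : ∀ g, ρ (RingQuot.mkAlgHom ℂ (RelA m N q) (FreeAlgebra.ι ℂ g)) = gmap χ g := by
    intro g
    simp only [ρ]
    rw [RingQuot.liftAlgHom_mkAlgHom_apply, FreeAlgebra.lift_ι_apply]
  have surj : Function.Surjective ρ := by
    rw [← AlgHom.range_eq_top]
    refine surj_lemma hN χ hχ _ (fun i => ?_) (fun i => ?_)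
    · by_cases hi : Even (i : ℕ)
      · exact ⟨_, (hρ (GenA.u i)).trans (by simp [gmap, hi])⟩
      · exact ⟨_, (hρ (GenA.v i)).trans (by simp [gmap, hi])⟩
    · by_cases hi : Even (i : ℕ)
      · exact ⟨_, (hρ (GenA.v i)).trans (by simp [gmap, hi])⟩
      · exact ⟨_, (hρ (GenA.u i)).trans (by simp [gmap, hi])⟩
  obtain ⟨hfin, hrank⟩ := alg_finite (m := m) (N := N) (q := q) hm (hq.ne_zero (by omega))
  have hdV : Module.finrank ℂ ((Fin N → ZMod m) → ℂ) = m ^ N := by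
    simp [ZMod.card]
  have hdE : Module.finrank ℂ (Module.End ℂ ((Fin N → ZMod m) → ℂ)) = m ^ N * m ^ N := by
    rw [Module.finrank_linearMap, hdV]
  have hle := LinearMap.finrank_le_finrank_of_surjective (f := ρ.toLinearMap) surj
  have heq : Module.finrank ℂ (AlgA m N q) =
    Module.finrank ℂ (Module.End ℂ ((Fin N → ZMod m) → ℂ)) := by omega
  have inj : Function.Injective ρ :=
    (LinearMap.injective_iff_surjective_of_finrank_eq_finrank (f := ρ.toLinearMap) heq).2 surj
  let σ := AlgEquiv.ofBijective ρ ⟨inj, surj⟩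
  have hPa := Pa_sq (m := m) (N := N)
  let cj : Module.End ℂ ((Fin N → ZMod m) → ℂ) →ₐ[ℂ] Module.End ℂ ((Fin N → ZMod m) → ℂ) :=
    AlgHom.ofLinearMap (LinearMap.mulRight ℂ (Pa m N) ∘ₗ LinearMap.mulLeft ℂ (Pa m N))
      (by simp [hPa]) (by
        intro x y
        simp only [LinearMap.comp_apply, LinearMap.mulLeft_apply, LinearMap.mulRight_apply]
        calc Pa m N * (x * y) * Pa m N = Pa m N * x * 1 * y * Pa m N := by
              rw [mul_one, mul_assoc (Pa m N) x y]
          _ = _ := by rw [← hPa]; simp only [mul_assoc])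
  have hcj : ∀ x, cj x = Pa m N * x * Pa m N := fun x => rfl
  have aux : ∀ x y : Module.End ℂ ((Fin N → ZMod m) → ℂ), x ^ m = 1 → x * y = 1 →
      x ^ (m - 1) = y := by
    intro x y hx hxy
    calc x ^ (m - 1) = x ^ (m - 1) * (x * y) := by rw [hxy, mul_one]
      _ = x ^ (m - 1 + 1) * y := by rw [← mul_assoc, pow_succ]
      _ = y := by rw [Nat.sub_add_cancel (by omega), hx, one_mul]
  have hcomp : ρ.comp (φ : AlgA m N q →ₐ[ℂ] AlgA m N q) = cj.comp ρ := by
    refine RingQuot.ringQuot_ext' ℂ _ _ (FreeAlgebra.hom_ext (funext fun g => ?_))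
    rcases g with i | i
    · change ρ (φ (U m N q i)) = cj (ρ (U m N q i))
      rw [hU, map_pow, U, hρ, hcj]
      refine aux _ _ ?_ ?_ <;> simp only [gmap] <;> split_ifs
      · exact Tr_pow_m _
      · exact dd_pow_m _ _
      · exact Tr_Pa _
      · exact Dg_Pa _ _
    · change ρ (φ (V m N q i)) = cj (ρ (V m N q i))
      rw [hV, map_pow, V, hρ, hcj]
      refine aux _ _ ?_ ?_ <;> simp only [gmap] <;> split_ifs
      · exact dd_pow_m _ _
      · exact Tr_pow_m _
      · exact Dg_Pa _ _
      · exact Tr_Pa _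
  exact final_lemma σ (Pa m N) hPa (m ^ N) hdV (Pa_trace hodd) _
    (fun x => AlgHom.congr_fun hcomp x)

end Stmt14
end
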